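/- Let γ > 0 and ρ_a, ρ_b ∈ [0,1]. There is r0 ∈ (0,1) such that for every r ∈ (0,r0), with q1(t) and q2(t) the contour integrals defined in the context, the function σ²(t) := (ρ_a−ρ_b)²·(2·q2(t) − q1(t)²) + (ρ_a+ρ_b−2ρ_aρ_b)·q1(t) satisfies lim_{t→∞} σ²(t)/√t = (1/√(2πγ))·[(ρ_a+ρ_b−2ρ_aρ_b) − (ρ_a−ρ_b)²/√2]. -/

import Mathlib

open Filter

/-- `∮_{|z|=ρ} f(z) dz/(2πiz)`: the normalized contour integral over the counterclockwise
circle of radius `ρ` centered at the origin. -/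
noncomputable def cint (ρ : ℝ) (f : ℂ → ℂ) : ℂ :=
  (2 * Real.pi * Complex.I)⁻¹ * (∮ z in C(0, ρ), f z / z)

/-- `c(z) = (z + 1/z)/2`. -/
noncomputable def cfun (z : ℂ) : ℂ := (z + z⁻¹) / 2

/-- `ε_γ(z) = -z + 1/z - 2γ`. -/
noncomputable def epsfun (γ : ℂ) (z : ℂ) : ℂ := -z + z⁻¹ - 2 * γ

/-- The contour-integral expression for `q1(t)`. -/
noncomputable def q1 (γ r : ℝ) (t : ℝ) : ℂ :=
  cint r fun z1 => cint 1 fun z2 =>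
    Complex.exp (t * (epsfun γ z1 + epsfun γ z2)) *
      ((cfun z1 - cfun z2) / (cfun z1 - cfun z2 - 2 * γ)) *
      (z1 * z2 / (1 - z1 * z2) ^ 2)

noncomputable def A1 (γ : ℝ) (z1 z2 z3 z4 : ℂ) : ℂ :=
  ((cfun z1 - cfun z3) / (cfun z1 - cfun z3 - 2 * γ)) *
    ((cfun z2 - cfun z4) / (cfun z2 - cfun z4 - 2 * γ)) *
    ((cfun z1 - cfun z4 - 4 * γ) / (cfun z1 - cfun z4 - 2 * γ))

noncomputable def A2 (γ : ℝ) (z1 z2 z3 z4 : ℂ) : ℂ :=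
  (2 * γ * (cfun z1 + cfun z2 - cfun z3 - cfun z4) /
      ((cfun z2 - cfun z3 - 2 * γ) * (cfun z1 - cfun z4 - 2 * γ))) *
    ((cfun z2 - cfun z4 - 4 * γ) / (cfun z2 - cfun z4 - 2 * γ))

/-- The contour-integral expression for `q2(t)`. -/
noncomputable def q2 (γ r : ℝ) (t : ℝ) : ℂ :=
  cint (r ^ 3) fun z1 => cint (r ^ 2) fun z2 => cint r fun z3 => cint 1 fun z4 =>
    Complex.exp (t * (epsfun γ z1 + epsfun γ z2 + epsfun γ z3 + epsfun γ z4)) *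
      (z1 * z2 * z3 * z4 / (1 - z1 * z2 * z3 * z4) ^ 2) *
      (z1 * z2 / (1 - z1 * z2)) *
      ((cfun z1 - cfun z2) / (cfun z1 - cfun z2 - 2 * γ)) *
      ((cfun z3 - cfun z4) / (cfun z3 - cfun z4 - 2 * γ)) *
      (z3 * z4 / (1 - z3 * z4) - 2 * (z1 * z3 / (1 - z1 * z3)) * A1 γ z1 z2 z3 z4 +
        z1 * z2 / (1 - z1 * z2) * (1 + A2 γ z1 z2 z3 z4))

namespace VarianceAsymptotics

open MeasureTheory Complex Set Topology

/-! ### Haar measure on the circle group -/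

noncomputable section

instance : Fact (0 < 2 * Real.pi) := ⟨Real.two_pi_pos⟩

instance : MeasurableSpace Circle := borel Circle
instance : BorelSpace Circle := ⟨rfl⟩

/-- The circle group carries its Haar probability measure. -/
instance : MeasureSpace Circle :=
  ⟨Measure.map (AddCircle.toCircle (T := 2 * Real.pi)) AddCircle.haarAddCircle⟩

lemma measurable_toCircle : Measurable (AddCircle.toCircle (T := 2 * Real.pi)) :=
  AddCircle.continuous_toCircle.measurable

lemma surjective_toCircle : Function.Surjective (AddCircle.toCircle (T := 2 * Real.pi)) := by
  intro a
  obtain ⟨x, hx⟩ := (AddCircle.homeomorphCircle Real.two_pi_pos.ne').surjective a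
  exact ⟨x, by rw [← hx, AddCircle.homeomorphCircle_apply]⟩

lemma volume_circle_eq : (volume : Measure Circle) =
    Measure.map (AddCircle.toCircle (T := 2 * Real.pi)) AddCircle.haarAddCircle := rfl

instance : IsProbabilityMeasure (volume : Measure Circle) := by
  rw [volume_circle_eq]
  exact Measure.isProbabilityMeasure_map measurable_toCircle.aemeasurable

instance : Measure.IsMulLeftInvariant (volume : Measure Circle) := by
  constructor
  intro g
  obtain ⟨x, rfl⟩ := surjective_toCircle g
  rw [volume_circle_eq, Measure.map_map (measurable_const_mul _) measurable_toCircle]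
  have : (fun y => AddCircle.toCircle x * y) ∘ (AddCircle.toCircle (T := 2 * Real.pi)) =
      AddCircle.toCircle ∘ fun y => x + y := by
    funext y; simp [AddCircle.toCircle_add]
  rw [this, ← Measure.map_map measurable_toCircle (measurable_const_add x), map_add_left_eq_self]

instance : Measure.IsHaarMeasure (volume : Measure Circle) :=
  Measure.isHaarMeasure_of_isCompact_nonempty_interior _ univ isCompact_univ
    (by simp) (by simp) (by simp)

lemma integral_circle_eq (g : Circle → ℂ) (a : ℝ) :
    ∫ z, g z = (2 * Real.pi : ℝ)⁻¹ • ∫ θ in Ioc a (a + 2 * Real.pi), g (Circle.exp θ) := by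
  have hemb : MeasurableEmbedding (AddCircle.toCircle (T := 2 * Real.pi)) := by
    have := (AddCircle.homeomorphCircle (T := 2 * Real.pi) Real.two_pi_pos.ne').measurableEmbedding
    convert this using 1
    funext x; simp [AddCircle.homeomorphCircle_apply]
  rw [volume_circle_eq, hemb.integral_map, AddCircle.integral_haarAddCircle,
    ← AddCircle.integral_preimage (2 * Real.pi) a]
  congr 1
  apply integral_congr_ae
  refine ae_of_all _ fun θ => ?_
  simp only [AddCircle.toCircle_apply_mk]
  congr 2
  field_simp

lemma cint_eq (ρ : ℝ) (hρ : ρ ≠ 0) (f : ℂ → ℂ) : cint ρ f = ∫ a : Circle, f (ρ * a) := by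
  rw [integral_circle_eq _ 0, cint, circleIntegral,
    intervalIntegral.integral_of_le (by positivity), zero_add]
  have : ∀ θ : ℝ, deriv (circleMap 0 ρ) θ • (f (circleMap 0 ρ θ) / circleMap 0 ρ θ) =
      I * f (ρ * Circle.exp θ) := by
    intro θ
    have h0 : circleMap 0 ρ θ ≠ 0 := by simp [hρ]
    have h1 : circleMap 0 ρ θ = ρ * Circle.exp θ := by simp [circleMap]
    have hr : (ρ : ℂ) * Circle.exp θ ≠ 0 := h1 ▸ h0
    rw [deriv_circleMap, smul_eq_mul, h1]
    generalize (ρ : ℂ) * Circle.exp θ = w at hr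
    field_simp
  simp_rw [this]
  rw [integral_const_mul, real_smul]
  have := I_ne_zero
  push_cast
  field_simp

end

section

/-! ### Moving contours in one variable -/

lemma cint_congr {ρ : ℝ} {f g : ℂ → ℂ} (hρ : 0 < ρ) (h : ∀ z, ‖z‖ = ρ → f z = g z) :
    cint ρ f = cint ρ g := by
  unfold cint
  congr 1
  refine circleIntegral.integral_congr hρ.le fun z hz => ?_
  simp only [h z (by simpa using hz)]

lemma cint_annulus_aux {r R : ℝ} (hr : 0 < r) (hR : r ≤ R) (f : ℂ → ℂ) {s : Set ℂ}
    (hs : s.Countable) (hc : ∀ z, r ≤ ‖z‖ → ‖z‖ ≤ R → ContinuousAt f z)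
    (hd : ∀ z, r ≤ ‖z‖ → ‖z‖ ≤ R → z ∉ s → DifferentiableAt ℂ f z) :
    cint R f = cint r f := by
  have h := circleIntegral_sub_center_inv_smul_eq_of_differentiable_on_annulus_off_countable
    (c := 0) hr hR (f := f) hs
    (fun z hz => by
      simp only [Set.mem_sdiff, Metric.mem_closedBall, dist_zero_right, Metric.mem_ball, not_lt] at hz
      exact (hc z hz.2 hz.1).continuousWithinAt)
    (fun z hz => by
      simp only [Set.mem_sdiff, Metric.mem_closedBall, dist_zero_right, Metric.mem_ball, not_le] at hz
      exact hd z hz.1.2.le hz.1.1.le hz.2)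
  unfold cint
  simpa [div_eq_inv_mul] using congrArg (fun w => (2 * Real.pi * Complex.I)⁻¹ * w) h

lemma cint_annulus {r R : ℝ} (hr : 0 < r) (hR : r ≤ R) (f : ℂ → ℂ)
    (hd : ∀ z, r ≤ ‖z‖ → ‖z‖ ≤ R → DifferentiableAt ℂ f z) : cint R f = cint r f :=
  cint_annulus_aux hr hR f countable_empty (fun z h1 h2 => (hd z h1 h2).continuousAt)
    fun z h1 h2 _ => hd z h1 h2

lemma cint_disc {R : ℝ} (hR : 0 < R) (f : ℂ → ℂ)
    (hd : ∀ z, ‖z‖ ≤ R → DifferentiableAt ℂ f z) : cint R f = f 0 := by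
  have h := Complex.circleIntegral_sub_inv_smul_of_differentiable_on_off_countable
    (c := 0) (w := 0) (R := R) (f := f) countable_empty (by simpa using hR)
    (fun z hz => (hd z (by simpa using hz)).continuousAt.continuousWithinAt)
    (fun z hz => hd z (le_of_lt (by simpa using hz.1)))
  unfold cint
  have h2 : (2 * Real.pi * Complex.I : ℂ) ≠ 0 := by simp [Real.pi_ne_zero]
  simp only [sub_zero, smul_eq_mul] at h
  simp only [div_eq_inv_mul, h]
  field_simp

lemma cint_cross {r R : ℝ} (hr : 0 < r) (p : ℂ) (h1 : r < ‖p‖) (h2 : ‖p‖ < R) (g : ℂ → ℂ)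
    (hd : ∀ z, r ≤ ‖z‖ → ‖z‖ ≤ R → DifferentiableAt ℂ g z) :
    cint R (fun z => z / (z - p) * g z) - cint r (fun z => z / (z - p) * g z) = g p := by
  have key : ∀ ρ, 0 < ρ → ρ ≠ ‖p‖ → r ≤ ρ → ρ ≤ R → cint ρ (fun z => z / (z - p) * g z) =
      cint ρ (fun z => z * dslope g p z) + g p * cint ρ (fun z => z / (z - p)) := by
    intro ρ hρ hρp h3 h4
    unfold cint
    rw [mul_left_comm, ← mul_add, ← circleIntegral.integral_const_mul (g p),
      ← circleIntegral.integral_add]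
    · congr 1
      refine circleIntegral.integral_congr hρ.le fun z hz => ?_
      have hz' : ‖z‖ = ρ := by simpa using hz
      have hzp : z - p ≠ 0 := by
        rw [sub_ne_zero]; rintro rfl; exact hρp hz'.symm
      have hz0 : z ≠ 0 := by rintro rfl; simp at hz'; exact hρ.ne hz'
      simp only [dslope_of_ne _ (sub_ne_zero.mp hzp), slope_def_field]
      field_simp
      ring
    · refine ContinuousOn.circleIntegrable hρ.le fun z hz => ContinuousAt.continuousWithinAt ?_
      have hz' : ‖z‖ = ρ := by simpa using hz
      have hzp : z ≠ p := by rintro rfl; exact hρp hz'.symm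
      have hz0 : z ≠ 0 := by rintro rfl; simp at hz'; exact hρ.ne hz'
      refine ContinuousAt.div₀ (continuousAt_id.mul ?_) continuousAt_id hz0
      exact (continuousAt_dslope_of_ne hzp).2 (hd z (hz' ▸ h3) (hz' ▸ h4)).continuousAt
    · refine ContinuousOn.circleIntegrable hρ.le fun z hz => ContinuousAt.continuousWithinAt ?_
      have hz' : ‖z‖ = ρ := by simpa using hz
      have hzp : z - p ≠ 0 := by rw [sub_ne_zero]; rintro rfl; exact hρp hz'.symm
      have hz0 : z ≠ 0 := by rintro rfl; simp at hz'; exact hρ.ne hz'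
      fun_prop (disch := assumption)
  have hann : cint R (fun z => z * dslope g p z) = cint r (fun z => z * dslope g p z) := by
    refine cint_annulus_aux hr (h1.trans h2).le _ (s := {p}) (countable_singleton p) ?_ ?_
    · intro z h3 h4
      refine continuousAt_id.mul ?_
      by_cases hzp : z = p
      · subst hzp; exact continuousAt_dslope_same.2 (hd z h3 h4)
      · exact (continuousAt_dslope_of_ne hzp).2 (hd z h3 h4).continuousAt
    · intro z h3 h4 hzp
      exact differentiableAt_id.mul ((differentiableAt_dslope_of_ne hzp).2 (hd z h3 h4))
  have h2π : (2 * Real.pi * Complex.I : ℂ) ≠ 0 := by simp [Real.pi_ne_zero]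
  have hout : cint R (fun z => z / (z - p)) = 1 := by
    have := circleIntegral.integral_sub_inv_of_mem_ball (c := 0) (w := p) (R := R) (by simpa using h2)
    unfold cint
    rw [circleIntegral.integral_congr (g := fun z => (z - p)⁻¹) (by linarith), this,
      inv_mul_cancel₀ h2π]
    intro z hz
    have hz0 : z ≠ 0 := by rintro rfl; simp at hz; linarith
    simp only []
    field_simp
  have hin : cint r (fun z => z / (z - p)) = 0 := by
    rw [cint_disc hr]
    · simp
    · intro z hz
      have hzp : z - p ≠ 0 := by rw [sub_ne_zero]; rintro rfl; linarith
      fun_prop (disch := assumption)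
  rw [key R (by linarith) h2.ne' (h1.trans h2).le le_rfl, key r hr h1.ne le_rfl (h1.trans h2).le,
    hann, hout, hin]
  ring

/-! ### Normalized integrals over four-dimensional tori -/

/-- The normalized integral of `f` over `|z₁| = r₁, …, |z₄| = r₄`. -/
noncomputable def M4 (r1 r2 r3 r4 : ℝ) (f : ℂ → ℂ → ℂ → ℂ → ℂ) : ℂ :=
  ∫ p : Circle × Circle × Circle × Circle, f (r1 * p.1) (r2 * p.2.1) (r3 * p.2.2.1) (r4 * p.2.2.2)

/-- Joint complex differentiability at a point. -/
def DiffAt (f : ℂ → ℂ → ℂ → ℂ → ℂ) (a b c d : ℂ) : Prop :=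
  DifferentiableAt ℂ (fun p : ℂ × ℂ × ℂ × ℂ => f p.1 p.2.1 p.2.2.1 p.2.2.2) (a, b, c, d)

lemma DiffAt.left {f : ℂ → ℂ → ℂ → ℂ → ℂ} {a b c d : ℂ} (h : DiffAt f a b c d) :
    DifferentiableAt ℂ (fun z => f z b c d) a :=
  DifferentiableAt.comp (g := fun p : ℂ × ℂ × ℂ × ℂ => f p.1 p.2.1 p.2.2.1 p.2.2.2)
    (f := fun z => (z, b, c, d)) a h (by fun_prop)

/-- Continuity at every point of a torus. -/
def ContT (r1 r2 r3 r4 : ℝ) (f : ℂ → ℂ → ℂ → ℂ → ℂ) : Prop :=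
  ∀ a b c d : ℂ, ‖a‖ = r1 → ‖b‖ = r2 → ‖c‖ = r3 → ‖d‖ = r4 →
    ContinuousAt (fun p : ℂ × ℂ × ℂ × ℂ => f p.1 p.2.1 p.2.2.1 p.2.2.2) (a, b, c, d)

lemma norm_mul_circle {r : ℝ} (hr : 0 ≤ r) (a : Circle) : ‖(r * a : ℂ)‖ = r := by
  rw [norm_mul, Circle.norm_coe, Complex.norm_real, Real.norm_of_nonneg hr, mul_one]

structure Pos4 (r1 r2 r3 r4 : ℝ) : Prop where
  p1 : 0 < r1
  p2 : 0 < r2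
  p3 : 0 < r3
  p4 : 0 < r4

variable {r1 r2 r3 r4 : ℝ} {f g : ℂ → ℂ → ℂ → ℂ → ℂ}

lemma ContT.continuous (hr : Pos4 r1 r2 r3 r4) (hf : ContT r1 r2 r3 r4 f) :
    Continuous fun p : Circle × Circle × Circle × Circle =>
      f (r1 * p.1) (r2 * p.2.1) (r3 * p.2.2.1) (r4 * p.2.2.2) := by
  rw [continuous_iff_continuousAt]
  intro p
  exact ContinuousAt.comp (g := fun p : ℂ × ℂ × ℂ × ℂ => f p.1 p.2.1 p.2.2.1 p.2.2.2)
    (f := fun p : Circle × Circle × Circle × Circle =>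
      ((r1 * p.1 : ℂ), (r2 * p.2.1 : ℂ), (r3 * p.2.2.1 : ℂ), (r4 * p.2.2.2 : ℂ)))
    (hf _ _ _ _ (norm_mul_circle hr.p1.le _) (norm_mul_circle hr.p2.le _)
      (norm_mul_circle hr.p3.le _) (norm_mul_circle hr.p4.le _)) (by fun_prop)

lemma integrable_of_continuous {X : Type*} [TopologicalSpace X] [CompactSpace X]
    [SecondCountableTopology X]
    [MeasurableSpace X] [BorelSpace X] (μ : Measure X) [IsFiniteMeasure μ] {F : X → ℂ}
    (h : Continuous F) : Integrable F μ :=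
  h.integrable_of_hasCompactSupport (HasCompactSupport.of_compactSpace F)

lemma ContT.integrable (hr : Pos4 r1 r2 r3 r4) (hf : ContT r1 r2 r3 r4 f) :
    Integrable fun p : Circle × Circle × Circle × Circle =>
      f (r1 * p.1) (r2 * p.2.1) (r3 * p.2.2.1) (r4 * p.2.2.2) :=
  integrable_of_continuous _ (hf.continuous hr)

lemma ContT.of_diffAt (h : ∀ a b c d : ℂ, ‖a‖ = r1 → ‖b‖ = r2 → ‖c‖ = r3 → ‖d‖ = r4 →
    DiffAt f a b c d) : ContT r1 r2 r3 r4 f :=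
  fun a b c d h1 h2 h3 h4 => (h a b c d h1 h2 h3 h4).continuousAt

lemma M4_congr (hr : Pos4 r1 r2 r3 r4)
    (h : ∀ a b c d : ℂ, ‖a‖ = r1 → ‖b‖ = r2 → ‖c‖ = r3 → ‖d‖ = r4 → f a b c d = g a b c d) :
    M4 r1 r2 r3 r4 f = M4 r1 r2 r3 r4 g := by
  unfold M4
  congr 1
  funext p
  exact h _ _ _ _ (norm_mul_circle hr.p1.le _) (norm_mul_circle hr.p2.le _)
      (norm_mul_circle hr.p3.le _) (norm_mul_circle hr.p4.le _)

lemma M4_add (hr : Pos4 r1 r2 r3 r4) (hf : ContT r1 r2 r3 r4 f) (hg : ContT r1 r2 r3 r4 g) :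
    M4 r1 r2 r3 r4 (fun a b c d => f a b c d + g a b c d) =
      M4 r1 r2 r3 r4 f + M4 r1 r2 r3 r4 g :=
  integral_add (hf.integrable hr) (hg.integrable hr)

lemma M4_sub (hr : Pos4 r1 r2 r3 r4) (hf : ContT r1 r2 r3 r4 f) (hg : ContT r1 r2 r3 r4 g) :
    M4 r1 r2 r3 r4 (fun a b c d => f a b c d - g a b c d) =
      M4 r1 r2 r3 r4 f - M4 r1 r2 r3 r4 g :=
  integral_sub (hf.integrable hr) (hg.integrable hr)

lemma M4_const_mul (k : ℂ) :
    M4 r1 r2 r3 r4 (fun a b c d => k * f a b c d) = k * M4 r1 r2 r3 r4 f :=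
  integral_const_mul _ _

instance : (volume : Measure (Circle × Circle)).IsHaarMeasure :=
  Measure.prod.instIsHaarMeasure volume volume

instance : (volume : Measure (Circle × Circle × Circle)).IsHaarMeasure :=
  Measure.prod.instIsHaarMeasure volume volume

instance : (volume : Measure (Circle × Circle × Circle × Circle)).IsHaarMeasure :=
  Measure.prod.instIsHaarMeasure volume volume

lemma M4_swap12 (r1 r2 r3 r4 : ℝ) (f : ℂ → ℂ → ℂ → ℂ → ℂ) :
    M4 r1 r2 r3 r4 f = M4 r2 r1 r3 r4 (fun a b c d => f b a c d) := by
  let e : Circle × Circle × Circle × Circle ≃ₜ Circle × Circle × Circle × Circle :=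
    { toFun := fun p => (p.2.1, p.1, p.2.2)
      invFun := fun p => (p.2.1, p.1, p.2.2)
      left_inv := fun p => rfl
      right_inv := fun p => rfl }
  let h : Circle × Circle × Circle × Circle →* Circle × Circle × Circle × Circle :=
    { toFun := e, map_one' := rfl, map_mul' := fun p q => rfl }
  have hm : MeasurePreserving e volume volume :=
    MonoidHom.measurePreserving (f := h) e.continuous e.surjective rfl
  unfold M4
  rw [← hm.integral_comp e.measurableEmbedding]
  rfl

lemma M4_swap23 (r1 r2 r3 r4 : ℝ) (f : ℂ → ℂ → ℂ → ℂ → ℂ) :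
    M4 r1 r2 r3 r4 f = M4 r1 r3 r2 r4 (fun a b c d => f a c b d) := by
  let e : Circle × Circle × Circle × Circle ≃ₜ Circle × Circle × Circle × Circle :=
    { toFun := fun p => (p.1, p.2.2.1, p.2.1, p.2.2.2)
      invFun := fun p => (p.1, p.2.2.1, p.2.1, p.2.2.2)
      left_inv := fun p => rfl
      right_inv := fun p => rfl }
  let h : Circle × Circle × Circle × Circle →* Circle × Circle × Circle × Circle :=
    { toFun := e, map_one' := rfl, map_mul' := fun p q => rfl }
  have hm : MeasurePreserving e volume volume :=
    MonoidHom.measurePreserving (f := h) e.continuous e.surjective rfl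
  unfold M4
  rw [← hm.integral_comp e.measurableEmbedding]
  rfl

lemma M4_swap34 (r1 r2 r3 r4 : ℝ) (f : ℂ → ℂ → ℂ → ℂ → ℂ) :
    M4 r1 r2 r3 r4 f = M4 r1 r2 r4 r3 (fun a b c d => f a b d c) := by
  let e : Circle × Circle × Circle × Circle ≃ₜ Circle × Circle × Circle × Circle :=
    { toFun := fun p => (p.1, p.2.1, p.2.2.2, p.2.2.1)
      invFun := fun p => (p.1, p.2.1, p.2.2.2, p.2.2.1)
      left_inv := fun p => rfl
      right_inv := fun p => rfl }
  let h : Circle × Circle × Circle × Circle →* Circle × Circle × Circle × Circle :=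
    { toFun := e, map_one' := rfl, map_mul' := fun p q => rfl }
  have hm : MeasurePreserving e volume volume :=
    MonoidHom.measurePreserving (f := h) e.continuous e.surjective rfl
  unfold M4
  rw [← hm.integral_comp e.measurableEmbedding]
  rfl

lemma M4_inv (r1 r2 r3 r4 : ℝ) (f : ℂ → ℂ → ℂ → ℂ → ℂ) :
    M4 r1 r2 r3 r4 f = M4 r1⁻¹ r2 r3 r4 (fun a b c d => f a⁻¹ b c d) := by
  let e : Circle × Circle × Circle × Circle ≃ₜ Circle × Circle × Circle × Circle :=
    { toFun := fun p => (p.1⁻¹, p.2)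
      invFun := fun p => (p.1⁻¹, p.2)
      left_inv := fun p => by simp
      right_inv := fun p => by simp }
  let h : Circle × Circle × Circle × Circle →* Circle × Circle × Circle × Circle :=
    { toFun := e, map_one' := by simp [e], map_mul' := fun p q => by simp [e, mul_comm] }
  have hm : MeasurePreserving e volume volume :=
    MonoidHom.measurePreserving (f := h) e.continuous e.surjective rfl
  unfold M4
  rw [← hm.integral_comp e.measurableEmbedding]
  refine integral_congr_ae (ae_of_all _ fun p => ?_)
  simp [e, mul_comm]

lemma M4_eq_iterated (hr : Pos4 r1 r2 r3 r4) (hf : ContT r1 r2 r3 r4 f) :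
    M4 r1 r2 r3 r4 f = ∫ q : Circle × Circle × Circle,
      cint r1 (fun z => f z (r2 * q.1) (r3 * q.2.1) (r4 * q.2.2)) := by
  unfold M4
  rw [Measure.volume_eq_prod, integral_prod_symm _ (hf.integrable hr)]
  simp_rw [cint_eq r1 hr.p1.ne']

lemma M4_move {r R : ℝ} (hr : Pos4 r r2 r3 r4) (hR : r ≤ R)
    (hd : ∀ a b c d : ℂ, r ≤ ‖a‖ → ‖a‖ ≤ R → ‖b‖ = r2 → ‖c‖ = r3 → ‖d‖ = r4 → DiffAt f a b c d) :
    M4 R r2 r3 r4 f = M4 r r2 r3 r4 f := by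
  have hR' : Pos4 R r2 r3 r4 := ⟨hr.p1.trans_le hR, hr.p2, hr.p3, hr.p4⟩
  rw [M4_eq_iterated hR' (.of_diffAt fun a b c d h1 h2 h3 h4 =>
      hd a b c d (h1 ▸ hR) h1.le h2 h3 h4),
    M4_eq_iterated hr (.of_diffAt fun a b c d h1 h2 h3 h4 =>
      hd a b c d h1.ge (h1 ▸ hR) h2 h3 h4)]
  congr 1
  funext q
  exact cint_annulus hr.p1 hR _ fun z h1 h2 => (hd z _ _ _ h1 h2 (norm_mul_circle hr.p2.le _)
      (norm_mul_circle hr.p3.le _) (norm_mul_circle hr.p4.le _)).left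

lemma M4_disc (hr : Pos4 r1 r2 r3 r4) (hf : ContT r1 r2 r3 r4 f)
    (hd : ∀ b c d : ℂ, ‖b‖ = r2 → ‖c‖ = r3 → ‖d‖ = r4 →
      ∃ F : ℂ → ℂ, (∀ a, ‖a‖ ≤ r1 → DifferentiableAt ℂ F a) ∧ F 0 = 0 ∧
        ∀ a, ‖a‖ = r1 → f a b c d = F a) :
    M4 r1 r2 r3 r4 f = 0 := by
  rw [M4_eq_iterated hr hf]
  refine (integral_congr_ae (ae_of_all _ fun q => ?_)).trans (integral_zero _ _)
  obtain ⟨F, h1, h2, h3⟩ := hd _ _ _ (norm_mul_circle hr.p2.le q.1)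
      (norm_mul_circle hr.p3.le q.2.1) (norm_mul_circle hr.p4.le q.2.2)
  change cint r1 _ = 0
  rw [cint_congr hr.p1 h3, cint_disc hr.p1 F h1, h2]

/-- Moving the first contour across a simple pole at `p`. -/
lemma M4_cross {r R : ℝ} (hr : Pos4 r r2 r3 r4) (p : ℂ → ℂ → ℂ → ℂ)
    (hp : ∀ b c d : ℂ, ‖b‖ = r2 → ‖c‖ = r3 → ‖d‖ = r4 → r < ‖p b c d‖ ∧ ‖p b c d‖ < R)
    (hpd : ∀ a b c d : ℂ, ‖b‖ = r2 → ‖c‖ = r3 → ‖d‖ = r4 → DiffAt (fun _ => p) a b c d)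
    (hd : ∀ a b c d : ℂ, r ≤ ‖a‖ → ‖a‖ ≤ R → ‖b‖ = r2 → ‖c‖ = r3 → ‖d‖ = r4 → DiffAt g a b c d)
    (hf : f = fun a b c d => a / (a - p b c d) * g a b c d) :
    M4 R r2 r3 r4 f - M4 r r2 r3 r4 f = M4 1 r2 r3 r4 (fun _ b c d => g (p b c d) b c d) := by
  subst hf
  obtain ⟨hlt1, hlt2⟩ := hp r2 r3 r4 (by simp [abs_of_pos hr.p2]) (by simp [abs_of_pos hr.p3])
    (by simp [abs_of_pos hr.p4])
  have hrR : r < R := hlt1.trans hlt2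
  have hR' : Pos4 R r2 r3 r4 := ⟨hr.p1.trans hrR, hr.p2, hr.p3, hr.p4⟩
  have hone : Pos4 1 r2 r3 r4 := ⟨one_pos, hr.p2, hr.p3, hr.p4⟩
  have hcont : ∀ ρ, r ≤ ρ → ρ ≤ R → (∀ b c d : ℂ, ‖b‖ = r2 → ‖c‖ = r3 → ‖d‖ = r4 →
      ρ ≠ ‖p b c d‖) → ContT ρ r2 r3 r4 fun a b c d => a / (a - p b c d) * g a b c d := by
    intro ρ h1 h2 h3
    refine .of_diffAt fun a b c d ha hb hc hd' => ?_
    have h0 : a - p b c d ≠ 0 := by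
      rw [sub_ne_zero]; intro h; exact h3 b c d hb hc hd' (by rw [← h, ha])
    have e1 := hd a b c d (by rw [ha]; exact h1) (by rw [ha]; exact h2) hb hc hd'
    have e2 := hpd a b c d hb hc hd'
    have e3 : DifferentiableAt ℂ (fun q : ℂ × ℂ × ℂ × ℂ => q.1) (a, b, c, d) := by fun_prop
    refine DifferentiableAt.mul ?_ e1
    simp only [div_eq_mul_inv]
    exact e3.mul (DifferentiableAt.fun_inv (e3.sub e2) h0)
  have c1 := hcont R hrR.le le_rfl fun b c d hb hc hd' => (hp b c d hb hc hd').2.ne'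
  have c2 := hcont r le_rfl hrR.le fun b c d hb hc hd' => (hp b c d hb hc hd').1.ne
  have i1 := (c1.integrable hR').integral_prod_right
  have i2 := (c2.integrable hr).integral_prod_right
  have c3 : ContT 1 r2 r3 r4 (fun _ b c d => g (p b c d) b c d) := by
    refine .of_diffAt fun a b c d ha hb hc hd' => ?_
    have e1 := hd (p b c d) b c d (hp b c d hb hc hd').1.le (hp b c d hb hc hd').2.le hb hc hd'
    have e2 := hpd a b c d hb hc hd'
    have e3 : DifferentiableAt ℂ (fun q : ℂ × ℂ × ℂ × ℂ => q.2) (a, b, c, d) := by fun_prop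
    exact DifferentiableAt.comp (g := fun p : ℂ × ℂ × ℂ × ℂ => g p.1 p.2.1 p.2.2.1 p.2.2.2)
      (f := fun q : ℂ × ℂ × ℂ × ℂ => (p q.2.1 q.2.2.1 q.2.2.2, q.2))
      (a, b, c, d) e1 (e2.prodMk e3)
  rw [M4_eq_iterated hR' c1, M4_eq_iterated hr c2, M4_eq_iterated hone c3]
  simp_rw [cint_eq r hr.p1.ne', cint_eq R hR'.p1.ne', cint_eq 1 one_ne_zero]
  rw [← integral_sub i1 i2]
  congr 1
  funext q
  have hb := norm_mul_circle hr.p2.le q.1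
  have hc := norm_mul_circle hr.p3.le q.2.1
  have hd' := norm_mul_circle hr.p4.le q.2.2
  have := cint_cross hr.p1 (p (r2 * q.1) (r3 * q.2.1) (r4 * q.2.2))
    (hp _ _ _ hb hc hd').1 (hp _ _ _ hb hc hd').2
    (fun z => g z (r2 * q.1) (r3 * q.2.1) (r4 * q.2.2))
    (fun z h1 h2 => (hd z _ _ _ h1 h2 hb hc hd').left)
  rw [cint_eq r hr.p1.ne', cint_eq R hR'.p1.ne'] at this
  rw [this]
  simp

end

section

/-! ### Reduction of the integrand of `q2` -/

noncomputable def K12 (G c1 c3 c4 X : ℂ) : ℂ :=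
  -G * X ^ 2 / (c1 - c3 - G) + G ^ 2 * X ^ 2 / ((c3 - c4 - G) * (c1 - c4 - G)) + 2 * G * X ^ 2 / (c1 - c4 - G)

noncomputable def K34 (G c1 c2 c3 c4 X : ℂ) : ℂ :=
  G * (1 + G / (c1 - c2 - G)) * X ^ 2 *
      (1 / (c2 - c3 - G) + 1 / (c1 - c4 - G) + 2 * G / ((c1 - c4 - G) * (c2 - c3 - G))) -
    G * X ^ 2 / (c2 - c3 - G) + G ^ 2 * X ^ 2 / ((c1 - c2 - G) * (c1 - c4 - G))

noncomputable def K23 (G c1 c2 c3 c4 X Z W : ℂ) : ℂ :=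
  G ^ 2 * X ^ 2 * (1 / ((c2 - c4 - G) * (c3 - c4 - G)) + 1 / ((c1 - c2 - G) * (c1 - c3 - G)) +
      G * (1 / (c1 - c3 - G) + 1 / (c3 - c4 - G)) / ((c1 - c2 - G) * (c2 - c4 - G))) -
    G ^ 2 * W * (1 / (c1 - c3 - G) + 1 / (c2 - c4 - G) + G / ((c2 - c4 - G) * (c1 - c3 - G))) -
    G * W -
    2 * X * Z * (G / (c2 - c4 - G) + G / (c1 - c3 - G) + G ^ 2 / ((c2 - c4 - G) * (c1 - c3 - G))) +
    2 * G ^ 2 * X ^ 2 / ((c1 - c3 - G) * (c2 - c4 - G)) + X ^ 2 -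
    2 * G * Z ^ 2 / (c1 - c2 - G) - 2 * G * Z ^ 2 / (c3 - c4 - G) + G * Z ^ 2 / (c1 - c4 - G)

set_option maxRecDepth 10000 in
set_option maxHeartbeats 2000000 in
lemma certificate {G c1 c2 c3 c4 X Y Z W : ℂ} (he : c1 - c2 - G ≠ 0) (hf : c3 - c4 - G ≠ 0)
    (hg : c2 - c3 - G ≠ 0) (ha : c1 - c4 - G ≠ 0) (hb : c2 - c4 - G ≠ 0) (hh : c1 - c3 - G ≠ 0)
    (hd : c2 - c3 ≠ 0) (hW : W = (X - Z) ^ 2 / (c2 - c3)) :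
    X * ((c1 - c2) / (c1 - c2 - G)) * ((c3 - c4) / (c3 - c4 - G)) *
      (Y - 2 * Z * (((c1 - c3) / (c1 - c3 - G)) * ((c2 - c4) / (c2 - c4 - G)) *
          ((c1 - c4 - 2 * G) / (c1 - c4 - G))) +
        X * (1 + (G * (c1 + c2 - c3 - c4) / ((c2 - c3 - G) * (c1 - c4 - G))) *
          ((c2 - c4 - 2 * G) / (c2 - c4 - G)))) =
    ((c1 - c2) / (c1 - c2 - G)) * ((c3 - c4) / (c3 - c4 - G)) *
        (X * Y + X ^ 2 + 2 * Z ^ 2 - 4 * X * Z + 2 * G * W) -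
      (X - Z) ^ 2 * ((c1 - c4) / (c1 - c4 - G)) +
      (K12 G c1 c3 c4 X - K12 G c2 c3 c4 X) +
      (K34 G c1 c2 c3 c4 X - K34 G c1 c2 c4 c3 X) +
      (K23 G c1 c2 c3 c4 X Z W - K23 G c1 c3 c2 c4 Z X (-W)) := by
  obtain ⟨e, rfl⟩ : ∃ e, c1 = e + c2 + G := ⟨c1 - c2 - G, by ring⟩
  obtain ⟨g, rfl⟩ : ∃ g, c2 = g + c3 + G := ⟨c2 - c3 - G, by ring⟩
  obtain ⟨f, rfl⟩ : ∃ f, c3 = f + c4 + G := ⟨c3 - c4 - G, by ring⟩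
  subst hW
  unfold K12 K34 K23
  have e1 : e + (g + (f + c4 + G) + G) + G - (g + (f + c4 + G) + G) - G = e := by ring
  have e2 : f + c4 + G - c4 - G = f := by ring
  have e3 : (g + (f + c4 + G) + G) - (f + c4 + G) - G = g := by ring
  have e4 : e + (g + (f + c4 + G) + G) + G - c4 - G = e + g + f + 2 * G := by ring
  have e5 : (g + (f + c4 + G) + G) - c4 - G = g + f + G := by ring
  have e6 : e + (g + (f + c4 + G) + G) + G - (f + c4 + G) - G = e + g + G := by ring
  have e7 : (g + (f + c4 + G) + G) - (f + c4 + G) = g + G := by ring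
  rw [e1] at he; rw [e2] at hf; rw [e3] at hg; rw [e4] at ha; rw [e5] at hb; rw [e6] at hh; rw [e7] at hd
  simp only [e1, e2, e4, e5, e6, e7, add_sub_cancel_right]
  clear e1 e2 e3 e4 e5 e6 e7
  generalize hA : e + g + f + 2 * G = a at *
  generalize hB : g + f + G = b at *
  generalize hH : e + g + G = h at *
  generalize hD : g + G = d at *
  field_simp
  subst hA hB hH hD
  ring

lemma cfun_lower (z : ℂ) : (‖z‖⁻¹ - ‖z‖) / 2 ≤ ‖cfun z‖ := by
  unfold cfun
  rw [norm_div, Complex.norm_two]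
  have := norm_sub_norm_le z⁻¹ (-z)
  rw [norm_inv, norm_neg, sub_neg_eq_add, add_comm] at this
  linarith

lemma cfun_upper (z : ℂ) : ‖cfun z‖ ≤ (‖z‖⁻¹ + ‖z‖) / 2 := by
  unfold cfun
  rw [norm_div, Complex.norm_two]
  have := norm_add_le z z⁻¹
  rw [norm_inv] at this
  linarith

lemma cfun_gap {γ r : ℝ} (hγ : 0 < γ) (hr0 : 0 < r) (hr : r < 1 / (4 * γ + 4)) {a b : ℂ}
    (ha : 0 < ‖a‖) (hab : ‖a‖ ≤ r * ‖b‖) (hb : ‖b‖ ≤ 1) :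
    2 * γ < ‖cfun a - cfun b‖ := by
  have h1 := cfun_lower a
  have h2 := cfun_upper b
  have h3 := norm_sub_norm_le (cfun a) (cfun b)
  have hb0 : 0 < ‖b‖ := by
    by_contra h
    have : ‖b‖ = 0 := le_antisymm (not_lt.1 h) (norm_nonneg _)
    rw [this] at hab; linarith
  have h4 : (r * ‖b‖)⁻¹ ≤ ‖a‖⁻¹ := inv_anti₀ ha hab
  have h5 : 4 * γ + 4 < r⁻¹ := by
    rw [lt_inv_comm₀ (by positivity) hr0]; simpa using hr
  have h6 : 1 ≤ ‖b‖⁻¹ := (one_le_inv₀ hb0).2 hb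
  have hr1 : r < 1 := hr.trans (by rw [div_lt_one (by positivity)]; linarith)
  have h7 : ‖a‖ ≤ 1 := hab.trans (by nlinarith)
  rw [mul_inv] at h4
  nlinarith

lemma cfun_sub_ne {γ r : ℝ} (hγ : 0 < γ) (hr0 : 0 < r) (hr : r < 1 / (4 * γ + 4)) {a b : ℂ}
    (ha : 0 < ‖a‖) (hab : ‖a‖ ≤ r * ‖b‖) (hb : ‖b‖ ≤ 1) :
    cfun a - cfun b - 2 * γ ≠ 0 ∧ cfun a - cfun b ≠ 0 := by
  have h := cfun_gap hγ hr0 hr ha hab hb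
  constructor
  · intro h0
    rw [sub_eq_zero] at h0
    rw [h0] at h
    simp [abs_of_pos hγ] at h
  · intro h0
    rw [h0] at h
    simp at h; linarith

@[fun_prop]
lemma _root_.DifferentiableAt.cfun {E : Type*} [NormedAddCommGroup E] [NormedSpace ℂ E]
    {f : E → ℂ} {x : E} (hf : DifferentiableAt ℂ f x) (h0 : f x ≠ 0) :
    DifferentiableAt ℂ (fun x => cfun (f x)) x := by
  unfold _root_.cfun
  fun_prop (disch := assumption)

@[fun_prop]
lemma _root_.DifferentiableAt.epsfun {E : Type*} [NormedAddCommGroup E] [NormedSpace ℂ E]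
    {f : E → ℂ} {x : E} {γ : ℂ} (hf : DifferentiableAt ℂ f x) (h0 : f x ≠ 0) :
    DifferentiableAt ℂ (fun x => epsfun γ (f x)) x := by
  unfold _root_.epsfun
  fun_prop (disch := assumption)

lemma DiffAt.swap12 {a b c d : ℂ} (h : DiffAt f b a c d) :
    DiffAt (fun a b c d => f b a c d) a b c d :=
  DifferentiableAt.comp (g := fun p : ℂ × ℂ × ℂ × ℂ => f p.1 p.2.1 p.2.2.1 p.2.2.2)
    (f := fun p : ℂ × ℂ × ℂ × ℂ => (p.2.1, p.1, p.2.2)) (a, b, c, d) h (by fun_prop)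

lemma DiffAt.swap23 {a b c d : ℂ} (h : DiffAt f a c b d) :
    DiffAt (fun a b c d => f a c b d) a b c d :=
  DifferentiableAt.comp (g := fun p : ℂ × ℂ × ℂ × ℂ => f p.1 p.2.1 p.2.2.1 p.2.2.2)
    (f := fun p : ℂ × ℂ × ℂ × ℂ => (p.1, p.2.2.1, p.2.1, p.2.2.2)) (a, b, c, d) h (by fun_prop)

lemma DiffAt.swap34 {a b c d : ℂ} (h : DiffAt f a b d c) :
    DiffAt (fun a b c d => f a b d c) a b c d :=
  DifferentiableAt.comp (g := fun p : ℂ × ℂ × ℂ × ℂ => f p.1 p.2.1 p.2.2.1 p.2.2.2)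
    (f := fun p : ℂ × ℂ × ℂ × ℂ => (p.1, p.2.1, p.2.2.2, p.2.2.1)) (a, b, c, d) h (by fun_prop)

lemma M4_sym12 {s R : ℝ} (hr : Pos4 s R r3 r4) (hR : s ≤ R)
    (hd : ∀ a b c d : ℂ, s ≤ ‖a‖ → ‖a‖ ≤ R → s ≤ ‖b‖ → ‖b‖ ≤ R → ‖c‖ = r3 → ‖d‖ = r4 →
      DiffAt f a b c d) :
    M4 s R r3 r4 f = M4 s R r3 r4 (fun a b c d => f b a c d) := by
  have hs : Pos4 s s r3 r4 := ⟨hr.p1, hr.p1, hr.p3, hr.p4⟩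
  rw [M4_swap12 s R, M4_swap12 s R, M4_move hs hR, M4_move hs hR, M4_swap12]
  · exact fun a b c d h1 h2 h3 h4 h5 => hd _ _ _ _ h1 h2 h3.ge (h3 ▸ hR) h4 h5
  · exact fun a b c d h1 h2 h3 h4 h5 => (hd _ _ _ _ h3.ge (h3 ▸ hR) h1 h2 h4 h5).swap12

lemma M4_sym23 {s R : ℝ} (hr : Pos4 r1 s R r4) (hR : s ≤ R)
    (hd : ∀ a b c d : ℂ, ‖a‖ = r1 → s ≤ ‖b‖ → ‖b‖ ≤ R → s ≤ ‖c‖ → ‖c‖ ≤ R → ‖d‖ = r4 →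
      DiffAt f a b c d) :
    M4 r1 s R r4 f = M4 r1 s R r4 (fun a b c d => f a c b d) := by
  rw [M4_swap12, M4_swap23, M4_sym12 ⟨hr.p2, hr.p3, hr.p1, hr.p4⟩ hR, M4_swap23, M4_swap12]
  exact fun a b c d h1 h2 h3 h4 h5 h6 => ((hd _ _ _ _ h5 h1 h2 h3 h4 h6).swap12).swap23

lemma M4_sym34 {s R : ℝ} (hr : Pos4 r1 r2 s R) (hR : s ≤ R)
    (hd : ∀ a b c d : ℂ, ‖a‖ = r1 → ‖b‖ = r2 → s ≤ ‖c‖ → ‖c‖ ≤ R → s ≤ ‖d‖ → ‖d‖ ≤ R →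
      DiffAt f a b c d) :
    M4 r1 r2 s R f = M4 r1 r2 s R (fun a b c d => f a b d c) := by
  rw [M4_swap23, M4_swap34, M4_sym23 ⟨hr.p1, hr.p3, hr.p4, hr.p2⟩ hR, M4_swap34, M4_swap23]
  exact fun a b c d h1 h2 h3 h4 h5 h6 => ((hd _ _ _ _ h1 h6 h2 h3 h4 h5).swap23).swap34

lemma cint4_eq (hr : Pos4 r1 r2 r3 r4) (hf : ContT r1 r2 r3 r4 f) :
    cint r1 (fun a => cint r2 fun b => cint r3 fun c => cint r4 fun d => f a b c d) =
      M4 r1 r2 r3 r4 f := by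
  have hc := hf.continuous hr
  unfold M4
  rw [Measure.volume_eq_prod, integral_prod _ (hf.integrable hr), cint_eq _ hr.p1.ne']
  congr 1
  funext a
  have ha : Continuous fun p : Circle × Circle × Circle =>
      f (r1 * a) (r2 * p.1) (r3 * p.2.1) (r4 * p.2.2) :=
    hc.comp (by fun_prop : Continuous fun y : Circle × Circle × Circle => (a, y))
  rw [cint_eq _ hr.p2.ne']
  refine Eq.trans ?_ (integral_prod _ (integrable_of_continuous (volume.prod volume) ha)).symm
  congr 1
  funext b
  have hb : Continuous fun p : Circle × Circle =>
      f (r1 * a) (r2 * b) (r3 * p.1) (r4 * p.2) :=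
    ha.comp (by fun_prop : Continuous fun y : Circle × Circle => (b, y))
  rw [cint_eq _ hr.p3.ne']
  refine Eq.trans ?_ (integral_prod _ (integrable_of_continuous (volume.prod volume) hb)).symm
  congr 1
  funext c
  rw [cint_eq _ hr.p4.ne']

end

noncomputable section

/-- `z ↦ z / (1 - z)`. -/
def geo (z : ℂ) : ℂ := z / (1 - z)

/-- `z ↦ z / (1 - z)²`. -/
def koebe (z : ℂ) : ℂ := z / (1 - z) ^ 2

def Sfun (γ : ℝ) (a b : ℂ) : ℂ := (cfun a - cfun b) / (cfun a - cfun b - 2 * γ)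

def Wfun (a b c : ℂ) : ℂ :=
  -2 * a ^ 2 * b * c * (b - c) / ((1 - a * b) ^ 2 * (1 - a * c) ^ 2 * (1 - b * c))

def weight (γ t : ℝ) (a b c d : ℂ) : ℂ :=
  exp (t * (epsfun γ a + epsfun γ b + epsfun γ c + epsfun γ d)) * koebe (a * b * c * d)

lemma one_sub_ne {z : ℂ} (h : ‖z‖ < 1) : 1 - z ≠ 0 := by
  intro h0
  rw [sub_eq_zero] at h0
  rw [← h0] at h
  simp at h

section Diff
variable {E : Type*} [NormedAddCommGroup E] [NormedSpace ℂ E] {f g h k : E → ℂ} {x : E} {γ t : ℝ}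

@[fun_prop]
lemma _root_.DifferentiableAt.geo (hf : DifferentiableAt ℂ f x) (h0 : 1 - f x ≠ 0) :
    DifferentiableAt ℂ (fun x => geo (f x)) x := by
  unfold VarianceAsymptotics.geo
  fun_prop (disch := assumption)

@[fun_prop]
lemma _root_.DifferentiableAt.koebe (hf : DifferentiableAt ℂ f x) (h0 : 1 - f x ≠ 0) :
    DifferentiableAt ℂ (fun x => koebe (f x)) x := by
  unfold VarianceAsymptotics.koebe
  fun_prop (disch := first | assumption | exact pow_ne_zero _ ‹_›)

@[fun_prop]
lemma _root_.DifferentiableAt.Sfun (hf : DifferentiableAt ℂ f x) (hg : DifferentiableAt ℂ g x)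
    (hf0 : f x ≠ 0) (hg0 : g x ≠ 0) (h0 : cfun (f x) - cfun (g x) - 2 * γ ≠ 0) :
    DifferentiableAt ℂ (fun x => Sfun γ (f x) (g x)) x := by
  unfold VarianceAsymptotics.Sfun
  fun_prop (disch := assumption)

@[fun_prop]
lemma _root_.DifferentiableAt.Wfun (hf : DifferentiableAt ℂ f x) (hg : DifferentiableAt ℂ g x)
    (hh : DifferentiableAt ℂ h x) (h1 : 1 - f x * g x ≠ 0) (h2 : 1 - f x * h x ≠ 0)
    (h3 : 1 - g x * h x ≠ 0) :
    DifferentiableAt ℂ (fun x => Wfun (f x) (g x) (h x)) x := by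
  unfold VarianceAsymptotics.Wfun
  have := mul_ne_zero (mul_ne_zero (pow_ne_zero 2 h1) (pow_ne_zero 2 h2)) h3
  fun_prop (disch := assumption)

@[fun_prop]
lemma _root_.DifferentiableAt.weight (hf : DifferentiableAt ℂ f x) (hg : DifferentiableAt ℂ g x)
    (hh : DifferentiableAt ℂ h x) (hk : DifferentiableAt ℂ k x)
    (hf0 : f x ≠ 0) (hg0 : g x ≠ 0) (hh0 : h x ≠ 0) (hk0 : k x ≠ 0)
    (h1 : 1 - f x * g x * h x * k x ≠ 0) :
    DifferentiableAt ℂ (fun x => weight γ t (f x) (g x) (h x) (k x)) x := by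
  unfold VarianceAsymptotics.weight
  fun_prop (disch := assumption)

@[fun_prop]
lemma _root_.DifferentiableAt.K12 {G : ℂ} {f1 f3 f4 X : E → ℂ} (h1 : DifferentiableAt ℂ f1 x)
    (h3 : DifferentiableAt ℂ f3 x) (h4 : DifferentiableAt ℂ f4 x) (hX : DifferentiableAt ℂ X x)
    (hh : f1 x - f3 x - G ≠ 0) (hf : f3 x - f4 x - G ≠ 0) (ha : f1 x - f4 x - G ≠ 0) :
    DifferentiableAt ℂ (fun x => K12 G (f1 x) (f3 x) (f4 x) (X x)) x := by
  unfold VarianceAsymptotics.K12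
  fun_prop (disch := first | assumption | exact mul_ne_zero ‹_› ‹_›)

@[fun_prop]
lemma _root_.DifferentiableAt.K34 {G : ℂ} {f1 f2 f3 f4 X : E → ℂ} (h1 : DifferentiableAt ℂ f1 x)
    (h2 : DifferentiableAt ℂ f2 x) (h3 : DifferentiableAt ℂ f3 x) (h4 : DifferentiableAt ℂ f4 x)
    (hX : DifferentiableAt ℂ X x)
    (he : f1 x - f2 x - G ≠ 0) (hg : f2 x - f3 x - G ≠ 0) (ha : f1 x - f4 x - G ≠ 0) :
    DifferentiableAt ℂ (fun x => K34 G (f1 x) (f2 x) (f3 x) (f4 x) (X x)) x := by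
  unfold VarianceAsymptotics.K34
  fun_prop (disch := first | assumption | exact mul_ne_zero ‹_› ‹_›)

@[fun_prop]
lemma _root_.DifferentiableAt.K23 {G : ℂ} {f1 f2 f3 f4 X Z W : E → ℂ}
    (h1 : DifferentiableAt ℂ f1 x)
    (h2 : DifferentiableAt ℂ f2 x) (h3 : DifferentiableAt ℂ f3 x) (h4 : DifferentiableAt ℂ f4 x)
    (hX : DifferentiableAt ℂ X x) (hZ : DifferentiableAt ℂ Z x) (hW : DifferentiableAt ℂ W x)
    (he : f1 x - f2 x - G ≠ 0) (hh : f1 x - f3 x - G ≠ 0) (ha : f1 x - f4 x - G ≠ 0)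
    (hb : f2 x - f4 x - G ≠ 0) (hf : f3 x - f4 x - G ≠ 0) :
    DifferentiableAt ℂ (fun x => K23 G (f1 x) (f2 x) (f3 x) (f4 x) (X x) (Z x) (W x)) x := by
  unfold VarianceAsymptotics.K23
  have d1 := mul_ne_zero hb hf
  have d2 := mul_ne_zero he hh
  have d3 := mul_ne_zero he hb
  have d4 := mul_ne_zero hb hh
  have d5 := mul_ne_zero hh hb
  fun_prop (disch := assumption)

end Diff

lemma weight_swap12 (γ t : ℝ) (a b c d : ℂ) : weight γ t b a c d = weight γ t a b c d := by
  unfold weight; ring_nf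

lemma weight_swap23 (γ t : ℝ) (a b c d : ℂ) : weight γ t a c b d = weight γ t a b c d := by
  unfold weight; ring_nf

lemma weight_swap34 (γ t : ℝ) (a b c d : ℂ) : weight γ t a b d c = weight γ t a b c d := by
  unfold weight; ring_nf

/-- The integrand of `q2` after symmetrization. -/
def symIntegrand (γ t : ℝ) (a b c d : ℂ) : ℂ :=
  weight γ t a b c d *
    (Sfun γ a b * Sfun γ c d *
      (geo (a * b) * geo (c * d) + geo (a * b) ^ 2 + 2 * geo (a * c) ^ 2 -
        4 * geo (a * b) * geo (a * c) + 2 * (2 * γ) * Wfun a b c) -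
      (geo (a * b) - geo (a * c)) ^ 2 * Sfun γ a d)

def q2Integrand (γ t : ℝ) (z1 z2 z3 z4 : ℂ) : ℂ :=
    Complex.exp (t * (epsfun γ z1 + epsfun γ z2 + epsfun γ z3 + epsfun γ z4)) *
      (z1 * z2 * z3 * z4 / (1 - z1 * z2 * z3 * z4) ^ 2) *
      (z1 * z2 / (1 - z1 * z2)) *
      ((cfun z1 - cfun z2) / (cfun z1 - cfun z2 - 2 * γ)) *
      ((cfun z3 - cfun z4) / (cfun z3 - cfun z4 - 2 * γ)) *
      (z3 * z4 / (1 - z3 * z4) - 2 * (z1 * z3 / (1 - z1 * z3)) * A1 γ z1 z2 z3 z4 +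
        z1 * z2 / (1 - z1 * z2) * (1 + A2 γ z1 z2 z3 z4))

lemma Wfun_eq {a b c : ℂ} (hb : b ≠ 0) (hc : c ≠ 0) (h1 : 1 - a * b ≠ 0)
    (h2 : 1 - a * c ≠ 0) (h3 : 1 - b * c ≠ 0) (hd : cfun b - cfun c ≠ 0) :
    Wfun a b c = (geo (a * b) - geo (a * c)) ^ 2 / (cfun b - cfun c) := by
  rw [eq_div_iff hd]
  unfold Wfun geo cfun
  field_simp
  ring

lemma q2Integrand_eq {γ t : ℝ} {a b c d : ℂ} (hb : b ≠ 0) (hc : c ≠ 0)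
    (h1 : 1 - a * b ≠ 0) (h2 : 1 - a * c ≠ 0) (h3 : 1 - b * c ≠ 0)
    (hdd : cfun b - cfun c ≠ 0)
    (he : cfun a - cfun b - 2 * γ ≠ 0) (hf : cfun c - cfun d - 2 * γ ≠ 0)
    (hg : cfun b - cfun c - 2 * γ ≠ 0) (ha : cfun a - cfun d - 2 * γ ≠ 0)
    (hbb : cfun b - cfun d - 2 * γ ≠ 0) (hh : cfun a - cfun c - 2 * γ ≠ 0) :
    q2Integrand γ t a b c d = symIntegrand γ t a b c d +
      (weight γ t a b c d * K12 (2 * γ) (cfun a) (cfun c) (cfun d) (geo (a * b)) -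
        weight γ t b a c d * K12 (2 * γ) (cfun b) (cfun c) (cfun d) (geo (b * a))) +
      (weight γ t a b c d * K34 (2 * γ) (cfun a) (cfun b) (cfun c) (cfun d) (geo (a * b)) -
        weight γ t a b d c * K34 (2 * γ) (cfun a) (cfun b) (cfun d) (cfun c) (geo (a * b))) +
      (weight γ t a b c d * K23 (2 * γ) (cfun a) (cfun b) (cfun c) (cfun d) (geo (a * b))
          (geo (a * c)) (Wfun a b c) -
        weight γ t a c b d * K23 (2 * γ) (cfun a) (cfun c) (cfun b) (cfun d) (geo (a * c))
          (geo (a * b)) (Wfun a c b)) := by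
  have hW : Wfun a c b = - Wfun a b c := by unfold Wfun; ring
  have key := certificate (Y := geo (c * d)) he hf hg ha hbb hh hdd (Wfun_eq hb hc h1 h2 h3 hdd)
  rw [weight_swap12 γ t a b c d, weight_swap23 γ t a b c d, weight_swap34 γ t a b c d, hW, mul_comm b a]
  have e1 : q2Integrand γ t a b c d = weight γ t a b c d * (geo (a * b) *
      ((cfun a - cfun b) / (cfun a - cfun b - 2 * γ)) *
      ((cfun c - cfun d) / (cfun c - cfun d - 2 * γ)) *
      (geo (c * d) - 2 * geo (a * c) * A1 γ a b c d + geo (a * b) * (1 + A2 γ a b c d))) := by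
    unfold q2Integrand weight geo koebe; ring
  have e2 : (4 * γ : ℂ) = 2 * (2 * γ) := by ring
  rw [e1]
  unfold A1 A2 symIntegrand Sfun
  rw [e2, key]
  ring

variable {r1 r2 r3 r4 : ℝ} {f g : ℂ → ℂ → ℂ → ℂ → ℂ}

lemma ContT.add (hf : ContT r1 r2 r3 r4 f) (hg : ContT r1 r2 r3 r4 g) :
    ContT r1 r2 r3 r4 (fun a b c d => f a b c d + g a b c d) :=
  fun a b c d h1 h2 h3 h4 => ContinuousAt.add (hf a b c d h1 h2 h3 h4) (hg a b c d h1 h2 h3 h4)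

lemma ContT.sub (hf : ContT r1 r2 r3 r4 f) (hg : ContT r1 r2 r3 r4 g) :
    ContT r1 r2 r3 r4 (fun a b c d => f a b c d - g a b c d) :=
  fun a b c d h1 h2 h3 h4 => ContinuousAt.sub (hf a b c d h1 h2 h3 h4) (hg a b c d h1 h2 h3 h4)

theorem q2_eq_symIntegrand {γ r : ℝ} (hγ : 0 < γ) (hr0 : 0 < r) (hr : r < 1 / (4 * γ + 4))
    (t : ℝ) : q2 γ r t = M4 (r ^ 3) (r ^ 2) r 1 (symIntegrand γ t) := by
  have hr1 : r < 1 := hr.trans (by rw [div_lt_one (by positivity)]; linarith)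
  have hp : Pos4 (r ^ 3) (r ^ 2) r 1 := ⟨by positivity, by positivity, hr0, one_pos⟩
  have h32 : r ^ 3 ≤ r ^ 2 := pow_le_pow_of_le_one hr0.le hr1.le (by norm_num)
  have h21 : r ^ 2 ≤ r := by nlinarith
  have hr3 : r ^ 3 < 1 := pow_lt_one₀ hr0.le hr1 (by norm_num)
  have hr2 : r ^ 2 < 1 := pow_lt_one₀ hr0.le hr1 (by norm_num)
  have gap : ∀ a b : ℂ, 0 < ‖a‖ → ‖a‖ ≤ r * ‖b‖ → ‖b‖ ≤ 1 →
      cfun a - cfun b - 2 * γ ≠ 0 ∧ cfun a - cfun b ≠ 0 := fun a b h1 h2 h3 =>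
    cfun_sub_ne hγ hr0 hr h1 h2 h3
  have ne0 : ∀ a : ℂ, 0 < ‖a‖ → a ≠ 0 := fun a h => norm_pos_iff.1 h
  have n2 : ∀ a b : ℂ, ‖a‖ < 1 → ‖b‖ ≤ 1 → 1 - a * b ≠ 0 := fun a b h1 h2 => one_sub_ne (by
    rw [norm_mul]; nlinarith [norm_nonneg a, norm_nonneg b])
  have n4 : ∀ a b c d : ℂ, ‖a‖ < 1 → ‖b‖ ≤ 1 → ‖c‖ ≤ 1 → ‖d‖ ≤ 1 → 1 - a * b * c * d ≠ 0 :=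
    fun a b c d h1 h2 h3 h4 => by
      rw [mul_assoc a, mul_assoc a]
      refine n2 a _ h1 ?_
      rw [norm_mul, norm_mul]
      exact mul_le_one₀ (mul_le_one₀ h2 (norm_nonneg _) h3) (norm_nonneg _) h4
  have d12 : ∀ a b c d : ℂ, r ^ 3 ≤ ‖a‖ → ‖a‖ ≤ r ^ 2 → r ^ 3 ≤ ‖b‖ → ‖b‖ ≤ r ^ 2 → ‖c‖ = r →
      ‖d‖ = 1 → DiffAt (fun a b c d => weight γ t a b c d *
        K12 (2 * γ) (cfun a) (cfun c) (cfun d) (geo (a * b))) a b c d := by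
    intro a b c d h1 h2 h3 h4 h5 h6
    have a0 : 0 < ‖a‖ := hp.p1.trans_le h1
    have b0 : 0 < ‖b‖ := hp.p1.trans_le h3
    have c0 : 0 < ‖c‖ := by rw [h5]; exact hr0
    have d0 : 0 < ‖d‖ := by rw [h6]; exact one_pos
    have g1 := (gap a c a0 (by rw [h5]; nlinarith) (by linarith)).1
    have g2 := (gap a d a0 (by rw [h6]; nlinarith) (by linarith)).1
    have g3 := (gap c d c0 (by rw [h6]; nlinarith) (by linarith)).1
    have g4 := ne0 a a0
    have g5 := ne0 b b0
    have g6 := ne0 c c0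
    have g7 := ne0 d d0
    have g8 := n2 a b (by linarith) (by linarith)
    have g9 := n4 a b c d (by linarith) (by linarith) (by linarith) (by linarith)
    unfold DiffAt
    fun_prop (disch := assumption)
  have d34 : ∀ a b c d : ℂ, ‖a‖ = r ^ 3 → ‖b‖ = r ^ 2 → r ≤ ‖c‖ → ‖c‖ ≤ 1 → r ≤ ‖d‖ → ‖d‖ ≤ 1 →
      DiffAt (fun a b c d => weight γ t a b c d *
        K34 (2 * γ) (cfun a) (cfun b) (cfun c) (cfun d) (geo (a * b))) a b c d := by
    intro a b c d h1 h2 h3 h4 h5 h6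
    have a0 : 0 < ‖a‖ := by rw [h1]; exact hp.p1
    have b0 : 0 < ‖b‖ := by rw [h2]; exact hp.p2
    have c0 : 0 < ‖c‖ := hr0.trans_le h3
    have d0 : 0 < ‖d‖ := hr0.trans_le h5
    have g1 := (gap a b a0 (by rw [h1, h2]; nlinarith) (by linarith)).1
    have g2 := (gap a d a0 (by rw [h1]; nlinarith) (by linarith)).1
    have g3 := (gap b c b0 (by rw [h2]; nlinarith) (by linarith)).1
    have g4 := ne0 a a0
    have g5 := ne0 b b0
    have g6 := ne0 c c0
    have g7 := ne0 d d0
    have g8 := n2 a b (by linarith) (by linarith)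
    have g9 := n4 a b c d (by linarith) (by linarith) (by linarith) (by linarith)
    unfold DiffAt
    fun_prop (disch := assumption)
  have d23 : ∀ a b c d : ℂ, ‖a‖ = r ^ 3 → r ^ 2 ≤ ‖b‖ → ‖b‖ ≤ r → r ^ 2 ≤ ‖c‖ → ‖c‖ ≤ r → ‖d‖ = 1 →
      DiffAt (fun a b c d => weight γ t a b c d *
        K23 (2 * γ) (cfun a) (cfun b) (cfun c) (cfun d) (geo (a * b))
          (geo (a * c)) (Wfun a b c)) a b c d := by
    intro a b c d h1 h2 h3 h4 h5 h6
    have a0 : 0 < ‖a‖ := by rw [h1]; exact hp.p1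
    have b0 : 0 < ‖b‖ := hp.p2.trans_le h2
    have c0 : 0 < ‖c‖ := hp.p2.trans_le h4
    have d0 : 0 < ‖d‖ := by rw [h6]; exact one_pos
    have g1 := (gap a b a0 (by rw [h1]; nlinarith) (by linarith)).1
    have g2 := (gap a c a0 (by rw [h1]; nlinarith) (by linarith)).1
    have g3 := (gap a d a0 (by rw [h1, h6]; nlinarith) (by linarith)).1
    have g11 := (gap b d b0 (by rw [h6]; nlinarith) (by linarith)).1
    have g12 := (gap c d c0 (by rw [h6]; nlinarith) (by linarith)).1
    have g4 := ne0 a a0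
    have g5 := ne0 b b0
    have g6 := ne0 c c0
    have g7 := ne0 d d0
    have g8 := n2 a b (by linarith) (by linarith)
    have g13 := n2 a c (by linarith) (by linarith)
    have g14 := n2 b c (by linarith) (by linarith)
    have g9 := n4 a b c d (by linarith) (by linarith) (by linarith) (by linarith)
    unfold DiffAt
    fun_prop (disch := assumption)
  have hS : ContT (r ^ 3) (r ^ 2) r 1 (symIntegrand γ t) := by
    refine .of_diffAt fun a b c d h1 h2 h3 h4 => ?_
    have a0 : 0 < ‖a‖ := by rw [h1]; exact hp.p1
    have b0 : 0 < ‖b‖ := by rw [h2]; exact hp.p2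
    have c0 : 0 < ‖c‖ := by rw [h3]; exact hr0
    have d0 : 0 < ‖d‖ := by rw [h4]; exact one_pos
    have g1 := (gap a b a0 (by rw [h1, h2]; nlinarith) (by linarith)).1
    have g2 := (gap c d c0 (by rw [h3, h4]; nlinarith) (by linarith)).1
    have g3 := (gap a d a0 (by rw [h1, h4]; nlinarith) (by linarith)).1
    have g4 := ne0 a a0
    have g5 := ne0 b b0
    have g6 := ne0 c c0
    have g7 := ne0 d d0
    have g8 := n2 a b (by linarith) (by linarith)
    have g13 := n2 a c (by linarith) (by linarith)
    have g14 := n2 b c (by linarith) (by linarith)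
    have g15 := n2 c d (by linarith) (by linarith)
    have g9 := n4 a b c d (by linarith) (by linarith) (by linarith) (by linarith)
    unfold DiffAt symIntegrand
    fun_prop (disch := assumption)
  have c12 := ContT.of_diffAt fun a b c d h1 h2 h3 h4 =>
    d12 a b c d h1.ge (h1 ▸ h32) (h2 ▸ h32) h2.le h3 h4
  have c12' := ContT.of_diffAt fun a b c d h1 h2 h3 h4 =>
    (d12 b a c d (h2 ▸ h32) h2.le h1.ge (h1 ▸ h32) h3 h4).swap12
  have c34 := ContT.of_diffAt fun a b c d h1 h2 h3 h4 =>
    d34 a b c d h1 h2 h3.ge (h3 ▸ hr1.le) (h4 ▸ hr1.le) h4.le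
  have c34' := ContT.of_diffAt fun a b c d h1 h2 h3 h4 =>
    (d34 a b d c h1 h2 (h4 ▸ hr1.le) h4.le h3.ge (h3 ▸ hr1.le)).swap34
  have c23 := ContT.of_diffAt fun a b c d h1 h2 h3 h4 =>
    d23 a b c d h1 h2.ge (h2 ▸ h21) (h3 ▸ h21) h3.le h4
  have c23' := ContT.of_diffAt fun a b c d h1 h2 h3 h4 =>
    (d23 a c b d h1 (h3 ▸ h21) h3.le h2.ge (h2 ▸ h21) h4).swap23
  have hq : ∀ a b c d : ℂ, ‖a‖ = r ^ 3 → ‖b‖ = r ^ 2 → ‖c‖ = r → ‖d‖ = 1 → _ :=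
    fun a b c d h1 h2 h3 h4 => by
    have a0 : 0 < ‖a‖ := by rw [h1]; exact hp.p1
    have b0 : 0 < ‖b‖ := by rw [h2]; exact hp.p2
    have c0 : 0 < ‖c‖ := by rw [h3]; exact hr0
    have d0 : 0 < ‖d‖ := by rw [h4]; exact one_pos
    exact q2Integrand_eq (γ := γ) (t := t) (a := a) (b := b) (c := c) (d := d) (ne0 b b0) (ne0 c c0)
      (n2 a b (by linarith) (by linarith)) (n2 a c (by linarith) (by linarith))
      (n2 b c (by linarith) (by linarith))
      (gap b c b0 (by rw [h2, h3]; nlinarith) (by linarith)).2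
      (gap a b a0 (by rw [h1, h2]; nlinarith) (by linarith)).1
      (gap c d c0 (by rw [h3, h4]; nlinarith) (by linarith)).1
      (gap b c b0 (by rw [h2, h3]; nlinarith) (by linarith)).1
      (gap a d a0 (by rw [h1, h4]; nlinarith) (by linarith)).1
      (gap b d b0 (by rw [h2, h4]; nlinarith) (by linarith)).1
      (gap a c a0 (by rw [h1, h3]; nlinarith) (by linarith)).1
  have s12 := M4_sym12 hp h32 d12
  have s34 := M4_sym34 hp hr1.le d34
  have s23 := M4_sym23 hp h21 d23
  have key := M4_congr hp hq
  rw [M4_add hp (.add (.add hS (c12.sub c12')) (c34.sub c34')) (c23.sub c23'),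
    M4_add hp (.add hS (c12.sub c12')) (c34.sub c34'), M4_add hp hS (c12.sub c12'),
    M4_sub hp c12 c12', M4_sub hp c34 c34', M4_sub hp c23 c23', ← s12, ← s34, ← s23] at key
  have hqc : ContT (r ^ 3) (r ^ 2) r 1 (q2Integrand γ t) := by
    refine .of_diffAt fun a b c d h1 h2 h3 h4 => ?_
    have a0 : 0 < ‖a‖ := by rw [h1]; exact hp.p1
    have b0 : 0 < ‖b‖ := by rw [h2]; exact hp.p2
    have c0 : 0 < ‖c‖ := by rw [h3]; exact hr0
    have d0 : 0 < ‖d‖ := by rw [h4]; exact one_pos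
    have g1 := (gap a b a0 (by rw [h1, h2]; nlinarith) (by linarith)).1
    have g2 := (gap c d c0 (by rw [h3, h4]; nlinarith) (by linarith)).1
    have g3 := (gap a d a0 (by rw [h1, h4]; nlinarith) (by linarith)).1
    have g16 := (gap b c b0 (by rw [h2, h3]; nlinarith) (by linarith)).1
    have g17 := (gap b d b0 (by rw [h2, h4]; nlinarith) (by linarith)).1
    have g18 := (gap a c a0 (by rw [h1, h3]; nlinarith) (by linarith)).1
    have g19 := mul_ne_zero g16 g3
    have g4 := ne0 a a0
    have g5 := ne0 b b0
    have g6 := ne0 c c0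
    have g7 := ne0 d d0
    have g8 := n2 a b (by linarith) (by linarith)
    have g13 := n2 a c (by linarith) (by linarith)
    have g15 := n2 c d (by linarith) (by linarith)
    have g9 := pow_ne_zero 2 (n4 a b c d (by linarith) (by linarith) (by linarith) (by linarith))
    unfold DiffAt q2Integrand A1 A2
    fun_prop (disch := assumption)
  rw [sub_self, sub_self, sub_self, add_zero, add_zero, add_zero] at key
  rw [← key, ← cint4_eq hp hqc]
  rfl
end

/-! ### Exponential averaging -/

noncomputable section

/-- The exponential distribution of rate `4γ`. -/
def expo (γ : ℝ) : Measure ℝ :=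
  (volume.restrict (Ioi 0)).withDensity fun s => ENNReal.ofReal (4 * γ * Real.exp (-(4 * γ) * s))

def Es (t s : ℝ) (a b : ℂ) : ℂ :=
  exp (s / a - (2 * t - s) * a + (2 * t - s) / b - s * b)

lemma integral_expo {E : Type*} [NormedAddCommGroup E] [NormedSpace ℝ E] {γ : ℝ} (hγ : 0 < γ)
    (f : ℝ → E) :
    ∫ s, f s ∂expo γ = ∫ s in Ioi 0, (4 * γ * Real.exp (-(4 * γ) * s)) • f s := by
  unfold expo
  rw [integral_withDensity_eq_integral_toReal_smul (by fun_prop) (by simp)]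
  congr 1
  funext s
  rw [ENNReal.toReal_ofReal (by positivity)]

lemma integral_Ioi_expo {γ : ℝ} (hγ : 0 < γ) (t : ℝ) :
    ∫ s in Ioi t, 4 * γ * Real.exp (-(4 * γ) * s) = Real.exp (-(4 * γ) * t) := by
  rw [integral_const_mul, integral_exp_mul_Ioi (by linarith)]
  field_simp

lemma integrableOn_expo {γ : ℝ} (hγ : 0 < γ) (t : ℝ) :
    IntegrableOn (fun s => 4 * γ * Real.exp (-(4 * γ) * s)) (Ioi t) :=
  (integrableOn_exp_mul_Ioi (by linarith) t).const_mul _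

lemma isProbabilityMeasure_expo {γ : ℝ} (hγ : 0 < γ) : IsProbabilityMeasure (expo γ) := by
  constructor
  unfold expo
  rw [withDensity_apply _ MeasurableSet.univ, Measure.restrict_univ,
    ← ofReal_integral_eq_lintegral_ofReal (integrableOn_expo hγ 0)
      (ae_of_all _ fun s => by positivity), integral_Ioi_expo hγ]
  simp

lemma expo_ae_pos (γ : ℝ) : ∀ᵐ s ∂expo γ, 0 < s :=
  (withDensity_absolutelyContinuous _ _).ae_le (ae_restrict_mem measurableSet_Ioi)

lemma Es_eq (t s : ℝ) (a b : ℂ) :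
    Es t s a b = exp (2 * s * (cfun a - cfun b)) * exp (2 * t * (b⁻¹ - a)) := by
  unfold Es cfun
  rw [← exp_add]
  congr 1
  ring

lemma Ehat_eq {γ t : ℝ} (hγ : 0 < γ) (ht : 0 ≤ t) {a b : ℂ}
    (he : cfun a - cfun b - 2 * γ ≠ 0) :
    ∫ s, Es t (min s t) a b ∂expo γ =
      exp (t * (epsfun γ a + epsfun γ b)) * Sfun γ a b -
        2 * γ / (cfun a - cfun b - 2 * γ) * exp (2 * t * (b⁻¹ - a)) := by
  rw [integral_expo hγ, ← Ioc_union_Ioi_eq_Ioi ht,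
    setIntegral_union (Set.Ioc_disjoint_Ioi le_rfl) measurableSet_Ioi]
  rotate_left
  · refine (Continuous.continuousOn ?_).integrableOn_Icc.mono_set Ioc_subset_Icc_self
    simp only [Es_eq]
    fun_prop
  · refine IntegrableOn.congr_fun (((integrableOn_expo hγ t).ofReal (𝕜 := ℂ)).mul_const
      (Es t t a b)) ?_ measurableSet_Ioi
    intro s hs
    simp only [min_eq_right (le_of_lt hs : t ≤ s)]
    rw [real_smul]
    rfl
  have e2 : ∫ s in Ioi t, (4 * γ * Real.exp (-(4 * γ) * s)) • Es t (min s t) a b =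
      exp (-(4 * γ) * t) * Es t t a b := by
    rw [setIntegral_congr_fun measurableSet_Ioi (g := fun s =>
      (4 * γ * Real.exp (-(4 * γ) * s)) • Es t t a b), integral_smul_const, integral_Ioi_expo hγ]
    · rw [real_smul]; push_cast; rfl
    · intro s hs
      simp only [min_eq_right (le_of_lt hs : t ≤ s)]
  have e1 : ∫ s in Ioc 0 t, (4 * γ * Real.exp (-(4 * γ) * s)) • Es t (min s t) a b =
      4 * γ * exp (2 * t * (b⁻¹ - a)) *
        ((exp (2 * (cfun a - cfun b - 2 * γ) * t) - 1) / (2 * (cfun a - cfun b - 2 * γ))) := by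
    have h0 : 2 * (cfun a - cfun b - 2 * γ) ≠ 0 := mul_ne_zero two_ne_zero he
    have := integral_exp_mul_complex (a := 0) (b := t) h0
    rw [intervalIntegral.integral_of_le ht] at this
    simp only [ofReal_zero, mul_zero, exp_zero] at this
    rw [← this, ← integral_const_mul]
    refine setIntegral_congr_fun measurableSet_Ioc fun s hs => ?_
    simp only [min_eq_left hs.2]
    rw [Es_eq, real_smul]
    push_cast
    rw [show 2 * (cfun a - cfun b - 2 * γ) * s = -(4 * γ) * s + 2 * s * (cfun a - cfun b) by ring,
      exp_add]
    ring
  rw [e1, e2, Es_eq]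
  have e3 : exp (t * (epsfun γ a + epsfun γ b)) =
      exp (2 * (cfun a - cfun b - 2 * γ) * t) * exp (2 * t * (b⁻¹ - a)) := by
    rw [← exp_add]
    congr 1
    unfold epsfun cfun
    ring
  have e4 : exp (-(4 * γ) * t) * (exp (2 * t * (cfun a - cfun b)) * exp (2 * t * (b⁻¹ - a))) =
      exp (2 * (cfun a - cfun b - 2 * γ) * t) * exp (2 * t * (b⁻¹ - a)) := by
    rw [← mul_assoc, ← exp_add]
    congr 2
    ring
  rw [e4, e3]
  unfold Sfun
  generalize cfun a - cfun b = δ at he ⊢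
  obtain ⟨D, rfl⟩ : ∃ D, δ = D + 2 * γ := ⟨δ - 2 * γ, by ring⟩
  simp only [add_sub_cancel_right] at he ⊢
  generalize exp (2 * D * t) = e
  generalize exp (2 * t * (b⁻¹ - a)) = f
  field_simp
  ring

lemma norm_Es_le {t s : ℝ} (h0 : 0 ≤ s) (h1 : s ≤ t) (a b : ℂ) :
    ‖Es t s a b‖ ≤ Real.exp (2 * t * (‖a‖⁻¹ + ‖a‖ + ‖b‖⁻¹ + ‖b‖)) := by
  unfold Es
  refine (norm_exp_le_exp_norm _).trans (Real.exp_le_exp.2 ?_)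
  have hs : ‖(s : ℂ)‖ = s := by rw [Complex.norm_real, Real.norm_of_nonneg h0]
  have hs2 : ‖(2 * t - s : ℂ)‖ = 2 * t - s := by
    rw [show (2 * t - s : ℂ) = ((2 * t - s : ℝ) : ℂ) by push_cast; ring, Complex.norm_real,
      Real.norm_of_nonneg (by linarith)]
  have e1 : ‖(s : ℂ) / a‖ ≤ 2 * t * ‖a‖⁻¹ := by
    rw [norm_div, hs, div_eq_mul_inv]; gcongr; linarith
  have e2 : ‖(2 * t - s : ℂ) * a‖ ≤ 2 * t * ‖a‖ := by
    rw [norm_mul, hs2]; gcongr; linarith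
  have e3 : ‖(2 * t - s : ℂ) / b‖ ≤ 2 * t * ‖b‖⁻¹ := by
    rw [norm_div, hs2, div_eq_mul_inv]; gcongr; linarith
  have e4 : ‖(s : ℂ) * b‖ ≤ 2 * t * ‖b‖ := by
    rw [norm_mul, hs]; gcongr; linarith
  calc _ ≤ ‖(s : ℂ) / a‖ + ‖(2 * t - s : ℂ) * a‖ + ‖(2 * t - s : ℂ) / b‖ + ‖(s : ℂ) * b‖ := by
        refine (norm_sub_le _ _).trans (add_le_add_left ((norm_add_le _ _).trans
          (add_le_add_left (norm_sub_le _ _) _)) _)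
    _ ≤ _ := by linarith

variable {r1 r2 r3 r4 : ℝ}

lemma continuous_Es_comp (hr1 : r1 ≠ 0) (hr2 : r2 ≠ 0) (t : ℝ) {X : Type*} [TopologicalSpace X]
    {s : X → ℝ} (hs : Continuous s) {a b : X → Circle} (ha : Continuous a) (hb : Continuous b) :
    Continuous fun p : X => Es t (s p) (r1 * a p) (r2 * b p) := by
  unfold Es
  have h1 : ∀ p, (r1 * a p : ℂ) ≠ 0 := fun p =>
    mul_ne_zero (by exact_mod_cast hr1) (Circle.coe_ne_zero _)
  have h2 : ∀ p, (r2 * b p : ℂ) ≠ 0 := fun p =>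
    mul_ne_zero (by exact_mod_cast hr2) (Circle.coe_ne_zero _)
  fun_prop (disch := assumption)

lemma M4_Es_fubini {γ t : ℝ} (hγ : 0 < γ) (ht : 0 ≤ t) (hr : Pos4 r1 r2 r3 r4)
    {k : ℂ → ℂ → ℂ → ℂ → ℂ} (hk : ContT r1 r2 r3 r4 k) :
    M4 r1 r2 r3 r4 (fun a b c d => k a b c d * (∫ s, Es t (min s t) a b ∂expo γ) *
        ∫ s, Es t (min s t) c d ∂expo γ) =
      ∫ σ : ℝ × ℝ, M4 r1 r2 r3 r4 (fun a b c d => k a b c d * Es t (min σ.1 t) a b *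
        Es t (min σ.2 t) c d) ∂(expo γ).prod (expo γ) := by
  have := isProbabilityMeasure_expo hγ
  unfold M4
  rw [integral_integral_swap]
  · congr 1
    funext p
    simp_rw [mul_assoc]
    rw [integral_const_mul]
    congr 1
    exact (integral_prod_mul _ _).symm
  · have hc := hk.continuous hr
    obtain ⟨C, hC⟩ := isCompact_univ.exists_bound_of_continuousOn hc.continuousOn
    have c1 : Continuous fun q : (ℝ × ℝ) × (Circle × Circle × Circle × Circle) =>
        Es t (min q.1.1 t) (r1 * q.2.1) (r2 * q.2.2.1) :=
      continuous_Es_comp hr.p1.ne' hr.p2.ne' t (by fun_prop) (by fun_prop) (by fun_prop)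
    have c2 : Continuous fun q : (ℝ × ℝ) × (Circle × Circle × Circle × Circle) =>
        Es t (min q.1.2 t) (r3 * q.2.2.2.1) (r4 * q.2.2.2.2) :=
      continuous_Es_comp hr.p3.ne' hr.p4.ne' t (by fun_prop) (by fun_prop) (by fun_prop)
    refine Integrable.of_bound (C := C * Real.exp (2 * t * (r1⁻¹ + r1 + r2⁻¹ + r2)) *
      Real.exp (2 * t * (r3⁻¹ + r3 + r4⁻¹ + r4))) ?_ ?_
    · exact (((hc.comp continuous_snd).mul c1).mul c2).aestronglyMeasurable
    · have h1 : ∀ᵐ q ∂((expo γ).prod (expo γ)).prod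
          (volume : Measure (Circle × Circle × Circle × Circle)), 0 < q.1.1 := by
        have := (Measure.quasiMeasurePreserving_fst (μ := expo γ) (ν := expo γ)).comp
          (Measure.quasiMeasurePreserving_fst (μ := (expo γ).prod (expo γ))
            (ν := (volume : Measure (Circle × Circle × Circle × Circle))))
        exact this.ae (expo_ae_pos γ)
      have h2 : ∀ᵐ q ∂((expo γ).prod (expo γ)).prod
          (volume : Measure (Circle × Circle × Circle × Circle)), 0 < q.1.2 := by
        have := (Measure.quasiMeasurePreserving_snd (μ := expo γ) (ν := expo γ)).comp
          (Measure.quasiMeasurePreserving_fst (μ := (expo γ).prod (expo γ))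
            (ν := (volume : Measure (Circle × Circle × Circle × Circle))))
        exact this.ae (expo_ae_pos γ)
      filter_upwards [h1, h2] with q hq1 hq2
      have hC' := hC q.2 (mem_univ _)
      have b1 := norm_Es_le (le_min hq1.le ht) (min_le_right q.1.1 t) (r1 * q.2.1) (r2 * q.2.2.1)
      have b2 := norm_Es_le (le_min hq2.le ht) (min_le_right q.1.2 t) (r3 * q.2.2.2.1)
        (r4 * q.2.2.2.2)
      rw [norm_mul_circle hr.p1.le, norm_mul_circle hr.p2.le] at b1
      rw [norm_mul_circle hr.p3.le, norm_mul_circle hr.p4.le] at b2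
      simp only [Function.uncurry]
      rw [norm_mul, norm_mul]
      have := (norm_nonneg _).trans hC'
      gcongr

end

/-! ### Deformation of tori and removal of the rational factors -/

noncomputable section

variable {r1 r2 r3 r4 R1 R2 R3 R4 : ℝ} {f k : ℂ → ℂ → ℂ → ℂ → ℂ} {γ t : ℝ}

lemma M4_shrink (hr : Pos4 r1 r2 r3 r4) (h1 : r1 ≤ R1) (h2 : r2 ≤ R2) (h3 : r3 ≤ R3) (h4 : r4 ≤ R4)
    (hd : ∀ a b c d : ℂ, r1 ≤ ‖a‖ → ‖a‖ ≤ R1 → r2 ≤ ‖b‖ → ‖b‖ ≤ R2 → r3 ≤ ‖c‖ → ‖c‖ ≤ R3 →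
      r4 ≤ ‖d‖ → ‖d‖ ≤ R4 → DiffAt f a b c d) :
    M4 R1 R2 R3 R4 f = M4 r1 r2 r3 r4 f := by
  have p1 := hr.p1
  have p2 := hr.p2
  have p3 := hr.p3
  have p4 := hr.p4
  rw [M4_move ⟨p1, p2.trans_le h2, p3.trans_le h3, p4.trans_le h4⟩ h1, M4_swap12,
    M4_move ⟨p2, p1, p3.trans_le h3, p4.trans_le h4⟩ h2, ← M4_swap12, M4_swap23, M4_swap12,
    M4_move ⟨p3, p1, p2, p4.trans_le h4⟩ h3, ← M4_swap12, ← M4_swap23,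
    M4_swap34, M4_swap23, M4_swap12, M4_move ⟨p4, p1, p2, p3⟩ h4, ← M4_swap12, ← M4_swap23,
    ← M4_swap34]
  · intro d a b c e1 e2 e3 e4 e5
    exact DiffAt.swap12 (f := fun a d b c => f a b c d) <| DiffAt.swap23 (f := fun a b d c => f a b c d)
      <| DiffAt.swap34 (f := f) <| hd a b c d e3.ge (e3.le.trans h1) e4.ge (e4.le.trans h2)
        e5.ge (e5.le.trans h3) e1 e2
  · intro c a b d e1 e2 e3 e4 e5
    exact DiffAt.swap12 (f := fun a c b d => f a b c d) <| DiffAt.swap23 (f := f) <|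
      hd a b c d e3.ge (e3.le.trans h1) e4.ge (e4.le.trans h2) e1 e2 (e5.ge.trans' h4) e5.le
  · intro b a c d e1 e2 e3 e4 e5
    exact DiffAt.swap12 (f := f) <|
      hd a b c d e3.ge (e3.le.trans h1) e1 e2 (e4.ge.trans' h3) e4.le (e5.ge.trans' h4) e5.le
  · intro a b c d e1 e2 e3 e4 e5
    exact hd a b c d e1 e2 (e3.ge.trans' h2) e3.le (e4.ge.trans' h3) e4.le (e5.ge.trans' h4) e5.le

lemma M4_eq_of_shrink (hr : Pos4 r1 r2 r3 r4) (hR : Pos4 R1 R2 R3 R4)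
    (hd : ∀ a b c d : ℂ, a ≠ 0 → b ≠ 0 → c ≠ 0 → d ≠ 0 →
      ‖a‖ ≤ r1 → ‖b‖ ≤ r2 → ‖c‖ ≤ r3 → ‖d‖ ≤ r4 → DiffAt f a b c d)
    (hd' : ∀ a b c d : ℂ, a ≠ 0 → b ≠ 0 → c ≠ 0 → d ≠ 0 →
      ‖a‖ ≤ R1 → ‖b‖ ≤ R2 → ‖c‖ ≤ R3 → ‖d‖ ≤ R4 → DiffAt f a b c d) :
    M4 r1 r2 r3 r4 f = M4 R1 R2 R3 R4 f := by
  have hm : Pos4 (min r1 R1) (min r2 R2) (min r3 R3) (min r4 R4) :=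
    ⟨lt_min hr.p1 hR.p1, lt_min hr.p2 hR.p2, lt_min hr.p3 hR.p3, lt_min hr.p4 hR.p4⟩
  have ne0 : ∀ {a : ℂ} {m : ℝ}, 0 < m → m ≤ ‖a‖ → a ≠ 0 := fun h1 h2 => norm_pos_iff.1 (h1.trans_le h2)
  rw [M4_shrink hm (min_le_left _ _) (min_le_left _ _) (min_le_left _ _) (min_le_left _ _),
    M4_shrink hm (min_le_right _ _) (min_le_right _ _) (min_le_right _ _) (min_le_right _ _)]
  · intro a b c d a1 a2 b1 b2 c1 c2 d1 d2
    exact hd' a b c d (ne0 hm.p1 a1) (ne0 hm.p2 b1) (ne0 hm.p3 c1) (ne0 hm.p4 d1) a2 b2 c2 d2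
  · intro a b c d a1 a2 b1 b2 c1 c2 d1 d2
    exact hd a b c d (ne0 hm.p1 a1) (ne0 hm.p2 b1) (ne0 hm.p3 c1) (ne0 hm.p4 d1) a2 b2 c2 d2

lemma M4_rot (r1 r2 r3 r4 : ℝ) (f : ℂ → ℂ → ℂ → ℂ → ℂ) :
    M4 r1 r2 r3 r4 f = M4 r3 r4 r1 r2 (fun a b c d => f c d a b) := by
  rw [M4_swap23, M4_swap12, M4_swap34, M4_swap23]

def Ehat (γ t : ℝ) (a b : ℂ) : ℂ := ∫ s, Es t (min s t) a b ∂expo γ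

section Diff
variable {E : Type*} [NormedAddCommGroup E] [NormedSpace ℂ E] {f g : E → ℂ} {x : E} {s : ℝ}

@[fun_prop]
lemma _root_.DifferentiableAt.Es (hf : DifferentiableAt ℂ f x) (hg : DifferentiableAt ℂ g x)
    (hf0 : f x ≠ 0) (hg0 : g x ≠ 0) :
    DifferentiableAt ℂ (fun x => Es t s (f x) (g x)) x := by
  unfold VarianceAsymptotics.Es
  fun_prop (disch := assumption)

lemma _root_.DifferentiableAt.Ehat (hγ : 0 < γ) (ht : 0 ≤ t) (hf : DifferentiableAt ℂ f x)
    (hg : DifferentiableAt ℂ g x)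
    (hf0 : f x ≠ 0) (hg0 : g x ≠ 0) (h0 : cfun (f x) - cfun (g x) - 2 * γ ≠ 0) :
    DifferentiableAt ℂ (fun x => Ehat γ t (f x) (g x)) x := by
  have h1 : DifferentiableAt ℂ (fun x => cfun (f x) - cfun (g x) - 2 * γ) x := by
    fun_prop (disch := assumption)
  have h2 : DifferentiableAt ℂ (fun x => exp (t * (epsfun γ (f x) + epsfun γ (g x))) *
      VarianceAsymptotics.Sfun γ (f x) (g x) -
        2 * γ / (cfun (f x) - cfun (g x) - 2 * γ) * exp (2 * t * ((g x)⁻¹ - f x))) x := by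
    fun_prop (disch := assumption)
  refine h2.congr_of_eventuallyEq ?_
  filter_upwards [h1.continuousAt.eventually_ne h0] with y hy
  exact Ehat_eq hγ ht hy

end Diff

lemma M4_avg (hγ : 0 < γ) (ht : 0 ≤ t) (hr : Pos4 r1 r2 r3 r4)
    (hk : ∀ a b c d : ℂ, ‖a‖ ≤ r1 → ‖b‖ = r2 → ‖c‖ = r3 → ‖d‖ = r4 → DiffAt k a b c d)
    (hg : ∀ a b : ℂ, 0 < ‖a‖ → ‖a‖ ≤ r1 → ‖b‖ = r2 → cfun a - cfun b - 2 * γ ≠ 0) :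
    M4 r1 r2 r3 r4 (fun a b c d => k a b c d *
        (exp (t * (epsfun γ a + epsfun γ b)) * Sfun γ a b)) =
      M4 r1 r2 r3 r4 (fun a b c d => k a b c d * Ehat γ t a b) := by
  have hne : ∀ {a : ℂ} {r : ℝ}, 0 < r → ‖a‖ = r → a ≠ 0 := fun h1 h2 => norm_pos_iff.1 (h2 ▸ h1)
  have hres : M4 r1 r2 r3 r4 (fun a b c d => k a b c d *
      (2 * γ / (cfun a - cfun b - 2 * γ) * exp (2 * t * (b⁻¹ - a)))) = 0 := by
    refine M4_disc hr (.of_diffAt fun a b c d h1 h2 h3 h4 => ?_) fun b c d h2 h3 h4 =>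
      ⟨fun a => k a b c d * (4 * γ * a / (1 + a ^ 2 - 2 * (cfun b + 2 * γ) * a) *
        exp (2 * t * (b⁻¹ - a))), ?_, ?_, ?_⟩
    · have e1 := hk a b c d h1.le h2 h3 h4
      have e2 := hne hr.p1 h1
      have e3 := hne hr.p2 h2
      have e4 := hg a b (h1 ▸ hr.p1) h1.le h2
      unfold DiffAt at e1 ⊢
      fun_prop (disch := assumption)
    · intro a h1
      have e1 := (hk a b c d h1 h2 h3 h4).left
      have e2 : 1 + a ^ 2 - 2 * (cfun b + 2 * γ) * a ≠ 0 := by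
        rcases eq_or_ne a 0 with rfl | ha
        · simp
        · have := hg a b (norm_pos_iff.2 ha) h1 h2
          intro h
          apply this
          have e : cfun a - cfun b - 2 * γ = (1 + a ^ 2 - 2 * (cfun b + 2 * γ) * a) / (2 * a) := by
            unfold cfun; field_simp; ring
          rw [e, h, zero_div]
      fun_prop (disch := assumption)
    · simp
    · intro a h1
      have ha := hne hr.p1 h1
      have := hg a b (h1 ▸ hr.p1) h1.le h2
      have e : cfun a - cfun b - 2 * γ = (1 + a ^ 2 - 2 * (cfun b + 2 * γ) * a) / (2 * a) := by
        unfold cfun; field_simp; ring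
      simp only [e]
      congr 2
      rw [div_div_eq_mul_div]
      ring
  have h1 : M4 r1 r2 r3 r4 (fun a b c d => k a b c d * Ehat γ t a b) =
      M4 r1 r2 r3 r4 (fun a b c d => k a b c d *
        (exp (t * (epsfun γ a + epsfun γ b)) * Sfun γ a b) - k a b c d *
      (2 * γ / (cfun a - cfun b - 2 * γ) * exp (2 * t * (b⁻¹ - a)))) := by
    refine M4_congr hr fun a b c d h1 h2 h3 h4 => ?_
    have := Ehat_eq hγ ht (hg a b (h1 ▸ hr.p1) h1.le h2)
    rw [Ehat, this]
    ring
  rw [h1, M4_sub hr, hres, sub_zero]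
  all_goals
    refine .of_diffAt fun a b c d h1 h2 h3 h4 => ?_
    have e1 := hk a b c d h1.le h2 h3 h4
    have e2 := hne hr.p1 h1
    have e3 := hne hr.p2 h2
    have e4 := hg a b (h1 ▸ hr.p1) h1.le h2
    unfold DiffAt at e1 ⊢
    fun_prop (disch := assumption)

lemma M4_Ehat_fubini (hγ : 0 < γ) (ht : 0 ≤ t) (hr : Pos4 r1 r2 r3 r4)
    (hk : ContT r1 r2 r3 r4 k) :
    M4 r1 r2 r3 r4 (fun a b c d => k a b c d * Ehat γ t a b) =
      ∫ s, M4 r1 r2 r3 r4 (fun a b c d => k a b c d * Es t (min s t) a b) ∂expo γ := by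
  have := isProbabilityMeasure_expo hγ
  unfold M4 Ehat
  rw [integral_integral_swap]
  · congr 1
    funext p
    rw [integral_const_mul]
  · have hc := hk.continuous hr
    obtain ⟨C, hC⟩ := isCompact_univ.exists_bound_of_continuousOn hc.continuousOn
    have c1 : Continuous fun q : ℝ × (Circle × Circle × Circle × Circle) =>
        Es t (min q.1 t) (r1 * q.2.1) (r2 * q.2.2.1) :=
      continuous_Es_comp hr.p1.ne' hr.p2.ne' t (by fun_prop) (by fun_prop) (by fun_prop)
    refine Integrable.of_bound (C := C * Real.exp (2 * t * (r1⁻¹ + r1 + r2⁻¹ + r2))) ?_ ?_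
    · exact ((hc.comp continuous_snd).mul c1).aestronglyMeasurable
    · have h1 : ∀ᵐ q ∂(expo γ).prod
          (volume : Measure (Circle × Circle × Circle × Circle)), 0 < q.1 :=
        (Measure.quasiMeasurePreserving_fst (μ := expo γ)
            (ν := (volume : Measure (Circle × Circle × Circle × Circle)))).ae (expo_ae_pos γ)
      filter_upwards [h1] with q hq1
      have hC' := hC q.2 (mem_univ _)
      have b1 := norm_Es_le (le_min hq1.le ht) (min_le_right q.1 t) (r1 * q.2.1) (r2 * q.2.2.1)
      rw [norm_mul_circle hr.p1.le, norm_mul_circle hr.p2.le] at b1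
      simp only [Function.uncurry]
      rw [norm_mul]
      have := (norm_nonneg _).trans hC'
      gcongr

/-- The regular part of the symmetrized kernel. -/
def kreg (a b c d : ℂ) : ℂ :=
  koebe (a * b * c * d) * (geo (a * b) * geo (c * d) + geo (a * b) ^ 2 + 2 * geo (a * c) ^ 2 -
    4 * geo (a * b) * geo (a * c))

/-- The part of the symmetrized kernel with a pole at `bc = 1`. -/
def ksing (a b c d : ℂ) : ℂ := koebe (a * b * c * d) * Wfun a b c

def errS14 (γ r t : ℝ) : ℂ := M4 (r ^ 3) 1 (r ^ 2) r (fun a d b c =>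
  koebe (a * b * c * d) * (geo (a * b) - geo (a * c)) ^ 2 *
    exp (t * (epsfun γ b + epsfun γ c)) * Ehat γ t a d)

theorem q2_eq_Ehat {γ r : ℝ} (hγ : 0 < γ) (hr0 : 0 < r) (hr : r < 1 / (4 * γ + 4))
    (ht : 0 ≤ t) : q2 γ r t =
      M4 (r ^ 3) (r ^ 2) r 1 (fun a b c d =>
        (kreg a b c d + 4 * γ * ksing a b c d) * Ehat γ t a b * Ehat γ t c d) - errS14 γ r t := by
  have hr1 : r < 1 := hr.trans (by rw [div_lt_one (by positivity)]; linarith)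
  have hp : Pos4 (r ^ 3) (r ^ 2) r 1 := ⟨by positivity, by positivity, hr0, one_pos⟩
  have hp' : Pos4 r 1 (r ^ 3) (r ^ 2) := ⟨hr0, one_pos, hp.p1, hp.p2⟩
  have hp'' : Pos4 (r ^ 3) 1 (r ^ 2) r := ⟨hp.p1, one_pos, hp.p2, hr0⟩
  have h32 : r ^ 3 ≤ r ^ 2 := pow_le_pow_of_le_one hr0.le hr1.le (by norm_num)
  have h21 : r ^ 2 ≤ r := by nlinarith
  have hr3 : r ^ 3 < 1 := pow_lt_one₀ hr0.le hr1 (by norm_num)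
  have hr2 : r ^ 2 < 1 := pow_lt_one₀ hr0.le hr1 (by norm_num)
  have gap : ∀ a b : ℂ, 0 < ‖a‖ → ‖a‖ ≤ r * ‖b‖ → ‖b‖ ≤ 1 →
      cfun a - cfun b - 2 * γ ≠ 0 := fun a b h1 h2 h3 =>
    (cfun_sub_ne hγ hr0 hr h1 h2 h3).1
  have ne0 : ∀ a : ℂ, 0 < ‖a‖ → a ≠ 0 := fun a h => norm_pos_iff.1 h
  have n2 : ∀ a b : ℂ, ‖a‖ < 1 → ‖b‖ ≤ 1 → 1 - a * b ≠ 0 := fun a b h1 h2 => one_sub_ne (by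
    rw [norm_mul]; nlinarith [norm_nonneg a, norm_nonneg b])
  have n4 : ∀ a b c d : ℂ, ‖a‖ < 1 → ‖b‖ ≤ 1 → ‖c‖ ≤ 1 → ‖d‖ ≤ 1 → 1 - a * b * c * d ≠ 0 :=
    fun a b c d h1 h2 h3 h4 => by
      rw [mul_assoc a, mul_assoc a]
      refine n2 a _ h1 ?_
      rw [norm_mul, norm_mul]
      exact mul_le_one₀ (mul_le_one₀ h2 (norm_nonneg _) h3) (norm_nonneg _) h4
  have gap12 : ∀ a b : ℂ, 0 < ‖a‖ → ‖a‖ ≤ r ^ 3 → ‖b‖ = r ^ 2 → cfun a - cfun b - 2 * γ ≠ 0 :=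
    fun a b h1 h2 h3 => gap a b h1 (by rw [h3]; nlinarith) (by linarith)
  have gap34 : ∀ a b : ℂ, 0 < ‖a‖ → ‖a‖ ≤ r → ‖b‖ = 1 → cfun a - cfun b - 2 * γ ≠ 0 :=
    fun a b h1 h2 h3 => gap a b h1 (by rw [h3]; nlinarith) (by linarith)
  have gap14 : ∀ a b : ℂ, 0 < ‖a‖ → ‖a‖ ≤ r ^ 3 → ‖b‖ = 1 → cfun a - cfun b - 2 * γ ≠ 0 :=
    fun a b h1 h2 h3 => gap34 a b h1 (by linarith) h3
  have pos : ∀ {z : ℂ} {s : ℝ}, 0 < s → ‖z‖ = s → 0 < ‖z‖ := fun h1 h2 => h2 ▸ h1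
  rw [q2_eq_symIntegrand hγ hr0 hr]
  set K : ℂ → ℂ → ℂ → ℂ → ℂ := fun a b c d => kreg a b c d + 4 * γ * ksing a b c d with hK
  have hKd : ∀ a b c d : ℂ, ‖a‖ ≤ r ^ 3 → ‖b‖ = r ^ 2 → ‖c‖ ≤ r → ‖d‖ = 1 → DiffAt K a b c d := by
    intro a b c d h1 h2 h3 h4
    have g1 := n4 a b c d (by linarith) (by linarith) (by linarith) (by linarith)
    have g2 := n2 a b (by linarith) (by linarith)
    have g3 := n2 a c (by linarith) (by linarith)
    have g4 := n2 b c (by linarith) (by linarith)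
    have g5 := n2 c d (by linarith) (by linarith)
    rw [hK]
    unfold DiffAt kreg ksing
    fun_prop (disch := assumption)
  have hk1 : ∀ a b c d : ℂ, ‖a‖ ≤ r ^ 3 → ‖b‖ = r ^ 2 → ‖c‖ = r → ‖d‖ = 1 →
      DiffAt (fun a b c d => K a b c d *
        (exp (t * (epsfun γ c + epsfun γ d)) * Sfun γ c d)) a b c d := by
    intro a b c d h1 h2 h3 h4
    have e1 := hKd a b c d h1 h2 h3.le h4
    have g1 := ne0 c (pos hr0 h3)
    have g2 := ne0 d (pos one_pos h4)
    have g3 := gap34 c d (pos hr0 h3) h3.le h4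
    unfold DiffAt at e1 ⊢
    fun_prop (disch := assumption)
  have hk2 : ∀ c d a b : ℂ, ‖c‖ ≤ r → ‖d‖ = 1 → ‖a‖ = r ^ 3 → ‖b‖ = r ^ 2 →
      DiffAt (fun c d a b => K a b c d * Ehat γ t a b) c d a b := by
    intro c d a b h1 h2 h3 h4
    have e0 := hKd a b c d h3.le h4 h1 h2
    have e1 : DiffAt (fun c d a b => K a b c d) c d a b :=
      DifferentiableAt.comp (g := fun p : ℂ × ℂ × ℂ × ℂ => K p.1 p.2.1 p.2.2.1 p.2.2.2)
        (f := fun p : ℂ × ℂ × ℂ × ℂ => (p.2.2.1, p.2.2.2, p.1, p.2.1)) (c, d, a, b) e0 (by fun_prop)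
    have g1 := ne0 a (pos hp.p1 h3)
    have g2 := ne0 b (pos hp.p2 h4)
    have g3 := gap12 a b (pos hp.p1 h3) h3.le h4
    have e2 : DifferentiableAt ℂ (fun p : ℂ × ℂ × ℂ × ℂ => Ehat γ t p.2.2.1 p.2.2.2) (c, d, a, b) :=
      .Ehat hγ ht (by fun_prop) (by fun_prop) g1 g2 g3
    exact DifferentiableAt.mul e1 e2
  have hk3 : ∀ a d b c : ℂ, ‖a‖ ≤ r ^ 3 → ‖d‖ = 1 → ‖b‖ = r ^ 2 → ‖c‖ = r →
      DiffAt (fun a d b c => koebe (a * b * c * d) * (geo (a * b) - geo (a * c)) ^ 2 *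
        exp (t * (epsfun γ b + epsfun γ c))) a d b c := by
    intro a d b c h1 h2 h3 h4
    have g0 := n4 a b c d (by linarith) (by linarith) (by linarith) (by linarith)
    have g1 := ne0 b (pos hp.p2 h3)
    have g2 := ne0 c (pos hr0 h4)
    have g3 := n2 a b (by linarith) (by linarith)
    have g4 := n2 a c (by linarith) (by linarith)
    unfold DiffAt
    fun_prop (disch := assumption)
  have E1 := M4_avg hγ ht hp hk1 gap12
  have E2 := M4_avg hγ ht hp' hk2 gap34
  have E3 := M4_avg hγ ht hp'' hk3 gap14
  rw [errS14, ← E3, M4_swap23 (r ^ 3) 1, M4_swap34 (r ^ 3) (r ^ 2) 1]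
  have E4 : M4 (r ^ 3) (r ^ 2) r 1 (fun a b c d => K a b c d * Ehat γ t a b * Ehat γ t c d) =
      M4 (r ^ 3) (r ^ 2) r 1 (fun a b c d => K a b c d *
        (exp (t * (epsfun γ c + epsfun γ d)) * Sfun γ c d) *
        (exp (t * (epsfun γ a + epsfun γ b)) * Sfun γ a b)) := by
    rw [E1, M4_rot, ← E2, M4_rot]
    refine M4_congr hp fun a b c d _ _ _ _ => ?_
    ring
  rw [E4, ← M4_sub hp]
  · refine M4_congr hp fun a b c d _ _ _ _ => ?_
    rw [symIntegrand, weight, hK]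
    simp only [mul_add, exp_add, kreg, ksing]
    ring
  · refine .of_diffAt fun a b c d h1 h2 h3 h4 => ?_
    have e1 := hk1 a b c d h1.le h2 h3 h4
    have g1 := ne0 a (pos hp.p1 h1)
    have g2 := ne0 b (pos hp.p2 h2)
    have g3 := gap12 a b (pos hp.p1 h1) h1.le h2
    unfold DiffAt at e1 ⊢
    fun_prop (disch := assumption)
  · refine .of_diffAt fun a b c d h1 h2 h3 h4 => ?_
    have g5 := ne0 a (pos hp.p1 h1)
    have g1 := ne0 b (pos hp.p2 h2)
    have g2 := ne0 c (pos hr0 h3)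
    have g6 := ne0 d (pos one_pos h4)
    have g7 := gap14 a d (pos hp.p1 h1) h1.le h4
    have g0 := n4 a b c d (by linarith) (by linarith) (by linarith) (by linarith)
    have g3 := n2 a b (by linarith) (by linarith)
    have g4 := n2 a c (by linarith) (by linarith)
    unfold DiffAt
    fun_prop (disch := assumption)

end

/-! ### Sliding the contours through the pole at `bc = 1` -/

noncomputable section

variable {r1 r2 r3 r4 R1 R2 R3 R4 : ℝ} {t s1 s2 : ℝ}

/-- Radii for which `Wfun` and `koebe` have no pole other than possibly the one at `bc = 1`. -/
structure GoodRadii (r1 r2 r3 r4 : ℝ) : Prop where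
  pos : Pos4 r1 r2 r3 r4
  ab : r1 * r2 < 1
  ac : r1 * r3 < 1
  abcd : r1 * r2 * r3 * r4 < 1

lemma one_sub_mul_ne {a b : ℂ} (h1 : ‖a‖ ≤ r1) (h2 : ‖b‖ ≤ r2) (hab : r1 * r2 < 1) :
    1 - a * b ≠ 0 := by
  refine one_sub_ne (lt_of_le_of_lt ?_ hab)
  rw [norm_mul]
  gcongr
  exact (norm_nonneg _).trans h1

lemma one_sub_mul4_ne {a b c d : ℂ} (h1 : ‖a‖ ≤ r1) (h2 : ‖b‖ ≤ r2) (h3 : ‖c‖ ≤ r3) (h4 : ‖d‖ ≤ r4)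
    (h : r1 * r2 * r3 * r4 < 1) : 1 - a * b * c * d ≠ 0 := by
  refine one_sub_ne (lt_of_le_of_lt ?_ h)
  have p1 := (norm_nonneg _).trans h1
  have p2 := (norm_nonneg _).trans h2
  have p3 := (norm_nonneg _).trans h3
  rw [norm_mul, norm_mul, norm_mul]
  gcongr

lemma GoodRadii.diffAt (hr : GoodRadii r1 r2 r3 r4) {a b c d : ℂ} (ha : a ≠ 0) (hb : b ≠ 0)
    (hc : c ≠ 0) (hd : d ≠ 0) (h1 : ‖a‖ ≤ r1) (h2 : ‖b‖ ≤ r2) (h3 : ‖c‖ ≤ r3) (h4 : ‖d‖ ≤ r4)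
    (hbc : 1 - b * c ≠ 0) :
    DiffAt (fun a b c d => ksing a b c d * Es t s1 a b * Es t s2 c d) a b c d := by
  have g1 := one_sub_mul_ne h1 h2 hr.ab
  have g2 := one_sub_mul_ne h1 h3 hr.ac
  have g3 := one_sub_mul4_ne h1 h2 h3 h4 hr.abcd
  unfold DiffAt ksing
  fun_prop (disch := assumption)

lemma M4_ksing_lt (hr : GoodRadii r1 r2 r3 r4) (hR : GoodRadii R1 R2 R3 R4) (h : r2 * r3 < 1)
    (H : R2 * R3 < 1) :
    M4 r1 r2 r3 r4 (fun a b c d => ksing a b c d * Es t s1 a b * Es t s2 c d) =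
      M4 R1 R2 R3 R4 (fun a b c d => ksing a b c d * Es t s1 a b * Es t s2 c d) :=
  M4_eq_of_shrink hr.pos hR.pos
    (fun _ _ _ _ ha hb hc hd h1 h2 h3 h4 =>
      hr.diffAt ha hb hc hd h1 h2 h3 h4 (one_sub_mul_ne h2 h3 h))
    (fun _ _ _ _ ha hb hc hd h1 h2 h3 h4 =>
      hR.diffAt ha hb hc hd h1 h2 h3 h4 (one_sub_mul_ne h2 h3 H))

lemma M4_ksing_shrink (hR : GoodRadii R1 R2 R3 R4) (hr : Pos4 r1 r2 r3 r4)
    (h1 : r1 ≤ R1) (h2 : r2 ≤ R2) (h3 : r3 ≤ R3) (h4 : r4 ≤ R4) (h : 1 < r2 * r3) :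
    M4 R1 R2 R3 R4 (fun a b c d => ksing a b c d * Es t s1 a b * Es t s2 c d) =
      M4 r1 r2 r3 r4 (fun a b c d => ksing a b c d * Es t s1 a b * Es t s2 c d) := by
  have ne0 : ∀ {a : ℂ} {m : ℝ}, 0 < m → m ≤ ‖a‖ → a ≠ 0 := fun h1 h2 => norm_pos_iff.1 (h1.trans_le h2)
  refine M4_shrink hr h1 h2 h3 h4 fun a b c d a1 a2 b1 b2 c1 c2 d1 d2 =>
    hR.diffAt (ne0 hr.p1 a1) (ne0 hr.p2 b1) (ne0 hr.p3 c1) (ne0 hr.p4 d1) a2 b2 c2 d2 ?_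
  intro h0
  have h5 : ‖b‖ * ‖c‖ = 1 := by rw [← norm_mul, ← sub_eq_zero.1 h0, norm_one]
  have : r2 * r3 ≤ ‖b‖ * ‖c‖ := mul_le_mul b1 c1 hr.p3.le (norm_nonneg _)
  linarith

lemma M4_ksing_gt (hr : GoodRadii r1 r2 r3 r4) (hR : GoodRadii R1 R2 R3 R4) (h : 1 < r2 * r3)
    (H : 1 < R2 * R3) :
    M4 r1 r2 r3 r4 (fun a b c d => ksing a b c d * Es t s1 a b * Es t s2 c d) =
      M4 R1 R2 R3 R4 (fun a b c d => ksing a b c d * Es t s1 a b * Es t s2 c d) := by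
  obtain ⟨p1, p2, p3, p4⟩ := hr.pos
  obtain ⟨P1, P2, P3, P4⟩ := hR.pos
  set B := max r2 R2
  set C := max r3 R3
  have hB : 0 < B := lt_max_of_lt_left p2
  have hC : 0 < C := lt_max_of_lt_left p3
  have hBC : 1 < B * C := h.trans_le
    (mul_le_mul (le_max_left _ _) (le_max_left _ _) p3.le hB.le)
  obtain ⟨e, he, he1⟩ : ∃ e : ℝ, 0 < e ∧ e ≤ min (min r1 r4) (min (min R1 R4)
      (min (1 / 2) (min (1 / (2 * B)) (min (1 / (2 * C)) (1 / (2 * B * C)))))) :=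
    ⟨_, by positivity, le_rfl⟩
  simp only [le_min_iff] at he1
  obtain ⟨⟨e1, e2⟩, ⟨e3, e4⟩, e5, e6, e7, e8⟩ := he1
  rw [le_div_iff₀ (by positivity)] at e6 e7 e8
  have hG : GoodRadii e B C e := ⟨⟨he, hB, hC, he⟩, by linarith, by linarith, by nlinarith⟩
  rw [M4_ksing_shrink hr ⟨he, p2, p3, he⟩ e1 le_rfl le_rfl e2 h,
    M4_ksing_shrink hR ⟨he, P2, P3, he⟩ e3 le_rfl le_rfl e4 H,
    ← M4_ksing_shrink hG ⟨he, p2, p3, he⟩ le_rfl (le_max_left _ _) (le_max_left _ _) le_rfl h,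
    ← M4_ksing_shrink hG ⟨he, P2, P3, he⟩ le_rfl (le_max_right _ _) (le_max_right _ _) le_rfl H]

/-- The residue at `c = 1 / b` is odd under `b ↦ 1 / b`. -/
lemma M4_ksing_residue :
    M4 1 (1 / 4) 1 (1 / 4) (fun _ a b d => koebe (a * d) *
      (2 * a ^ 2 * (b - b⁻¹) / ((1 - a * b) ^ 2 * (1 - a * b⁻¹) ^ 2)) *
      Es t s1 a b * Es t s2 b⁻¹ d) = 0 := by
  rw [M4_swap23, M4_swap12]
  have h : ∀ z : ℂ, z = -z → z = 0 := fun z hz => by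
    have : 2 * z = 0 := by linear_combination hz
    simpa using this
  apply h
  conv_lhs => rw [M4_inv]
  rw [inv_one, ← neg_one_mul, ← M4_const_mul]
  congr 1
  funext b c a d
  have e : Es t s1 a b⁻¹ * Es t s2 b⁻¹⁻¹ d = Es t s1 a b * Es t s2 b⁻¹ d := by
    unfold Es
    rw [← exp_add, ← exp_add]
    congr 1
    simp only [inv_inv, div_eq_mul_inv]
    ring
  rw [mul_assoc, e, mul_comm ((1 - a * b⁻¹) ^ 2), inv_inv]
  ring

lemma M4_ksing_cross :
    M4 (1 / 4) 1 2 (1 / 4) (fun a b c d => ksing a b c d * Es t s1 a b * Es t s2 c d) =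
      M4 (1 / 4) 1 (1 / 2) (1 / 4) (fun a b c d => ksing a b c d * Es t s1 a b * Es t s2 c d) := by
  rw [← sub_eq_zero, M4_swap23, M4_swap12, M4_swap23 (1 / 4) 1 (1 / 2), M4_swap12 (1 / 4) (1 / 2)]
  set g : ℂ → ℂ → ℂ → ℂ → ℂ := fun c a b d => koebe (a * b * c * d) *
      (2 * a ^ 2 * (b - c) / ((1 - a * b) ^ 2 * (1 - a * c) ^ 2)) * Es t s1 a b * Es t s2 c d with hg
  have hG : GoodRadii (1 / 4) 1 2 (1 / 4) := ⟨⟨by norm_num, one_pos, two_pos, by norm_num⟩,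
    by norm_num, by norm_num, by norm_num⟩
  have ne0 : ∀ {a : ℂ} {m : ℝ}, 0 < m → m ≤ ‖a‖ → a ≠ 0 := fun h1 h2 => norm_pos_iff.1 (h1.trans_le h2)
  have hp : Pos4 (1 / 2) (1 / 4) 1 (1 / 4) := ⟨by norm_num, by norm_num, one_pos, by norm_num⟩
  set f : ℂ → ℂ → ℂ → ℂ → ℂ := fun c a b d => c / (c - b⁻¹) * g c a b d with hf
  have key : ∀ c a b d : ℂ, b ≠ 0 → ksing a b c d * Es t s1 a b * Es t s2 c d = f c a b d := by
    intro c a b d hb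
    have e : Wfun a b c = c / (c - b⁻¹) *
        (2 * a ^ 2 * (b - c) / ((1 - a * b) ^ 2 * (1 - a * c) ^ 2)) := by
      unfold Wfun
      rcases eq_or_ne (1 - b * c) 0 with h0 | h0
      · rw [h0, show c - b⁻¹ = -(1 - b * c) / b by field_simp; ring, h0]; simp
      · rw [show c - b⁻¹ = -(1 - b * c) / b by field_simp; ring]
        rcases eq_or_ne (1 - a * b) 0 with h1 | h1
        · simp [h1]
        rcases eq_or_ne (1 - a * c) 0 with h2 | h2
        · simp [h2]
        field_simp
    rw [hf, hg]
    simp only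
    rw [ksing, e]
    ring
  rw [M4_congr (g := f) ⟨two_pos, hp.p2, hp.p3, hp.p4⟩ fun c a b d _ _ h _ =>
      key c a b d (ne0 one_pos h.ge), M4_congr (g := f) hp fun c a b d _ _ h _ =>
      key c a b d (ne0 one_pos h.ge),
    M4_cross hp (fun _ b _ => b⁻¹) (g := g)]
  · refine Eq.trans (M4_congr ⟨one_pos, hp.p2, hp.p3, hp.p4⟩ ?_) (M4_ksing_residue (s1 := s1) (s2 := s2) (t := t))
    intro z a b d _ _ h _
    have hb : b ≠ 0 := ne0 one_pos h.ge
    rw [hg]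
    simp only [mul_inv_cancel_right₀ hb]
  · intro a b d _ h _
    simp only [norm_inv, h]
    norm_num
  · intro c a b d _ h _
    have hb : b ≠ 0 := ne0 one_pos h.ge
    unfold DiffAt
    fun_prop (disch := assumption)
  · intro c a b d h1 h2 h3 h4 h5
    have ha := ne0 hp.p2 h3.ge
    have hb := ne0 hp.p3 h4.ge
    have hd := ne0 hp.p4 h5.ge
    have hc := ne0 hp.p1 h1
    have g1 := one_sub_mul_ne h3.le h4.le hG.ab
    have g2 := one_sub_mul_ne h3.le h2 hG.ac
    have g3 := one_sub_mul4_ne h3.le h4.le h2 h5.le hG.abcd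
    have g4 := mul_ne_zero (pow_ne_zero 2 g1) (pow_ne_zero 2 g2)
    rw [hg]
    unfold DiffAt
    fun_prop (disch := assumption)
  · rfl

/-- All admissible tori off the pole `bc = 1` give the same integral of the singular part. -/
theorem M4_ksing_eq (hr : GoodRadii r1 r2 r3 r4) (hR : GoodRadii R1 R2 R3 R4) (h : r2 * r3 ≠ 1)
    (H : R2 * R3 ≠ 1) :
    M4 r1 r2 r3 r4 (fun a b c d => ksing a b c d * Es t s1 a b * Es t s2 c d) =
      M4 R1 R2 R3 R4 (fun a b c d => ksing a b c d * Es t s1 a b * Es t s2 c d) := by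
  have base : ∀ {q1 q2 q3 q4 : ℝ}, GoodRadii q1 q2 q3 q4 → q2 * q3 ≠ 1 →
      M4 q1 q2 q3 q4 (fun a b c d => ksing a b c d * Es t s1 a b * Es t s2 c d) =
      M4 (1 / 4) 1 (1 / 2) (1 / 4) (fun a b c d => ksing a b c d * Es t s1 a b * Es t s2 c d) := by
    intro q1 q2 q3 q4 hq hne
    rcases lt_or_gt_of_ne hne with h1 | h1
    · exact M4_ksing_lt hq ⟨⟨by norm_num, one_pos, by norm_num, by norm_num⟩,
        by norm_num, by norm_num, by norm_num⟩ h1 (by norm_num)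
    · rw [← M4_ksing_cross]
      exact M4_ksing_gt hq ⟨⟨by norm_num, one_pos, two_pos, by norm_num⟩,
        by norm_num, by norm_num, by norm_num⟩ h1 (by norm_num)
  rw [base hr h, base hR H]

end

/-! ### Balanced radii and the first error term -/

noncomputable section

variable {r1 r2 r3 r4 : ℝ} {γ t s : ℝ}

lemma re_mul_sub_div_le (p q : ℝ) {z : ℂ} (hz : z ≠ 0) :
    (p * z - q / z).re ≤ |p * ‖z‖ - q / ‖z‖| := by
  have hn : 0 < ‖z‖ := norm_pos_iff.2 hz
  have e : (p * z - q / z).re = (z.re / ‖z‖) * (p * ‖z‖ - q / ‖z‖) := by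
    have h2 : (q / z : ℂ).re = q * z.re / ‖z‖ ^ 2 := by
      rw [div_eq_mul_inv, Complex.re_ofReal_mul, Complex.inv_re, Complex.normSq_eq_norm_sq]
      ring
    rw [sub_re, re_ofReal_mul, h2]
    field_simp
  rw [e]
  refine (le_abs_self _).trans ?_
  rw [abs_mul, abs_div, abs_norm]
  exact mul_le_of_le_one_left (abs_nonneg _) (div_le_one_of_le₀ (abs_re_le_norm z) hn.le)

lemma norm_Es_le_radii (t s : ℝ) {a b : ℂ} (ha : a ≠ 0) (hb : b ≠ 0) :
    ‖Es t s a b‖ ≤ Real.exp (|s / ‖a‖ - (2 * t - s) * ‖a‖| + |(2 * t - s) / ‖b‖ - s * ‖b‖|) := by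
  unfold Es
  rw [norm_exp]
  refine Real.exp_le_exp.2 ?_
  have h1 := re_mul_sub_div_le s (2 * t - s) (inv_ne_zero ha)
  have h2 := re_mul_sub_div_le (2 * t - s) s (inv_ne_zero hb)
  rw [norm_inv, div_inv_eq_mul, ← div_eq_mul_inv, div_inv_eq_mul, ← div_eq_mul_inv] at h1 h2
  have e : (s / a - (2 * t - s) * a + (2 * t - s) / b - s * b : ℂ).re =
      (s / a - (2 * t - s : ℝ) * a : ℂ).re + ((2 * t - s : ℝ) / b - s * b : ℂ).re := by
    rw [← add_re]
    congr 1
    push_cast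
    ring
  rw [e]
  exact add_le_add h1 h2

/-- The radius of `b` at which the two terms of the exponent of `Es` balance. -/
def bal (t s : ℝ) : ℝ := √((2 * t - s) / s)

/-- The common size of the two terms at the balanced radius. -/
def tau (t s : ℝ) : ℝ := √(s * (2 * t - s))

lemma bal_ge_one (hs : 0 < s) (hst : s ≤ t) : 1 ≤ bal t s := by
  unfold bal
  rw [Real.one_le_sqrt, le_div_iff₀ hs]
  linarith

lemma mul_bal (hs : 0 < s) (hst : s ≤ t) : s * bal t s = tau t s := by
  unfold bal tau
  have h : 0 < 2 * t - s := by linarith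
  rw [Real.sqrt_div h.le, Real.sqrt_mul hs.le]
  nth_rw 1 [← Real.mul_self_sqrt hs.le]
  field_simp

lemma div_bal (hs : 0 < s) (hst : s ≤ t) : (2 * t - s) / bal t s = tau t s := by
  have h1 := mul_bal hs hst
  have h0 := bal_ge_one hs hst
  rw [div_eq_iff (by positivity), ← h1]
  have h : 0 < 2 * t - s := by linarith
  have : bal t s * bal t s = (2 * t - s) / s := Real.mul_self_sqrt (by positivity)
  rw [mul_assoc, this]
  field_simp

lemma tau_le (hst : s ≤ t) (hs : 0 ≤ s) : tau t s ≤ 2 * √t * √s := by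
  unfold tau
  have ht : 0 ≤ t := hs.trans hst
  rw [Real.sqrt_le_iff]
  refine ⟨by positivity, ?_⟩
  rw [mul_pow, mul_pow, Real.sq_sqrt hs, Real.sq_sqrt ht]
  nlinarith

lemma exp_sub_exp_neg_le {x : ℝ} (h0 : 0 ≤ x) (h1 : x ≤ 2) : Real.exp x - Real.exp (-x) ≤ 9 * x := by
  have h2 := Real.abs_exp_sub_one_sub_id_le (x := x / 2) (by rw [abs_of_nonneg (by linarith)]; linarith)
  have h3 := Real.add_one_le_exp (-(x / 2))
  have h4 := (abs_le.1 h2).2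
  have h5 : Real.exp (-(x / 2)) ≤ 1 := Real.exp_le_one_iff.2 (by linarith)
  have e1 : Real.exp x = Real.exp (x / 2) ^ 2 := by rw [← Real.exp_nat_mul]; congr 1; push_cast; ring
  have e2 : Real.exp (-x) = Real.exp (-(x / 2)) ^ 2 := by
    rw [← Real.exp_nat_mul]; congr 1; push_cast; ring
  have h6 : 0 ≤ Real.exp (x / 2) - Real.exp (-(x / 2)) := by
    rw [sub_nonneg, Real.exp_le_exp]; linarith
  rw [e1, e2, sq_sub_sq]
  have h7 : Real.exp (x / 2) - Real.exp (-(x / 2)) ≤ 9 / 4 * x := by nlinarith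
  have h8 : Real.exp (x / 2) + Real.exp (-(x / 2)) ≤ 4 := by nlinarith
  nlinarith

/-- The scale `1 / √t`. -/
def del (t : ℝ) : ℝ := (√t)⁻¹

lemma del_pos (ht : 1 ≤ t) : 0 < del t := by unfold del; positivity

lemma del_le_one (ht : 1 ≤ t) : del t ≤ 1 := inv_le_one_of_one_le₀ (Real.one_le_sqrt.2 ht)

lemma sqrt_mul_del (ht : 1 ≤ t) : √t * del t = 1 := mul_inv_cancel₀ (by positivity)

lemma mul_del (ht : 1 ≤ t) : t * del t = √t := by
  unfold del
  nth_rw 1 [← Real.mul_self_sqrt (show 0 ≤ t by linarith)]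
  field_simp

/-- The radius `exp (-1 / √t)` of the contours. -/
def rho (t : ℝ) : ℝ := Real.exp (-del t)

lemma rho_pos : 0 < rho t := Real.exp_pos _

lemma rho_lt_one (ht : 1 ≤ t) : rho t < 1 := by
  have := del_pos ht
  rw [rho, ← Real.exp_zero, Real.exp_lt_exp]
  linarith

lemma half_mul_le_one_sub_exp {x : ℝ} (h0 : 0 ≤ x) (h1 : x ≤ 1) : x / 2 ≤ 1 - Real.exp (-x) := by
  have h2 := Real.add_one_le_exp x
  rw [Real.exp_neg]
  have : (Real.exp x)⁻¹ ≤ (x + 1)⁻¹ := by gcongr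
  have h3 : (x + 1)⁻¹ ≤ 1 - x / 2 := by
    rw [inv_le_iff_one_le_mul₀ (by linarith)]
    nlinarith
  linarith

lemma one_sub_rho (ht : 1 ≤ t) : del t / 2 ≤ 1 - rho t :=
  half_mul_le_one_sub_exp (del_pos ht).le (del_le_one ht)

lemma norm_Es_bal (ht : 1 ≤ t) (hs : 0 < s) (hst : s ≤ t) {a b : ℂ} (ha : ‖a‖ = rho t / bal t s)
    (hb : ‖b‖ = bal t s) : ‖Es t s a b‖ ≤ Real.exp (60 * √s) := by
  have hB := bal_ge_one hs hst
  have hr := rho_pos (t := t)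
  have h1 := mul_bal hs hst
  have h2 := div_bal hs hst
  refine (norm_Es_le_radii t s (norm_pos_iff.1 (ha ▸ by positivity))
    (norm_pos_iff.1 (hb ▸ by positivity))).trans (Real.exp_le_exp.2 ?_)
  rw [ha, hb, h1, h2, sub_self, abs_zero, add_zero]
  have e : s / (rho t / bal t s) - (2 * t - s) * (rho t / bal t s) =
      tau t s * (Real.exp (del t) - Real.exp (-del t)) := by
    calc _ = s * bal t s * (rho t)⁻¹ - (2 * t - s) / bal t s * rho t := by field_simp
      _ = _ := by rw [h1, h2, rho, Real.exp_neg, inv_inv]; ring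
  have d0 := del_pos ht
  have h3 := exp_sub_exp_neg_le d0.le (by linarith [del_le_one ht])
  have h4 : 0 ≤ Real.exp (del t) - Real.exp (-del t) := by
    rw [sub_nonneg, Real.exp_le_exp]; linarith
  have h5 := tau_le hst hs.le
  have h6 : 0 ≤ tau t s := Real.sqrt_nonneg _
  rw [e, abs_of_nonneg (by positivity)]
  calc _ ≤ 2 * √t * √s * (9 * del t) := by gcongr
    _ = 18 * √s * (√t * del t) := by ring
    _ ≤ _ := by rw [sqrt_mul_del ht]; nlinarith [Real.sqrt_nonneg s]

lemma integrable_exp_sqrt (hγ : 0 < γ) (C : ℝ) :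
    Integrable (fun s => Real.exp (C * √s)) (expo γ) := by
  unfold expo
  rw [integrable_withDensity_iff_integrable_smul' (by fun_prop) (by simp)]
  have h := ((integrableOn_exp_mul_Ioi (a := -(2 * γ)) (by linarith) 0).const_mul
    (4 * γ * Real.exp (C ^ 2 / (8 * γ))))
  refine h.mono' (by fun_prop) ?_
  filter_upwards [ae_restrict_mem measurableSet_Ioi] with s hs
  rw [ENNReal.toReal_ofReal (by positivity), smul_eq_mul, Real.norm_of_nonneg (by positivity)]
  have h0 : √s ^ 2 = s := Real.sq_sqrt (le_of_lt hs)
  have h1 : C * √s ≤ C ^ 2 / (8 * γ) + 2 * γ * s := by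
    rw [div_add' _ _ _ (by positivity), le_div_iff₀ (by positivity), ← h0]
    simp only [Real.sqrt_sq (Real.sqrt_nonneg s)]
    nlinarith [sq_nonneg (C - 4 * γ * √s)]
  calc _ = 4 * γ * Real.exp (-(4 * γ) * s + C * √s) := by rw [Real.exp_add]; ring
    _ ≤ 4 * γ * Real.exp (C ^ 2 / (8 * γ) + -(2 * γ) * s) :=
        mul_le_mul_of_nonneg_left (Real.exp_le_exp.2 (by linarith)) (by positivity)
    _ = _ := by rw [Real.exp_add]; ring

lemma norm_geo_le {z : ℂ} {m : ℝ} (hz : ‖z‖ ≤ 1) (hm : 0 < m) (h : m ≤ ‖1 - z‖) : ‖geo z‖ ≤ m⁻¹ := by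
  unfold geo
  rw [norm_div, div_eq_mul_inv]
  have : ‖1 - z‖⁻¹ ≤ m⁻¹ := by gcongr
  exact (mul_le_of_le_one_left (by positivity) hz).trans this

lemma norm_koebe_le {z : ℂ} {m : ℝ} (hz : ‖z‖ ≤ 1) (hm : 0 < m) (h : m ≤ ‖1 - z‖) :
    ‖koebe z‖ ≤ (m ^ 2)⁻¹ := by
  unfold koebe
  rw [norm_div, norm_pow, div_eq_mul_inv]
  have : (‖1 - z‖ ^ 2)⁻¹ ≤ (m ^ 2)⁻¹ := by gcongr
  exact (mul_le_of_le_one_left (by positivity) hz).trans this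

lemma one_sub_norm_le (z : ℂ) : 1 - ‖z‖ ≤ ‖1 - z‖ := by
  simpa using norm_sub_norm_le 1 z

lemma norm_M4_le (hr : Pos4 r1 r2 r3 r4) {f : ℂ → ℂ → ℂ → ℂ → ℂ} {C : ℝ}
    (h : ∀ a b c d : ℂ, ‖a‖ = r1 → ‖b‖ = r2 → ‖c‖ = r3 → ‖d‖ = r4 → ‖f a b c d‖ ≤ C) :
    ‖M4 r1 r2 r3 r4 f‖ ≤ C := by
  unfold M4
  refine (norm_integral_le_of_norm_le_const (ae_of_all _ fun p => h _ _ _ _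
    (norm_mul_circle hr.p1.le _) (norm_mul_circle hr.p2.le _)
      (norm_mul_circle hr.p3.le _) (norm_mul_circle hr.p4.le _))).trans ?_
  simp [measureReal_def, Measure.volume_eq_prod]

lemma norm_exp_epsfun (t : ℝ) {b c : ℂ} (hb : ‖b‖ = 1) (hc : ‖c‖ = 1) :
    ‖exp (t * (epsfun γ b + epsfun γ c))‖ = Real.exp (-(4 * γ) * t) := by
  have h : ∀ z : ℂ, ‖z‖ = 1 → (epsfun γ z).re = -2 * γ := by
    intro z hz
    unfold epsfun
    have : z⁻¹.re = z.re := by rw [inv_re, normSq_eq_norm_sq, hz]; simp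
    simp [this]
  rw [norm_exp, re_ofReal_mul, add_re, h b hb, h c hc]
  congr 1
  ring

lemma norm_errS14_le (hγ : 0 < γ) {r : ℝ} (hr0 : 0 < r) (hr : r < 1) (ht : 1 ≤ t) :
    ‖errS14 γ r t‖ ≤
      64 * t ^ 2 * Real.exp (-(4 * γ) * t) * ∫ s, Real.exp (60 * √s) ∂expo γ := by
  have t0 : 0 ≤ t := by linarith
  have hp'' : Pos4 (r ^ 3) 1 (r ^ 2) r := ⟨by positivity, one_pos, by positivity, hr0⟩
  have hr3 : r ^ 3 < 1 := pow_lt_one₀ hr0.le hr (by norm_num)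
  have hr2 : r ^ 2 < 1 := pow_lt_one₀ hr0.le hr (by norm_num)
  have hprod : r ^ 3 * r ^ 2 * r * 1 < 1 := by
    rw [mul_one]
    have : r ^ 3 * r ^ 2 < 1 := mul_lt_one_of_nonneg_of_lt_one_left (by positivity) hr3 hr2.le
    exact mul_lt_one_of_nonneg_of_lt_one_left (by positivity) this hr.le
  have key : ∀ {q1 q2 q3 q4 : ℝ} {a d b c : ℂ} (s : ℝ), q1 * q3 < 1 → q1 * q4 < 1 →
      q1 * q3 * q4 * q2 < 1 → a ≠ 0 → d ≠ 0 → b ≠ 0 → c ≠ 0 → ‖a‖ ≤ q1 → ‖d‖ ≤ q2 → ‖b‖ ≤ q3 →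
      ‖c‖ ≤ q4 → DiffAt (fun a d b c => koebe (a * b * c * d) * (geo (a * b) - geo (a * c)) ^ 2 *
        exp (t * (epsfun γ b + epsfun γ c)) * Es t s a d) a d b c := by
    intro q1 q2 q3 q4 a d b c s h1 h2 h3 ha hd hb hc ha' hd' hb' hc'
    have g1 := one_sub_mul_ne ha' hb' h1
    have g2 := one_sub_mul_ne ha' hc' h2
    have g3 := one_sub_mul4_ne ha' hb' hc' hd' h3
    unfold DiffAt
    fun_prop (disch := assumption)
  have ne0 : ∀ {a : ℂ} {m : ℝ}, 0 < m → ‖a‖ = m → a ≠ 0 := fun h1 h2 => norm_pos_iff.1 (h2 ▸ h1)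
  have hρ := rho_pos (t := t)
  have hρ1 := rho_lt_one ht
  unfold errS14
  rw [M4_Ehat_fubini hγ t0 hp'']
  · rw [← integral_const_mul]
    refine norm_integral_le_of_norm_le ((integrable_exp_sqrt hγ 60).const_mul _) ?_
    filter_upwards [expo_ae_pos γ] with s hs
    have hs' : 0 < min s t := lt_min hs (by linarith)
    have hR := bal_ge_one hs' (min_le_right s t)
    set R := bal t (min s t)
    have hq : Pos4 (rho t / R) R 1 1 := ⟨by positivity, by positivity, one_pos, one_pos⟩
    have hlt : rho t / R ≤ rho t := div_le_self hρ.le hR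
    have hlt' : rho t / R < 1 := by linarith
    have habcd : rho t / R * R = rho t := by field_simp
    rw [M4_eq_of_shrink hp'' hq]
    · refine norm_M4_le hq fun a d b c ha hd hb hc => ?_
      have e1 : ‖a * b‖ ≤ rho t := by rw [norm_mul, ha, hb, mul_one]; exact hlt
      have e2 : ‖a * c‖ ≤ rho t := by rw [norm_mul, ha, hc, mul_one]; exact hlt
      have e3 : ‖a * b * c * d‖ ≤ rho t := by
        rw [norm_mul, norm_mul, norm_mul, ha, hb, hc, hd, mul_one, mul_one, habcd]
      have d0 := del_pos ht
      have low : ∀ z : ℂ, ‖z‖ ≤ rho t → del t / 2 ≤ ‖1 - z‖ := fun z hz =>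
        (one_sub_rho ht).trans ((by linarith : 1 - rho t ≤ 1 - ‖z‖).trans (one_sub_norm_le z))
      have b1 := norm_geo_le (by linarith) (by positivity) (low _ e1)
      have b2 := norm_geo_le (by linarith) (by positivity) (low _ e2)
      have b3 := norm_koebe_le (by linarith) (by positivity) (low _ e3)
      have b4 := norm_Es_bal ht hs' (min_le_right s t) ha hd
      have b5 : ‖geo (a * b) - geo (a * c)‖ ≤ 2 * (del t / 2)⁻¹ :=
        (norm_sub_le _ _).trans (by linarith)
      rw [norm_mul, norm_mul, norm_mul, norm_pow, norm_exp_epsfun t hb hc]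
      have e4 : (del t / 2)⁻¹ = 2 * √t := by unfold del; field_simp
      have e5 : (((del t / 2) ^ 2)⁻¹) = 4 * t := by
        rw [← inv_pow, e4, mul_pow, Real.sq_sqrt t0]; norm_num
      rw [e4] at b5
      rw [e5] at b3
      have b6 : Real.exp (60 * √(min s t)) ≤ Real.exp (60 * √s) := by
        gcongr
        exact min_le_left _ _
      calc _ ≤ 4 * t * (2 * (2 * √t)) ^ 2 * Real.exp (-(4 * γ) * t) * Real.exp (60 * √s) := by
            gcongr
            exact b4.trans b6
        _ = _ := by rw [mul_pow, mul_pow, Real.sq_sqrt t0]; ring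
    · intro a d b c ha hd hb hc ha' hd' hb' hc'
      refine key _ ?_ ?_ ?_ ha hd hb hc ha' hd' hb' hc'
      · exact mul_lt_one_of_nonneg_of_lt_one_left (by positivity) hr3 hr2.le
      · exact mul_lt_one_of_nonneg_of_lt_one_left (by positivity) hr3 hr.le
      · exact hprod
    · intro a d b c ha hd hb hc ha' hd' hb' hc'
      refine key _ ?_ ?_ ?_ ha hd hb hc ha' hd' hb' hc'
      · rw [mul_one]; exact hlt'
      · rw [mul_one]; exact hlt'
      · rw [mul_one, mul_one, habcd]; exact hρ1
  · refine .of_diffAt fun a d b c ha hd hb hc => ?_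
    have g1 := one_sub_mul_ne ha.le hb.le
      (mul_lt_one_of_nonneg_of_lt_one_left (by positivity) hr3 hr2.le)
    have g2 := one_sub_mul_ne ha.le hc.le
      (mul_lt_one_of_nonneg_of_lt_one_left (by positivity) hr3 hr.le)
    have g3 := one_sub_mul4_ne ha.le hb.le hc.le hd.le hprod
    have g4 := ne0 hp''.p3 hb
    have g5 := ne0 hp''.p4 hc
    unfold DiffAt
    fun_prop (disch := assumption)

lemma tendsto_errS14 (hγ : 0 < γ) {r : ℝ} (hr0 : 0 < r) (hr : r < 1) :
    Tendsto (fun t => errS14 γ r t / (√t : ℂ)) atTop (𝓝 0) := by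
  set I := ∫ s, Real.exp (60 * √s) ∂expo γ
  have h1 : Tendsto (fun t : ℝ => 64 * I * (t ^ (2 : ℝ) * Real.exp (-(4 * γ) * t))) atTop (𝓝 0) := by
    simpa using (tendsto_rpow_mul_exp_neg_mul_atTop_nhds_zero 2 (4 * γ) (by linarith)).const_mul
      (64 * I)
  refine squeeze_zero_norm' ?_ h1
  filter_upwards [eventually_ge_atTop 1] with t ht
  have h2 := norm_errS14_le hγ hr0 hr ht
  rw [norm_div, Complex.norm_real, Real.norm_of_nonneg (Real.sqrt_nonneg _)]
  refine (div_le_self (norm_nonneg _) (Real.one_le_sqrt.2 ht)).trans (h2.trans (le_of_eq ?_))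
  rw [Real.rpow_two]
  ring

end

/-! ### Reduction to integrals over the balanced tori -/

noncomputable section

variable {r1 r2 r3 r4 : ℝ} {γ t s κ : ℝ} {x v : ℂ}

instance : (volume : Measure ((Circle × Circle) × Circle × Circle)).IsHaarMeasure :=
  inferInstanceAs (((volume : Measure (Circle × Circle)).prod
    (volume : Measure (Circle × Circle))).IsHaarMeasure)

lemma M4_coord (r1 r2 r3 r4 : ℝ) (f : ℂ → ℂ → ℂ → ℂ → ℂ) :
    M4 r1 r2 r3 r4 f = ∫ p : (Circle × Circle) × Circle × Circle,
      f (r1 * (p.1.1 / p.2.1)) (r2 * p.2.1) (r3 * p.2.2) (r4 * (p.1.2 / (p.1.1 * p.2.2))) := by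
  let e : (Circle × Circle) × Circle × Circle ≃ₜ Circle × Circle × Circle × Circle :=
    { toFun := fun p => (p.1.1 / p.2.1, p.2.1, p.2.2, p.1.2 / (p.1.1 * p.2.2))
      invFun := fun q => ((q.1 * q.2.1, q.1 * q.2.1 * q.2.2.1 * q.2.2.2), q.2.1, q.2.2.1)
      left_inv := fun p => by simp
      right_inv := fun p => by simp
      continuous_toFun := by simp only [div_eq_mul_inv]; fun_prop
      continuous_invFun := by fun_prop }
  let h : (Circle × Circle) × Circle × Circle →* Circle × Circle × Circle × Circle :=
    { toFun := e, map_one' := by simp [e],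
      map_mul' := fun p q => by
        simp only [e, Homeomorph.homeomorph_mk_coe, Equiv.coe_fn_mk, Prod.fst_mul, Prod.snd_mul,
          Prod.mk_mul_mk, mul_mul_mul_comm p.1.1 q.1.1]
        simp only [mul_div_mul_comm] }
  have hm : MeasurePreserving e volume volume :=
    MonoidHom.measurePreserving (f := h) e.continuous e.surjective
      (by simp only [measure_univ])
  unfold M4
  rw [← hm.integral_comp e.measurableEmbedding]
  simp [e]

/-- The exponential `Es` in balanced coordinates. -/
def EE (κ : ℝ) (x v : ℂ) : ℂ := exp (κ * ((x⁻¹ - 1) * v + (1 - x) * v⁻¹))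

def psi (γ t : ℝ) (x : ℂ) : ℂ := ∫ p : ℝ × Circle, EE (tau t (min p.1 t)) x p.2 ∂(expo γ).prod volume

lemma Es_bal (hs : 0 < s) (hst : s ≤ t) (x v : ℂ) :
    Es t s (x / (bal t s * v)) (bal t s * v) = EE (tau t s) x v := by
  have h1 := mul_bal hs hst
  have h2 := div_bal hs hst
  have h3 := bal_ge_one hs hst
  have hb : (bal t s : ℂ) ≠ 0 := by exact_mod_cast (by linarith : bal t s ≠ 0)
  have e1 : (s : ℂ) * bal t s = tau t s := by exact_mod_cast h1
  have e2 : (2 * t - s : ℂ) * (bal t s : ℂ)⁻¹ = tau t s := by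
    rw [← div_eq_mul_inv]; exact_mod_cast h2
  unfold Es EE
  congr 1
  simp only [div_eq_mul_inv, mul_inv, inv_inv]
  linear_combination (x⁻¹ - 1) * v * e1 + (1 - x) * v⁻¹ * e2

lemma Es_bal' (hs : 0 < s) (hst : s ≤ t) (y v : ℂ) :
    Es t s (v / bal t s) (y / (v / bal t s)) = EE (tau t s) y v := by
  have h1 := mul_bal hs hst
  have h2 := div_bal hs hst
  have h3 := bal_ge_one hs hst
  have hb : (bal t s : ℂ) ≠ 0 := by exact_mod_cast (by linarith : bal t s ≠ 0)
  have e1 : (s : ℂ) * bal t s = tau t s := by exact_mod_cast h1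
  have e2 : (2 * t - s : ℂ) * (bal t s : ℂ)⁻¹ = tau t s := by
    rw [← div_eq_mul_inv]; exact_mod_cast h2
  unfold Es EE
  congr 1
  simp only [div_eq_mul_inv, mul_inv, inv_inv]
  linear_combination (1 - y) * v⁻¹ * e1 + (y⁻¹ - 1) * v * e2

lemma norm_EE_le (ht : 1 ≤ t) (hκ : 0 ≤ κ) (hx : ‖x‖ = rho t) (hv : ‖v‖ = 1) :
    ‖EE κ x v‖ ≤ Real.exp (κ * (9 * del t)) := by
  have hr := rho_pos (t := t)
  unfold EE
  rw [norm_exp, re_ofReal_mul]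
  refine Real.exp_le_exp.2 (mul_le_mul_of_nonneg_left ?_ hκ)
  have e1 : ((x⁻¹ - 1) * v + (1 - x) * v⁻¹).re = ((x⁻¹ - starRingEnd ℂ x) * v).re := by
    have h1 : ((1 - x) * v⁻¹).re = ((1 - starRingEnd ℂ x) * v).re := by
      rw [Complex.inv_eq_conj hv, ← Complex.conj_re]
      simp
    rw [add_re, h1, ← add_re]
    congr 1
    ring
  have e2 : x⁻¹ - starRingEnd ℂ x = ((Real.exp (del t) ^ 2 - 1 : ℝ) : ℂ) * starRingEnd ℂ x := by
    rw [Complex.inv_def, Complex.normSq_eq_norm_sq, hx, rho, Real.exp_neg]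
    push_cast
    field_simp
  rw [e1, e2]
  refine (Complex.re_le_norm _).trans ?_
  rw [norm_mul, hv, mul_one, norm_mul, Complex.norm_real, RCLike.norm_conj, hx, Real.norm_of_nonneg]
  · have := exp_sub_exp_neg_le (del_pos ht).le (by linarith [del_le_one ht])
    refine le_trans (le_of_eq ?_) this
    rw [rho, Real.exp_neg]
    field_simp
  · have := Real.one_le_exp (del_pos ht).le
    nlinarith

lemma norm_EE_tau_le (ht : 1 ≤ t) (hs : 0 ≤ s) (hx : ‖x‖ = rho t) (hv : ‖v‖ = 1) :
    ‖EE (tau t (min s t)) x v‖ ≤ Real.exp (18 * √s) := by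
  refine (norm_EE_le ht (Real.sqrt_nonneg _) hx hv).trans (Real.exp_le_exp.2 ?_)
  have h1 := tau_le (min_le_right s t) (le_min hs (by linarith))
  have h2 : √(min s t) ≤ √s := Real.sqrt_le_sqrt (min_le_left _ _)
  have h3 := sqrt_mul_del ht
  have h4 := del_pos ht
  calc _ ≤ (2 * √t * √s) * (9 * del t) := by gcongr; exact h1.trans (by gcongr)
    _ = 18 * √s * (√t * del t) := by ring
    _ = _ := by rw [h3, mul_one]

lemma continuous_tau (t : ℝ) : Continuous fun s => tau t (min s t) := by
  unfold tau; fun_prop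

lemma continuous_EE {X : Type*} [TopologicalSpace X] {κ : X → ℝ} {x v : X → ℂ} (hκ : Continuous κ)
    (hx : Continuous x) (hv : Continuous v) (hx0 : ∀ p, x p ≠ 0) (hv0 : ∀ p, v p ≠ 0) :
    Continuous fun p => EE (κ p) (x p) (v p) := by
  unfold EE; fun_prop (disch := assumption)

lemma integrable_prod_exp_sqrt (hγ : 0 < γ) (C : ℝ) :
    Integrable (fun p : ℝ × Circle => Real.exp (C * √p.1)) ((expo γ).prod volume) := by
  have := isProbabilityMeasure_expo hγ
  exact (integrable_exp_sqrt hγ C).comp_fst volume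

lemma ae_prod_pos (γ : ℝ) : ∀ᵐ p : ℝ × Circle ∂(expo γ).prod volume, 0 < p.1 :=
  (Measure.quasiMeasurePreserving_fst (μ := expo γ) (ν := (volume : Measure Circle))).ae
    (expo_ae_pos γ)

lemma integrable_EE (hγ : 0 < γ) (ht : 1 ≤ t) (hx : ‖x‖ = rho t) :
    Integrable (fun p : ℝ × Circle => EE (tau t (min p.1 t)) x p.2) ((expo γ).prod volume) := by
  have hx0 : x ≠ 0 := norm_pos_iff.1 (hx ▸ rho_pos)
  have := isProbabilityMeasure_expo hγ
  refine (integrable_prod_exp_sqrt hγ 18).mono' (continuous_EE ((continuous_tau t).comp continuous_fst)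
    continuous_const (by fun_prop) (fun _ => hx0) fun p => p.2.coe_ne_zero).aestronglyMeasurable ?_
  filter_upwards [ae_prod_pos γ] with p hp
  exact norm_EE_tau_le ht hp.le hx (Circle.norm_coe _)

lemma norm_psi_le (hγ : 0 < γ) (ht : 1 ≤ t) (hx : ‖x‖ = rho t) :
    ‖psi γ t x‖ ≤ ∫ s, Real.exp (18 * √s) ∂expo γ := by
  have := isProbabilityMeasure_expo hγ
  have e : ∫ s, Real.exp (18 * √s) ∂expo γ =
      ∫ p : ℝ × Circle, Real.exp (18 * √p.1) ∂(expo γ).prod volume := by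
    rw [integral_fun_fst (fun s => Real.exp (18 * √s))]; simp
  rw [e]
  refine norm_integral_le_of_norm_le (integrable_prod_exp_sqrt hγ 18) ?_
  filter_upwards [ae_prod_pos γ] with p hp
  exact norm_EE_tau_le ht hp.le hx (Circle.norm_coe _)

lemma continuous_psi (hγ : 0 < γ) (ht : 1 ≤ t) {X : Type*} [TopologicalSpace X]
    [FirstCountableTopology X] {x : X → ℂ} (hx : Continuous x) (hn : ∀ p, ‖x p‖ = rho t) :
    Continuous fun p => psi γ t (x p) := by
  have := isProbabilityMeasure_expo hγ
  have hx0 : ∀ p, x p ≠ 0 := fun p => norm_pos_iff.1 (hn p ▸ rho_pos)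
  unfold psi
  refine continuous_of_dominated (bound := fun p => Real.exp (18 * √p.1))
    (fun q => (integrable_EE hγ ht (hn q)).aestronglyMeasurable) (fun q => ?_)
    (integrable_prod_exp_sqrt hγ 18) (ae_of_all _ fun p => continuous_EE continuous_const hx
      continuous_const hx0 fun _ => p.2.coe_ne_zero)
  filter_upwards [ae_prod_pos γ] with p hp
  exact norm_EE_tau_le ht hp.le (hn q) (Circle.norm_coe _)

end

/-! ### Exact formulas on the balanced tori -/

noncomputable section

variable {r r1 r2 r3 r4 : ℝ} {γ t s κ : ℝ} {x v : ℂ} {k : ℂ → ℂ → ℂ → ℂ → ℂ}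

/-- The law of the pair (exponential time, uniform phase). -/
def nu (γ : ℝ) : Measure (ℝ × Circle) := (expo γ).prod volume

lemma isProbabilityMeasure_nu (hγ : 0 < γ) : IsProbabilityMeasure (nu γ) := by
  have := isProbabilityMeasure_expo hγ
  unfold nu; infer_instance

lemma measurePreserving_prodProdProdComm {A B C D : Type*} [MeasurableSpace A] [MeasurableSpace B]
    [MeasurableSpace C] [MeasurableSpace D] (a : Measure A) (b : Measure B) (c : Measure C)
    (d : Measure D) [SFinite a] [SFinite b] [SFinite c] [SFinite d] :
    MeasurePreserving (fun p : (A × B) × C × D => ((p.1.1, p.2.1), p.1.2, p.2.2))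
      ((a.prod b).prod (c.prod d)) ((a.prod c).prod (b.prod d)) := by
  have e1 := measurePreserving_prodAssoc a b (c.prod d)
  have e2 := (MeasurePreserving.id a).prod (measurePreserving_prodAssoc b c d).symm
  have e3 := (MeasurePreserving.id a).prod
    ((Measure.measurePreserving_swap (μ := b) (ν := c)).prod (MeasurePreserving.id d))
  have e4 := (MeasurePreserving.id a).prod (measurePreserving_prodAssoc c b d)
  have e5 := (measurePreserving_prodAssoc a c (b.prod d)).symm
  exact e5.comp (e4.comp (e3.comp (e2.comp e1)))

lemma integral_rearrange (hγ : 0 < γ) {G : (Circle × Circle) × (ℝ × Circle) × ℝ × Circle → ℂ}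
    (hG : Integrable G (volume.prod ((nu γ).prod (nu γ)))) :
    ∫ σ : ℝ × ℝ, (∫ p : (Circle × Circle) × Circle × Circle,
      G (p.1, (σ.1, p.2.1), (σ.2, p.2.2))) ∂(expo γ).prod (expo γ) =
    ∫ q, G q ∂(volume.prod ((nu γ).prod (nu γ))) := by
  have := isProbabilityMeasure_expo hγ
  have e1 := (measurePreserving_prodAssoc ((expo γ).prod (expo γ))
    (volume : Measure (Circle × Circle)) (volume : Measure (Circle × Circle))).symm
  have e2 := (Measure.measurePreserving_swap (μ := (expo γ).prod (expo γ))
    (ν := (volume : Measure (Circle × Circle)))).prod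
      (MeasurePreserving.id (volume : Measure (Circle × Circle)))
  have e3 := measurePreserving_prodAssoc (volume : Measure (Circle × Circle))
    ((expo γ).prod (expo γ)) (volume : Measure (Circle × Circle))
  have e4 := (MeasurePreserving.id (volume : Measure (Circle × Circle))).prod
    (measurePreserving_prodProdProdComm (expo γ) (expo γ) (volume : Measure Circle)
      (volume : Measure Circle))
  have e := e4.comp (e3.comp (e2.comp e1))
  have hG' : Integrable G (volume.prod (((expo γ).prod volume).prod ((expo γ).prod volume))) := hG
  have h2 := (e.integrable_comp hG'.aestronglyMeasurable).2 hG'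
  have h1 := integral_prod _ h2
  refine Eq.trans h1.symm ?_
  change _ = ∫ q, G q ∂(volume.prod (((expo γ).prod volume).prod ((expo γ).prod volume)))
  rw [← e.map_eq, integral_map e.measurable.aemeasurable]
  · rfl
  · rw [e.map_eq]; exact hG'.aestronglyMeasurable

/-- The integrand in balanced coordinates `x = ab`, `u = abcd`, with radii `β₁` for `b` and `1/β₂`
for `c`. -/
def balF (t : ℝ) (k : ℂ → ℂ → ℂ → ℂ → ℂ) (β1 β2 s1 s2 : ℝ) (x u v1 v2 : ℂ) : ℂ :=
  k (x / (β1 * v1)) (β1 * v1) (v2 / β2) (u / x / (v2 / β2)) *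
    Es t (min s1 t) (x / (β1 * v1)) (β1 * v1) * Es t (min s2 t) (v2 / β2) (u / x / (v2 / β2))

lemma M4_eq_balF (t : ℝ) (k : ℂ → ℂ → ℂ → ℂ → ℂ) {β1 β2 : ℝ} (h1 : β1 ≠ 0) (s1 s2 : ℝ) :
    M4 (rho t / β1) β1 β2⁻¹ (rho t * β2) (fun a b c d => k a b c d * Es t (min s1 t) a b *
      Es t (min s2 t) c d) = ∫ p : (Circle × Circle) × Circle × Circle,
        balF t k β1 β2 s1 s2 (rho t * p.1.1) (rho t ^ 2 * p.1.2) p.2.1 p.2.2 := by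
  rw [M4_coord]
  congr 1
  funext p
  have hr : (rho t : ℂ) ≠ 0 := by exact_mod_cast rho_pos.ne'
  have hx := p.1.1.coe_ne_zero
  have hv := p.2.1.coe_ne_zero
  have hv' := p.2.2.coe_ne_zero
  have hb : (β1 : ℂ) ≠ 0 := by exact_mod_cast h1
  have e1 : ((rho t / β1 : ℝ) : ℂ) * (p.1.1 / p.2.1) = rho t * p.1.1 / (β1 * p.2.1) := by
    push_cast; field_simp
  have e2 : ((β2⁻¹ : ℝ) : ℂ) * p.2.2 = p.2.2 / β2 := by push_cast; field_simp
  have e3 : ((rho t * β2 : ℝ) : ℂ) * (p.1.2 / (p.1.1 * p.2.2)) =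
      rho t ^ 2 * p.1.2 / (rho t * p.1.1) / (p.2.2 / β2) := by push_cast; field_simp
  rw [e1, e2, e3, balF]

/-- The part of the kernel that depends on `ab` and `abcd` only. -/
def kmain (a b c d : ℂ) : ℂ :=
  koebe (a * b * c * d) * (geo (a * b) * geo (c * d) + geo (a * b) ^ 2)

def kZ (a b c d : ℂ) : ℂ :=
  koebe (a * b * c * d) * (2 * geo (a * c) ^ 2 - 4 * geo (a * b) * geo (a * c))

def krest (γ : ℝ) (a b c d : ℂ) : ℂ := kZ a b c d + 4 * γ * ksing a b c d

lemma continuous_circle_koebe {X : Type*} [TopologicalSpace X] {f : X → ℂ} (hf : Continuous f)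
    (h : ∀ p, ‖f p‖ < 1) : Continuous fun p => koebe (f p) := by
  unfold koebe
  have h0 : ∀ p, (1 - f p) ^ 2 ≠ 0 := fun p => pow_ne_zero 2 (one_sub_ne (h p))
  fun_prop (disch := assumption)

lemma continuous_circle_geo {X : Type*} [TopologicalSpace X] {f : X → ℂ} (hf : Continuous f)
    (h : ∀ p, ‖f p‖ < 1) : Continuous fun p => geo (f p) := by
  unfold geo
  have h0 : ∀ p, 1 - f p ≠ 0 := fun p => one_sub_ne (h p)
  fun_prop (disch := assumption)

def mainKernel (x u : ℂ) : ℂ := koebe u * (geo x * geo (u / x) + geo x ^ 2)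

lemma norm_u_div (a b : Circle) : ‖(rho t ^ 2 * b / (rho t * a) : ℂ)‖ = rho t := by
  have hr := rho_pos (t := t)
  rw [norm_div, norm_mul, norm_mul, norm_pow, Complex.norm_real, Circle.norm_coe, Circle.norm_coe,
    Real.norm_of_nonneg hr.le]
  field_simp

lemma norm_rho_mul (a : Circle) : ‖(rho t * a : ℂ)‖ = rho t := norm_mul_circle rho_pos.le a

lemma norm_rho_sq_mul (a : Circle) : ‖(rho t ^ 2 * a : ℂ)‖ = rho t ^ 2 := by
  have := norm_mul_circle (sq_nonneg (rho t)) a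
  push_cast at this
  exact this

lemma rho_sq_lt_one (ht : 1 ≤ t) : rho t ^ 2 < 1 :=
  pow_lt_one₀ rho_pos.le (rho_lt_one ht) two_ne_zero

lemma continuous_mainKernel (ht : 1 ≤ t) : Continuous fun p : Circle × Circle =>
    mainKernel (rho t * p.1) (rho t ^ 2 * p.2) := by
  have hr := rho_lt_one ht
  have h1 : ∀ p : Circle × Circle, ‖(rho t * p.1 : ℂ)‖ < 1 := fun p => by rwa [norm_rho_mul]
  have h2 : ∀ p : Circle × Circle, ‖(rho t ^ 2 * p.2 : ℂ)‖ < 1 := fun p => by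
    rw [norm_rho_sq_mul]; exact rho_sq_lt_one ht
  have h3 : ∀ p : Circle × Circle, ‖(rho t ^ 2 * p.2 / (rho t * p.1) : ℂ)‖ < 1 := fun p => by
    rwa [norm_u_div]
  have h0 : ∀ p : Circle × Circle, (rho t * p.1 : ℂ) ≠ 0 := fun p =>
    mul_ne_zero (by exact_mod_cast rho_pos.ne') p.1.coe_ne_zero
  unfold mainKernel
  refine (continuous_circle_koebe (by fun_prop) h2).mul (.add (.mul ?_ ?_) (.pow ?_ 2))
  · exact continuous_circle_geo (by fun_prop) h1
  · exact continuous_circle_geo (by fun_prop (disch := assumption)) h3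
  · exact continuous_circle_geo (by fun_prop) h1

lemma M4_kmain (hγ : 0 < γ) (ht : 1 ≤ t) (hr0 : 0 < r) (hr1 : r < 1) :
    M4 (r ^ 3) (r ^ 2) r 1 (fun a b c d => kmain a b c d * Ehat γ t a b * Ehat γ t c d) =
      ∫ p : Circle × Circle, mainKernel (rho t * p.1) (rho t ^ 2 * p.2) *
        (psi γ t (rho t * p.1) * psi γ t (rho t ^ 2 * p.2 / (rho t * p.1))) := by
  have := isProbabilityMeasure_expo hγ
  have := isProbabilityMeasure_nu hγ
  have hp : Pos4 (r ^ 3) (r ^ 2) r 1 := ⟨by positivity, by positivity, hr0, one_pos⟩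
  have hρ := rho_pos (t := t)
  have hρ1 := rho_lt_one ht
  have hr3 : r ^ 3 < 1 := pow_lt_one₀ hr0.le hr1 (by norm_num)
  have hr2 : r ^ 2 < 1 := pow_lt_one₀ hr0.le hr1 (by norm_num)
  have hd : ∀ {q1 q2 q3 q4 : ℝ}, Pos4 q1 q2 q3 q4 → q1 * q2 < 1 → q3 * q4 < 1 → ∀ a b c d : ℂ,
      ‖a‖ ≤ q1 → ‖b‖ ≤ q2 → ‖c‖ ≤ q3 → ‖d‖ ≤ q4 → DiffAt kmain a b c d := by
    intro q1 q2 q3 q4 hq h12 h34 a b c d h1 h2 h3 h4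
    have g1 := one_sub_mul_ne h1 h2 h12
    have g2 := one_sub_mul_ne h3 h4 h34
    have g3 := one_sub_mul4_ne h1 h2 h3 h4 (by
      have := hq.p1; have := hq.p2; have := hq.p3; have := hq.p4
      rw [mul_assoc (q1 * q2)]
      exact mul_lt_one_of_nonneg_of_lt_one_left (by positivity) h12 h34.le)
    unfold DiffAt kmain
    fun_prop (disch := assumption)
  have h12 : r ^ 3 * r ^ 2 < 1 := mul_lt_one_of_nonneg_of_lt_one_left (by positivity) hr3 hr2.le
  have e1 := M4_Es_fubini hγ (by linarith : 0 ≤ t) hp (k := kmain) (.of_diffAt fun a b c d h1 h2 h3 h4 =>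
    hd hp h12 (by linarith) a b c d h1.le h2.le h3.le h4.le)
  refine e1.trans ?_
  have hpos : ∀ᵐ σ ∂(expo γ).prod (expo γ), 0 < σ.1 ∧ 0 < σ.2 :=
    ((Measure.quasiMeasurePreserving_fst (μ := expo γ) (ν := expo γ)).ae (expo_ae_pos γ)).and
      ((Measure.quasiMeasurePreserving_snd (μ := expo γ) (ν := expo γ)).ae (expo_ae_pos γ))
  set G : (Circle × Circle) × (ℝ × Circle) × ℝ × Circle → ℂ := fun q =>
    mainKernel (rho t * q.1.1) (rho t ^ 2 * q.1.2) *
      (EE (tau t (min q.2.1.1 t)) (rho t * q.1.1) q.2.1.2 *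
        EE (tau t (min q.2.2.1 t)) (rho t ^ 2 * q.1.2 / (rho t * q.1.1)) q.2.2.2) with hGdef
  have hcase : ∀ σ : ℝ × ℝ, 0 < σ.1 ∧ 0 < σ.2 →
      M4 (r ^ 3) (r ^ 2) r 1 (fun a b c d => kmain a b c d * Es t (min σ.1 t) a b *
        Es t (min σ.2 t) c d) = ∫ p : (Circle × Circle) × Circle × Circle,
      G (p.1, (σ.1, p.2.1), (σ.2, p.2.2)) := by
    intro σ hσ
    have m1 : 0 < min σ.1 t := lt_min hσ.1 (by linarith)
    have m2 : 0 < min σ.2 t := lt_min hσ.2 (by linarith)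
    have b1 := bal_ge_one m1 (min_le_right _ _)
    have b2 := bal_ge_one m2 (min_le_right _ _)
    set B1 := bal t (min σ.1 t)
    set B2 := bal t (min σ.2 t)
    have hq : Pos4 (rho t / B1) B1 B2⁻¹ (rho t * B2) :=
      ⟨by positivity, by positivity, by positivity, by positivity⟩
    rw [M4_eq_of_shrink hp hq, M4_eq_balF t kmain (by positivity : B1 ≠ 0) σ.1 σ.2]
    · congr 1
      funext p
      have hρ' : (rho t : ℂ) ≠ 0 := by exact_mod_cast hρ.ne'
      have hx := p.1.1.coe_ne_zero
      have hv := p.2.1.coe_ne_zero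
      have hv' := p.2.2.coe_ne_zero
      have hb1 : (B1 : ℂ) ≠ 0 := by exact_mod_cast (by positivity : B1 ≠ 0)
      have hb2 : (B2 : ℂ) ≠ 0 := by exact_mod_cast (by positivity : B2 ≠ 0)
      simp only [hGdef]
      rw [balF, Es_bal m1 (min_le_right _ _), Es_bal' m2 (min_le_right _ _), kmain, mainKernel,
        mul_assoc]
      generalize (rho t : ℂ) ^ 2 * p.1.2 = u
      have i0 : (rho t * p.1.1 : ℂ) ≠ 0 := mul_ne_zero hρ' hx
      have i1 : (rho t * p.1.1 / (B1 * p.2.1) * (B1 * p.2.1) : ℂ) = rho t * p.1.1 := by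
        field_simp
      have i2 : (p.2.2 / B2 * (u / (rho t * p.1.1) / (p.2.2 / B2)) : ℂ) = u / (rho t * p.1.1) := by
        field_simp
      have i3 : (rho t * p.1.1 * (p.2.2 / B2) * (u / (rho t * p.1.1) / (p.2.2 / B2)) : ℂ) = u := by
        field_simp
      rw [i1, i2, i3]
    all_goals
      intro a b c d ha hb hc hd' h1 h2 h3 h4
    · have := hd hp h12 (by linarith) a b c d h1 h2 h3 h4
      unfold DiffAt at this ⊢
      fun_prop (disch := assumption)
    · have := hd hq (by field_simp; exact hρ1) (by field_simp; exact hρ1) a b c d h1 h2 h3 h4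
      unfold DiffAt at this ⊢
      fun_prop (disch := assumption)
  rw [integral_congr_ae (hpos.mono hcase)]
  have n1 : ∀ q : (Circle × Circle) × (ℝ × Circle) × ℝ × Circle, (rho t * q.1.1 : ℂ) ≠ 0 := fun q =>
    mul_ne_zero (by exact_mod_cast hρ.ne') q.1.1.coe_ne_zero
  have n2 : ∀ q : (Circle × Circle) × (ℝ × Circle) × ℝ × Circle,
      (rho t ^ 2 * q.1.2 / (rho t * q.1.1) : ℂ) ≠ 0 := fun q =>
    div_ne_zero (mul_ne_zero (by exact_mod_cast (pow_pos hρ 2).ne') q.1.2.coe_ne_zero) (n1 q)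
  have hGc : Continuous G := by
    refine .mul ((continuous_mainKernel ht).comp continuous_fst) (.mul ?_ ?_)
    · exact continuous_EE ((continuous_tau t).comp (by fun_prop)) (by fun_prop) (by fun_prop) n1
        fun q => q.2.1.2.coe_ne_zero
    · exact continuous_EE ((continuous_tau t).comp (by fun_prop)) (by fun_prop (disch := exact n1 _))
        (by fun_prop) n2 fun q => q.2.2.2.coe_ne_zero
  have hpos' : ∀ᵐ q ∂(volume : Measure (Circle × Circle)).prod ((nu γ).prod (nu γ)),
      0 < q.2.1.1 ∧ 0 < q.2.2.1 := by
    refine (Measure.quasiMeasurePreserving_snd (μ := (volume : Measure (Circle × Circle)))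
      (ν := (nu γ).prod (nu γ))).ae (p := fun q => 0 < q.1.1 ∧ 0 < q.2.1) ?_
    exact ((Measure.quasiMeasurePreserving_fst (μ := nu γ) (ν := nu γ)).ae (ae_prod_pos γ)).and
      ((Measure.quasiMeasurePreserving_snd (μ := nu γ) (ν := nu γ)).ae (ae_prod_pos γ))
  have hGi : Integrable G (volume.prod ((nu γ).prod (nu γ))) := by
    obtain ⟨C, hC⟩ := isCompact_univ.exists_bound_of_continuousOn
      (continuous_mainKernel ht).continuousOn
    have hi : Integrable (fun q : (ℝ × Circle) × ℝ × Circle =>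
        C * (Real.exp (18 * √q.1.1) * Real.exp (18 * √q.2.1))) ((nu γ).prod (nu γ)) :=
      ((integrable_prod_exp_sqrt hγ 18).mul_prod (integrable_prod_exp_sqrt hγ 18)).const_mul _
    refine (hi.comp_snd (volume : Measure (Circle × Circle))).mono' hGc.aestronglyMeasurable ?_
    filter_upwards [hpos'] with q hq
    have h1 := norm_EE_tau_le ht hq.1.le (norm_rho_mul q.1.1) (Circle.norm_coe q.2.1.2)
    have h2 := norm_EE_tau_le ht hq.2.le (norm_u_div (t := t) q.1.1 q.1.2) (Circle.norm_coe q.2.2.2)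
    have h3 := hC q.1 (mem_univ _)
    have := (norm_nonneg _).trans h3
    rw [hGdef]
    simp only [norm_mul] at h1 h2 h3 ⊢
    gcongr
  rw [integral_rearrange hγ hGi, integral_prod _ hGi]
  congr 1
  funext p
  rw [hGdef]
  simp only
  rw [integral_const_mul]
  congr 1
  exact integral_prod_mul (μ := nu γ) (ν := nu γ) (fun z : ℝ × Circle => EE (tau t (min z.1 t)) (rho t * p.1) z.2)
    (fun z : ℝ × Circle => EE (tau t (min z.1 t)) (rho t ^ 2 * p.2 / (rho t * p.1)) z.2)

end

/-! ### Exact formulas for the first and second moments -/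

noncomputable section

variable {r r1 r2 r3 r4 : ℝ} {γ t s κ : ℝ} {x v : ℂ} {k : ℂ → ℂ → ℂ → ℂ → ℂ}

lemma integral_rearrange' (hγ : 0 < γ) {G : Circle × ℝ × Circle → ℂ}
    (hG : Integrable G (volume.prod (nu γ))) :
    ∫ s : ℝ, (∫ p : (Circle × Circle) × Circle × Circle, G (p.1.1, (s, p.2.1))) ∂(expo γ) =
    ∫ q, G q ∂(volume.prod (nu γ)) := by
  have := isProbabilityMeasure_expo hγ
  have e0 : MeasurePreserving (fun p : (Circle × Circle) × Circle × Circle => (p.1.1, p.2.1))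
      (((volume : Measure Circle).prod (volume : Measure Circle)).prod
        ((volume : Measure Circle).prod (volume : Measure Circle)))
      ((volume : Measure Circle).prod (volume : Measure Circle)) :=
    measurePreserving_fst.prod measurePreserving_fst
  have e1 := (MeasurePreserving.id (expo γ)).prod e0
  have e2 := (measurePreserving_prodAssoc (expo γ) (volume : Measure Circle)
    (volume : Measure Circle)).symm
  have e3 := (Measure.measurePreserving_swap (μ := expo γ)
    (ν := (volume : Measure Circle))).prod (MeasurePreserving.id (volume : Measure Circle))
  have e4 := measurePreserving_prodAssoc (volume : Measure Circle) (expo γ) (volume : Measure Circle)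
  have e := e4.comp (e3.comp (e2.comp e1))
  have hG' : Integrable G (volume.prod ((expo γ).prod volume)) := hG
  have h2 := (e.integrable_comp hG'.aestronglyMeasurable).2 hG'
  have h1 := integral_prod _ h2
  refine Eq.trans h1.symm ?_
  change _ = ∫ q, G q ∂(volume.prod ((expo γ).prod volume))
  rw [← e.map_eq, integral_map e.measurable.aemeasurable]
  · rfl
  · rw [e.map_eq]; exact hG'.aestronglyMeasurable

lemma M4_single (r1 r2 : ℝ) {f : ℂ → ℂ → ℂ} (hr : Pos4 r1 r2 1 1)
    (hf : ContT r1 r2 1 1 fun a b _ _ => f a b) :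
    cint r1 (fun a => cint r2 fun b => f a b) = M4 r1 r2 1 1 fun a b _ _ => f a b := by
  rw [← cint4_eq hr hf]
  simp [cint_eq (1 : ℝ) one_ne_zero]

theorem q1_eq (hγ : 0 < γ) (ht : 1 ≤ t) (hr0 : 0 < r) (hr : r < 1 / (4 * γ + 4)) :
    q1 γ r t = ∫ a : Circle, koebe (rho t * a) * psi γ t (rho t * a) := by
  have := isProbabilityMeasure_expo hγ
  have := isProbabilityMeasure_nu hγ
  have hr1 : r < 1 := hr.trans (by rw [div_lt_one (by positivity)]; linarith)
  have hp : Pos4 r 1 1 1 := ⟨hr0, one_pos, one_pos, one_pos⟩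
  have hρ := rho_pos (t := t)
  have hρ1 := rho_lt_one ht
  have gap : ∀ a b : ℂ, 0 < ‖a‖ → ‖a‖ ≤ r → ‖b‖ = 1 → cfun a - cfun b - 2 * γ ≠ 0 :=
    fun a b h1 h2 h3 => (cfun_sub_ne hγ hr0 hr h1 (by rw [h3]; linarith) h3.le).1
  have hd : ∀ {q1 q2 : ℝ}, q1 * q2 < 1 → ∀ a b c d : ℂ,
      ‖a‖ ≤ q1 → ‖b‖ ≤ q2 → DiffAt (fun a b _ _ => koebe (a * b)) a b c d := by
    intro q1 q2 h12 a b c d h1 h2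
    have g1 := one_sub_mul_ne h1 h2 h12
    unfold DiffAt
    fun_prop (disch := assumption)
  have hne : ∀ {z : ℂ} {s : ℝ}, 0 < s → ‖z‖ = s → z ≠ 0 := fun h1 h2 => norm_pos_iff.1 (h2 ▸ h1)
  have hdr : ∀ a b c d : ℂ, ‖a‖ ≤ r → ‖b‖ = 1 → DiffAt (fun a b _ _ => koebe (a * b)) a b c d :=
    fun a b c d h1 h2 => hd (by linarith : r * 1 < 1) a b c d h1 h2.le
  have e0 : q1 γ r t = M4 r 1 1 1 (fun a b _ _ => koebe (a * b) *
      (exp (t * (epsfun γ a + epsfun γ b)) * Sfun γ a b)) := by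
    unfold q1
    rw [M4_single r 1 hp]
    · refine M4_congr hp fun a b c d h1 h2 h3 h4 => ?_
      unfold koebe Sfun
      ring
    · refine .of_diffAt fun a b c d h1 h2 h3 h4 => ?_
      have g1 := hne hr0 h1
      have g2 := hne one_pos h2
      have g3 := gap a b (h1 ▸ hr0) h1.le h2
      have g4 : (1 - a * b) ^ 2 ≠ 0 :=
        pow_ne_zero 2 (one_sub_mul_ne h1.le h2.le (by linarith : r * 1 < 1))
      unfold DiffAt
      fun_prop (disch := assumption)
  rw [e0, M4_avg hγ (by linarith) hp (fun a b c d h1 h2 _ _ => hdr a b c d h1 h2) gap,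
    M4_Ehat_fubini hγ (by linarith) hp (.of_diffAt fun a b c d h1 h2 _ _ => hdr a b c d h1.le h2)]
  set G : Circle × ℝ × Circle → ℂ := fun q =>
    koebe (rho t * q.1) * EE (tau t (min q.2.1 t)) (rho t * q.1) q.2.2 with hGdef
  have hcase : ∀ s : ℝ, 0 < s →
      M4 r 1 1 1 (fun a b c d => koebe (a * b) * Es t (min s t) a b) =
        ∫ p : (Circle × Circle) × Circle × Circle, G (p.1.1, (s, p.2.1)) := by
    intro s hs
    have m1 : 0 < min s t := lt_min hs (by linarith)
    have b1 := bal_ge_one m1 (min_le_right _ _)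
    set B1 := bal t (min s t)
    have hq : Pos4 (rho t / B1) B1 1 1 := ⟨by positivity, by positivity, one_pos, one_pos⟩
    rw [M4_eq_of_shrink hp hq, M4_coord]
    · congr 1
      funext p
      have hv := p.2.1.coe_ne_zero
      have hb1 : (B1 : ℂ) ≠ 0 := by exact_mod_cast (by positivity : B1 ≠ 0)
      simp only [hGdef]
      have e1 : ((rho t / B1 : ℝ) : ℂ) * (p.1.1 / p.2.1) = rho t * p.1.1 / (B1 * p.2.1) := by
        push_cast; field_simp
      have i1 : (rho t * p.1.1 / (B1 * p.2.1) * (B1 * p.2.1) : ℂ) = rho t * p.1.1 := by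
        field_simp
      rw [e1, Es_bal m1 (min_le_right _ _), i1]
    all_goals
      intro a b c d ha hb hc hd' h1 h2 h3 h4
    · have := hd (by linarith : r * 1 < 1) a b c d h1 h2
      unfold DiffAt at this ⊢
      fun_prop (disch := assumption)
    · have := hd (by field_simp; exact hρ1) a b c d h1 h2
      unfold DiffAt at this ⊢
      fun_prop (disch := assumption)
  rw [integral_congr_ae ((expo_ae_pos γ).mono hcase)]
  have n1 : ∀ a : Circle, (rho t * a : ℂ) ≠ 0 := fun a =>
    mul_ne_zero (by exact_mod_cast hρ.ne') a.coe_ne_zero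
  have hkc : Continuous fun a : Circle => koebe (rho t * a) :=
    continuous_circle_koebe (by fun_prop) fun a => by rwa [norm_rho_mul]
  have hGc : Continuous G := (hkc.comp continuous_fst).mul <|
    continuous_EE ((continuous_tau t).comp (by fun_prop)) (by fun_prop) (by fun_prop)
      (fun q => n1 q.1) fun q => q.2.2.coe_ne_zero
  have hGi : Integrable G (volume.prod (nu γ)) := by
    obtain ⟨C, hC⟩ := isCompact_univ.exists_bound_of_continuousOn hkc.continuousOn
    have hi : Integrable (fun q : ℝ × Circle => C * Real.exp (18 * √q.1)) (nu γ) :=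
      (integrable_prod_exp_sqrt hγ 18).const_mul _
    refine (hi.comp_snd (volume : Measure Circle)).mono' hGc.aestronglyMeasurable ?_
    filter_upwards [(Measure.quasiMeasurePreserving_snd (μ := (volume : Measure Circle))
      (ν := nu γ)).ae (ae_prod_pos γ)] with q hq
    have h1 := norm_EE_tau_le ht hq.le (norm_rho_mul q.1) (Circle.norm_coe q.2.2)
    have h3 := hC q.1 (mem_univ _)
    have := (norm_nonneg _).trans h3
    rw [hGdef]
    simp only [norm_mul] at h1 h3 ⊢
    gcongr
  rw [integral_rearrange' hγ hGi, integral_prod _ hGi]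
  congr 1
  funext p
  simp only [hGdef]
  rw [integral_const_mul]
  rfl

/-- The radius of `b`. -/
def beta1 (t s : ℝ) : ℝ := if s < t then bal t s else Real.exp (-(del t / 2))

/-- The inverse of the radius of `c`. -/
def beta2 (t s : ℝ) : ℝ := if s < t then bal t s else Real.exp (-(del t / 4))

lemma beta1_ge (ht : 1 ≤ t) (hs : 0 < s) : Real.exp (-(del t / 2)) ≤ beta1 t s := by
  unfold beta1
  split_ifs with h
  · exact (Real.exp_le_one_iff.2 (by linarith [del_pos ht])).trans (bal_ge_one hs h.le)
  · exact le_rfl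

lemma beta2_ge (ht : 1 ≤ t) (hs : 0 < s) : Real.exp (-(del t / 4)) ≤ beta2 t s := by
  unfold beta2
  split_ifs with h
  · exact (Real.exp_le_one_iff.2 (by linarith [del_pos ht])).trans (bal_ge_one hs h.le)
  · exact le_rfl

lemma bal_inj {s' : ℝ} (hs : 0 < s) (hs' : 0 < s') (hst : s ≤ t) (hst' : s' ≤ t)
    (h : bal t s = bal t s') : s = s' := by
  unfold bal at h
  rw [Real.sqrt_inj (div_nonneg (by linarith) hs.le) (div_nonneg (by linarith) hs'.le),
    div_eq_div_iff hs.ne' hs'.ne'] at h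
  nlinarith

lemma beta1_ne_beta2 {s' : ℝ} (ht : 1 ≤ t) (hs : 0 < s) (hs' : 0 < s') (h : s ≠ s') :
    beta1 t s ≠ beta2 t s' := by
  have hδ := del_pos ht
  unfold beta1 beta2
  split_ifs with h1 h2 h2
  · exact fun h0 => h (bal_inj hs hs' h1.le h2.le h0)
  · have := bal_ge_one hs h1.le
    have h3 : Real.exp (-(del t / 4)) < 1 := by
      rw [← Real.exp_zero]; exact Real.exp_lt_exp.2 (by linarith)
    linarith
  · have := bal_ge_one hs' h2.le
    have h3 : Real.exp (-(del t / 2)) < 1 := by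
      rw [← Real.exp_zero]; exact Real.exp_lt_exp.2 (by linarith)
    linarith
  · rw [Ne, Real.exp_eq_exp]
    linarith

lemma rho_lt_beta_mul {s' : ℝ} (ht : 1 ≤ t) (hs : 0 < s) (hs' : 0 < s') :
    rho t / (beta1 t s * beta2 t s') ≤ Real.exp (-(del t / 4)) := by
  have h1 := beta1_ge ht hs
  have h2 := beta2_ge ht hs'
  have p1 := Real.exp_pos (-(del t / 2))
  have p2 := Real.exp_pos (-(del t / 4))
  have p3 := p1.trans_le h1
  rw [div_le_iff₀ (mul_pos (by linarith) (by linarith)), rho]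
  calc Real.exp (-del t) = Real.exp (-(del t / 4)) * (Real.exp (-(del t / 2)) *
        Real.exp (-(del t / 4))) := by rw [← Real.exp_add, ← Real.exp_add]; congr 1; ring
    _ ≤ _ := by gcongr

lemma goodRadii_beta {s' : ℝ} (ht : 1 ≤ t) (hs : 0 < s) (hs' : 0 < s') :
    GoodRadii (rho t / beta1 t s) (beta1 t s) (beta2 t s')⁻¹ (rho t * beta2 t s') := by
  have h1 := (Real.exp_pos _).trans_le (beta1_ge ht hs)
  have h2 := (Real.exp_pos _).trans_le (beta2_ge ht hs')
  have hρ := rho_pos (t := t)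
  have hρ1 := rho_lt_one ht
  refine ⟨⟨by positivity, h1, by positivity, by positivity⟩, ?_, ?_, ?_⟩
  · rwa [div_mul_cancel₀ _ h1.ne']
  · have := rho_lt_beta_mul ht hs hs'
    rw [← div_eq_mul_inv, div_div]
    refine this.trans_lt ?_
    rw [← Real.exp_zero]
    exact Real.exp_lt_exp.2 (by linarith [del_pos ht])
  · have := rho_sq_lt_one ht
    field_simp
    exact this

lemma GoodRadii.diffAt_kZ (hr : GoodRadii r1 r2 r3 r4) {s1 s2 : ℝ} {a b c d : ℂ} (ha : a ≠ 0)
    (hb : b ≠ 0)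
    (hc : c ≠ 0) (hd : d ≠ 0) (h1 : ‖a‖ ≤ r1) (h2 : ‖b‖ ≤ r2) (h3 : ‖c‖ ≤ r3) (h4 : ‖d‖ ≤ r4) :
    DiffAt (fun a b c d => kZ a b c d * Es t s1 a b * Es t s2 c d) a b c d := by
  have g1 := one_sub_mul_ne h1 h2 hr.ab
  have g2 := one_sub_mul_ne h1 h3 hr.ac
  have g3 := one_sub_mul4_ne h1 h2 h3 h4 hr.abcd
  unfold DiffAt kZ
  fun_prop (disch := assumption)

lemma M4_krest_split (hr : GoodRadii r1 r2 r3 r4) (h : r2 * r3 ≠ 1) (s1 s2 : ℝ) :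
    M4 r1 r2 r3 r4 (fun a b c d => krest γ a b c d * Es t s1 a b * Es t s2 c d) =
      M4 r1 r2 r3 r4 (fun a b c d => kZ a b c d * Es t s1 a b * Es t s2 c d) +
      4 * γ * M4 r1 r2 r3 r4 (fun a b c d => ksing a b c d * Es t s1 a b * Es t s2 c d) := by
  have hne : ∀ {z : ℂ} {s : ℝ}, 0 < s → ‖z‖ = s → z ≠ 0 := fun h1 h2 => norm_pos_iff.1 (h2 ▸ h1)
  rw [← M4_const_mul, ← M4_add hr.pos]
  · refine M4_congr hr.pos fun a b c d _ _ _ _ => ?_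
    unfold krest
    ring
  · exact .of_diffAt fun a b c d h1 h2 h3 h4 => hr.diffAt_kZ (hne hr.pos.p1 h1) (hne hr.pos.p2 h2)
      (hne hr.pos.p3 h3) (hne hr.pos.p4 h4) h1.le h2.le h3.le h4.le
  · refine .of_diffAt fun a b c d h1 h2 h3 h4 => ?_
    have h0 : 1 - b * c ≠ 0 := by
      intro h0
      apply h
      rw [← h2, ← h3, ← norm_mul, ← sub_eq_zero.1 h0, norm_one]
    have := hr.diffAt (t := t) (s1 := s1) (s2 := s2) (hne hr.pos.p1 h1) (hne hr.pos.p2 h2)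
      (hne hr.pos.p3 h3) (hne hr.pos.p4 h4) h1.le h2.le h3.le h4.le h0
    unfold DiffAt at this ⊢
    fun_prop

lemma M4_krest_eq (hr : GoodRadii r1 r2 r3 r4) {R1 R2 R3 R4 : ℝ} (hR : GoodRadii R1 R2 R3 R4)
    (h : r2 * r3 ≠ 1) (H : R2 * R3 ≠ 1) (s1 s2 : ℝ) :
    M4 r1 r2 r3 r4 (fun a b c d => krest γ a b c d * Es t s1 a b * Es t s2 c d) =
      M4 R1 R2 R3 R4 (fun a b c d => krest γ a b c d * Es t s1 a b * Es t s2 c d) := by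
  rw [M4_krest_split hr h, M4_krest_split hR H, M4_ksing_eq hr hR h H, M4_eq_of_shrink hr.pos hR.pos]
  · intro a b c d ha hb hc hd h1 h2 h3 h4
    exact hr.diffAt_kZ ha hb hc hd h1 h2 h3 h4
  · intro a b c d ha hb hc hd h1 h2 h3 h4
    exact hR.diffAt_kZ ha hb hc hd h1 h2 h3 h4

lemma ae_expo_prod (hγ : 0 < γ) : ∀ᵐ σ ∂(expo γ).prod (expo γ), (0 < σ.1 ∧ 0 < σ.2) ∧ σ.1 ≠ σ.2 := by
  have := isProbabilityMeasure_expo hγ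
  refine (((Measure.quasiMeasurePreserving_fst (μ := expo γ) (ν := expo γ)).ae (expo_ae_pos γ)).and
      ((Measure.quasiMeasurePreserving_snd (μ := expo γ) (ν := expo γ)).ae (expo_ae_pos γ))).and ?_
  have hm : MeasurableSet {σ : ℝ × ℝ | σ.1 ≠ σ.2} :=
    (measurableSet_eq_fun measurable_fst measurable_snd).compl
  rw [Measure.ae_prod_iff_ae_ae hm]
  refine ae_of_all _ fun s => ?_
  have : ∀ᵐ y ∂expo γ, y ≠ s := by
    have : expo γ {s} = 0 := by
      unfold expo
      refine withDensity_absolutelyContinuous _ _ ?_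
      rw [← nonpos_iff_eq_zero]
      exact (Measure.restrict_apply_le _ _).trans_eq Real.volume_singleton
    rw [ae_iff]; simpa using this
  filter_upwards [this] with y hy
  exact fun h => hy h.symm

def restG (γ t : ℝ) (q : (Circle × Circle) × (ℝ × Circle) × ℝ × Circle) : ℂ :=
  balF t (krest γ) (beta1 t q.2.1.1) (beta2 t q.2.2.1) q.2.1.1 q.2.2.1
    (rho t * q.1.1) (rho t ^ 2 * q.1.2) q.2.1.2 q.2.2.2

theorem q2_eq (hγ : 0 < γ) (ht : 1 ≤ t) (hr0 : 0 < r) (hr : r < 1 / (4 * γ + 4))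
    (hG : Integrable (restG γ t) (volume.prod ((nu γ).prod (nu γ)))) :
    q2 γ r t = (∫ p : Circle × Circle, mainKernel (rho t * p.1) (rho t ^ 2 * p.2) *
        (psi γ t (rho t * p.1) * psi γ t (rho t ^ 2 * p.2 / (rho t * p.1)))) +
      (∫ q, restG γ t q ∂(volume.prod ((nu γ).prod (nu γ)))) - errS14 γ r t := by
  have hr1 : r < 1 := hr.trans (by rw [div_lt_one (by positivity)]; linarith)
  have hr3 : r ^ 3 < 1 := pow_lt_one₀ hr0.le hr1 (by norm_num)
  have hr2 : r ^ 2 < 1 := pow_lt_one₀ hr0.le hr1 (by norm_num)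
  have hp : Pos4 (r ^ 3) (r ^ 2) r 1 := ⟨by positivity, by positivity, hr0, one_pos⟩
  have h12 : r ^ 3 * r ^ 2 < 1 := mul_lt_one_of_nonneg_of_lt_one_left (by positivity) hr3 hr2.le
  have h13 : r ^ 3 * r < 1 := mul_lt_one_of_nonneg_of_lt_one_left (by positivity) hr3 hr1.le
  have h23 : r ^ 2 * r < 1 := mul_lt_one_of_nonneg_of_lt_one_left (by positivity) hr2 hr1.le
  have hg : GoodRadii (r ^ 3) (r ^ 2) r 1 := ⟨hp, h12, h13, by
    rw [mul_one]
    exact mul_lt_one_of_nonneg_of_lt_one_left (by positivity) h12 hr1.le⟩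
  have hne : ∀ {z : ℂ} {s : ℝ}, 0 < s → ‖z‖ = s → z ≠ 0 := fun h1 h2 => norm_pos_iff.1 (h2 ▸ h1)
  have gap : ∀ a b : ℂ, 0 < ‖a‖ → ‖a‖ ≤ r * ‖b‖ → ‖b‖ ≤ 1 →
      cfun a - cfun b - 2 * γ ≠ 0 := fun a b h1 h2 h3 =>
    (cfun_sub_ne hγ hr0 hr h1 h2 h3).1
  have hkr : ContT (r ^ 3) (r ^ 2) r 1 (krest γ) := by
    refine .of_diffAt fun a b c d h1 h2 h3 h4 => ?_
    have g1 := one_sub_mul_ne h1.le h2.le hg.ab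
    have g2 := one_sub_mul_ne h1.le h3.le hg.ac
    have g4 := one_sub_mul_ne h2.le h3.le h23
    have g3 := one_sub_mul4_ne h1.le h2.le h3.le h4.le hg.abcd
    unfold DiffAt krest kZ ksing
    fun_prop (disch := assumption)
  have hE : ∀ a b c d : ℂ, ‖a‖ = r ^ 3 → ‖b‖ = r ^ 2 → ‖c‖ = r → ‖d‖ = 1 →
      DifferentiableAt ℂ (fun p : ℂ × ℂ × ℂ × ℂ => Ehat γ t p.1 p.2.1) (a, b, c, d) ∧
      DifferentiableAt ℂ (fun p : ℂ × ℂ × ℂ × ℂ => Ehat γ t p.2.2.1 p.2.2.2) (a, b, c, d) := by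
    intro a b c d h1 h2 h3 h4
    refine ⟨.Ehat hγ (by linarith) (by fun_prop) (by fun_prop) (hne hp.p1 h1) (hne hp.p2 h2) ?_,
      .Ehat hγ (by linarith) (by fun_prop) (by fun_prop) (hne hp.p3 h3) (hne hp.p4 h4) ?_⟩
    · exact gap a b (h1 ▸ hp.p1) (by rw [h1, h2]; nlinarith) (by linarith)
    · exact gap c d (h3 ▸ hp.p3) (by rw [h3, h4]; nlinarith) (by linarith)
  rw [q2_eq_Ehat hγ hr0 hr (by linarith), ← M4_kmain hγ ht hr0 hr1]
  have hsplit : M4 (r ^ 3) (r ^ 2) r 1 (fun a b c d =>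
        (kreg a b c d + 4 * γ * ksing a b c d) * Ehat γ t a b * Ehat γ t c d) =
      M4 (r ^ 3) (r ^ 2) r 1 (fun a b c d => kmain a b c d * Ehat γ t a b * Ehat γ t c d) +
      M4 (r ^ 3) (r ^ 2) r 1 (fun a b c d => krest γ a b c d * Ehat γ t a b * Ehat γ t c d) := by
    rw [← M4_add hp]
    · refine M4_congr hp fun a b c d _ _ _ _ => ?_
      unfold kreg kmain krest kZ
      ring
    · refine .of_diffAt fun a b c d h1 h2 h3 h4 => ?_
      have g1 := one_sub_mul_ne h1.le h2.le hg.ab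
      have g2 := one_sub_mul_ne h3.le h4.le (by linarith : r * 1 < 1)
      have g3 := one_sub_mul4_ne h1.le h2.le h3.le h4.le hg.abcd
      have g5 := (hE a b c d h1 h2 h3 h4).1
      have g6 := (hE a b c d h1 h2 h3 h4).2
      unfold DiffAt kmain
      fun_prop (disch := assumption)
    · refine .of_diffAt fun a b c d h1 h2 h3 h4 => ?_
      have g1 := one_sub_mul_ne h1.le h2.le hg.ab
      have g2 := one_sub_mul_ne h1.le h3.le hg.ac
      have g4 := one_sub_mul_ne h2.le h3.le h23
      have g3 := one_sub_mul4_ne h1.le h2.le h3.le h4.le hg.abcd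
      have g5 := (hE a b c d h1 h2 h3 h4).1
      have g6 := (hE a b c d h1 h2 h3 h4).2
      unfold DiffAt krest kZ ksing
      fun_prop (disch := assumption)
  rw [hsplit]
  congr 2
  rw [← integral_rearrange hγ hG]
  refine (M4_Es_fubini hγ (by linarith : 0 ≤ t) hp hkr).trans ?_
  refine integral_congr_ae ((ae_expo_prod hγ).mono fun σ hσ => ?_)
  have hb2 := (Real.exp_pos _).trans_le (beta2_ge ht hσ.1.2)
  have hb1 := (Real.exp_pos _).trans_le (beta1_ge ht hσ.1.1)
  have hb := beta1_ne_beta2 ht hσ.1.1 hσ.1.2 hσ.2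
  refine (M4_krest_eq hg (goodRadii_beta ht hσ.1.1 hσ.1.2) h23.ne ?_ _ _).trans
    (M4_eq_balF t (krest γ) hb1.ne' σ.1 σ.2)
  rw [← div_eq_mul_inv, Ne, div_eq_one_iff_eq hb2.ne']
  exact hb

end

/-! ### Two explicit one-dimensional integrals -/

noncomputable section

lemma sub_mul_I_ne {c : ℝ} (hc : 0 < c) (φ : ℝ) : (c : ℂ) - φ * I ≠ 0 := by
  intro h
  have := congrArg re h
  simp at this
  linarith

lemma normSq_sub_mul_I (c φ : ℝ) : ‖(c : ℂ) - φ * I‖ ^ 2 = c ^ 2 + φ ^ 2 := by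
  rw [← normSq_eq_norm_sq]
  simp [normSq_apply]
  ring

lemma hasDerivAt_sub_mul_I (c φ : ℝ) : HasDerivAt (fun φ : ℝ => (c : ℂ) - φ * I) (-I) φ := by
  simpa using ((hasDerivAt_id φ).ofReal_comp.mul_const I).const_sub (c : ℂ)

lemma norm_exp_sq (lam c φ : ℝ) :
    ‖exp ((lam : ℂ) * ((c : ℂ) - φ * I) ^ 2)‖ = Real.exp (lam * c ^ 2) * Real.exp (-lam * φ ^ 2) := by
  rw [norm_exp, ← Real.exp_add]
  congr 1
  simp [pow_two]
  ring

lemma norm_inv_sub_mul_I_le {c : ℝ} (hc : 1 ≤ c) (φ : ℝ) : ‖((c : ℂ) - φ * I)⁻¹‖ ≤ 1 := by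
  rw [norm_inv]
  apply inv_le_one_of_one_le₀
  have := normSq_sub_mul_I c φ
  nlinarith [norm_nonneg ((c : ℂ) - φ * I), sq_nonneg φ]

lemma norm_inv_sub_mul_I_sq_le {c : ℝ} (hc : 1 ≤ c) (φ : ℝ) :
    ‖((c : ℂ) - φ * I)⁻¹‖ ^ 2 ≤ (1 + φ ^ 2)⁻¹ := by
  rw [norm_inv, inv_pow, normSq_sub_mul_I]
  gcongr
  nlinarith

lemma continuous_inv_sub_mul_I {c : ℝ} (hc : 0 < c) : Continuous fun φ : ℝ => ((c : ℂ) - φ * I)⁻¹ :=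
  Continuous.inv₀ (by fun_prop) fun φ => sub_mul_I_ne hc φ

lemma integral_inv_sq_mul_exp {c lam : ℝ} (hc : 1 ≤ c) (hl : 0 < lam) :
    ∫ φ : ℝ, (((c : ℂ) - φ * I)⁻¹) ^ 2 * exp ((lam : ℂ) * ((c : ℂ) - φ * I) ^ 2) =
      ((2 * √(Real.pi * lam) : ℝ) : ℂ) := by
  have hc0 : 0 < c := by linarith
  have hg : Integrable fun φ : ℝ => exp ((lam : ℂ) * ((c : ℂ) - φ * I) ^ 2) := by
    refine ((integrable_exp_neg_mul_sq hl).const_mul (Real.exp (lam * c ^ 2))).mono'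
      (by fun_prop) (ae_of_all _ fun φ => (norm_exp_sq _ _ _).le)
  have hi : Integrable fun φ : ℝ =>
      (((c : ℂ) - φ * I)⁻¹) ^ 2 * exp ((lam : ℂ) * ((c : ℂ) - φ * I) ^ 2) := by
    refine hg.bdd_mul (c := 1) ((continuous_inv_sub_mul_I hc0).pow 2).aestronglyMeasurable
      (ae_of_all _ fun φ => ?_)
    rw [norm_pow]
    exact pow_le_one₀ (norm_nonneg _) (norm_inv_sub_mul_I_le hc φ)
  have hd : ∀ φ : ℝ, HasDerivAt
      (fun φ : ℝ => ((c : ℂ) - φ * I)⁻¹ * exp ((lam : ℂ) * ((c : ℂ) - φ * I) ^ 2))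
      (I * ((((c : ℂ) - φ * I)⁻¹) ^ 2 * exp ((lam : ℂ) * ((c : ℂ) - φ * I) ^ 2)) -
        2 * lam * I * exp ((lam : ℂ) * ((c : ℂ) - φ * I) ^ 2)) φ := by
    intro φ
    have h0 := sub_mul_I_ne hc0 φ
    have h1 := hasDerivAt_sub_mul_I c φ
    have h2 := (h1.inv h0).mul ((h1.pow 2).const_mul (lam : ℂ)).cexp
    refine h2.congr_deriv ?_
    simp only [Pi.pow_apply, Pi.inv_apply]
    generalize (c : ℂ) - φ * I = z at h0 ⊢
    field_simp
    push_cast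
    ring
  have hlim : ∀ {l : Filter ℝ}, Tendsto (fun φ : ℝ => Real.exp (-lam * φ ^ 2)) l (𝓝 0) → Tendsto
      (fun φ : ℝ => ((c : ℂ) - φ * I)⁻¹ * exp ((lam : ℂ) * ((c : ℂ) - φ * I) ^ 2)) l (𝓝 0) := by
    intro l h
    refine squeeze_zero_norm (fun φ => ?_) (by simpa using h.const_mul (Real.exp (lam * c ^ 2)))
    rw [norm_mul, norm_exp_sq]
    refine (mul_le_of_le_one_left (by positivity) (norm_inv_sub_mul_I_le hc φ)).trans_eq ?_
    simp
  have htop : Tendsto (fun φ : ℝ => Real.exp (-lam * φ ^ 2)) atTop (𝓝 0) := by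
    refine Real.tendsto_exp_atBot.comp ?_
    exact (tendsto_pow_atTop two_ne_zero).const_mul_atTop_of_neg (by linarith)
  have hbot : Tendsto (fun φ : ℝ => Real.exp (-lam * φ ^ 2)) atBot (𝓝 0) := by
    have := htop.comp tendsto_neg_atBot_atTop
    refine this.congr fun φ => ?_
    simp
  have h := integral_of_hasDerivAt_of_tendsto hd ((hi.const_mul I).sub (hg.const_mul _))
    (hlim hbot) (hlim htop)
  rw [integral_sub (hi.const_mul I) (hg.const_mul _), integral_const_mul, integral_const_mul,
    sub_zero, sub_eq_zero] at h
  have hG : ∫ φ : ℝ, exp ((lam : ℂ) * ((c : ℂ) - φ * I) ^ 2) = ((√(Real.pi / lam) : ℝ) : ℂ) := by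
    have := GaussianFourier.integral_cexp_neg_mul_sq_add_real_mul_I (b := lam) (by simpa using hl) c
    rw [Real.sqrt_eq_rpow, ofReal_cpow (by positivity)]
    push_cast
    rw [← this]
    congr 1
    funext φ
    congr 1
    ring_nf
    simp
    ring
  rw [hG] at h
  have h3 : √(Real.pi * lam) = lam * √(Real.pi / lam) := by
    rw [show Real.pi * lam = lam ^ 2 * (Real.pi / lam) by field_simp, Real.sqrt_mul (by positivity),
      Real.sqrt_sq hl.le]
  rw [h3]
  refine mul_left_cancel₀ I_ne_zero (h.trans ?_)
  push_cast
  ring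

lemma tendsto_log_sub_log (u : ℝ) : Tendsto (fun φ : ℝ =>
    log ((1 : ℝ) - φ * I) - log ((1 : ℝ) - (u - φ : ℝ) * I)) atTop (𝓝 (-(Real.pi * I))) := by
  have h0 : Tendsto (fun φ : ℝ => ((φ⁻¹ : ℝ) : ℂ)) atTop (𝓝 0) := by
    exact_mod_cast (continuous_ofReal.tendsto 0).comp tendsto_inv_atTop_zero
  have h1 : Tendsto (fun φ : ℝ => log (((φ⁻¹ : ℝ) : ℂ) - I)) atTop (𝓝 (log (0 - I))) :=
    (h0.sub_const I).clog (by simp [slitPlane])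
  have h2 : Tendsto (fun φ : ℝ => log (((φ⁻¹ : ℝ) : ℂ) * (1 - u * I) + I)) atTop
      (𝓝 (log (0 * (1 - u * I) + I))) :=
    ((h0.mul_const (1 - u * I)).add_const I).clog (by simp [slitPlane])
  have h3 := h1.sub h2
  have e : log (0 - I) - log (0 * (1 - u * I) + I) = -(Real.pi * I) := by
    simp [log_neg_I, log_I]
    ring
  rw [e] at h3
  refine h3.congr' ?_
  filter_upwards [eventually_gt_atTop 0] with φ hφ
  have hne : (φ : ℂ) ≠ 0 := by exact_mod_cast hφ.ne'
  have e1 : ((1 : ℝ) - φ * I : ℂ) = φ * (((φ⁻¹ : ℝ) : ℂ) - I) := by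
    push_cast; field_simp
  have e2 : ((1 : ℝ) - (u - φ : ℝ) * I : ℂ) = φ * (((φ⁻¹ : ℝ) : ℂ) * (1 - u * I) + I) := by
    push_cast; field_simp; ring
  have n1 : ((1 : ℝ) - φ * I : ℂ) ≠ 0 := sub_mul_I_ne one_pos φ
  have n2 : ((1 : ℝ) - (u - φ : ℝ) * I : ℂ) ≠ 0 := sub_mul_I_ne one_pos (u - φ)
  rw [e1] at n1 ⊢
  rw [e2] at n2 ⊢
  rw [log_ofReal_mul hφ (right_ne_zero_of_mul n1), log_ofReal_mul hφ (right_ne_zero_of_mul n2)]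
  ring

lemma integrable_inv_sq_mul_inv_sq (u : ℝ) : Integrable fun φ : ℝ =>
    (((1 : ℝ) - φ * I : ℂ)⁻¹) ^ 2 * (((1 : ℝ) - (u - φ : ℝ) * I : ℂ)⁻¹) ^ 2 := by
  have hc := continuous_inv_sub_mul_I one_pos
  refine integrable_inv_one_add_sq.mono' (((hc.pow 2).mul
    ((hc.comp (continuous_const.sub continuous_id)).pow 2)).aestronglyMeasurable)
    (ae_of_all _ fun φ => ?_)
  rw [norm_mul, norm_pow, norm_pow]
  have h1 := norm_inv_sub_mul_I_sq_le le_rfl φ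
  have h2 := pow_le_one₀ (n := 2) (norm_nonneg _) (norm_inv_sub_mul_I_le le_rfl (u - φ))
  exact (mul_le_of_le_one_right (by positivity) h2).trans h1

lemma tendsto_inv_sub_mul_I {c : ℝ} (hc : 1 ≤ c) {l : Filter ℝ}
    (hl : Tendsto (fun φ : ℝ => (1 + φ ^ 2)⁻¹) l (𝓝 0)) :
    Tendsto (fun φ : ℝ => ((c : ℂ) - φ * I)⁻¹) l (𝓝 0) := by
  refine squeeze_zero_norm (fun φ => ?_) (by simpa using hl.sqrt)
  rw [← Real.sqrt_inv]
  exact Real.le_sqrt_of_sq_le (norm_inv_sub_mul_I_sq_le hc φ)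

lemma integral_inv_sq_mul_inv_sq (u : ℝ) : ∫ φ : ℝ,
    (((1 : ℝ) - φ * I : ℂ)⁻¹) ^ 2 * (((1 : ℝ) - (u - φ : ℝ) * I : ℂ)⁻¹) ^ 2 =
      4 * Real.pi * (((2 : ℝ) - u * I : ℂ)⁻¹) ^ 3 := by
  set S : ℂ := (2 : ℝ) - u * I with hS
  have hS0 : S ≠ 0 := sub_mul_I_ne two_pos u
  have htop : Tendsto (fun φ : ℝ => (1 + φ ^ 2)⁻¹) atTop (𝓝 0) :=
    tendsto_inv_atTop_zero.comp (tendsto_atTop_add_const_left _ _ (tendsto_pow_atTop two_ne_zero))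
  have hbot : Tendsto (fun φ : ℝ => (1 + φ ^ 2)⁻¹) atBot (𝓝 0) := by
    refine (htop.comp tendsto_neg_atBot_atTop).congr fun φ => by simp
  have sub_top : Tendsto (fun φ : ℝ => u - φ) atTop atBot :=
    tendsto_const_nhds.add_atBot tendsto_neg_atTop_atBot
  have sub_bot : Tendsto (fun φ : ℝ => u - φ) atBot atTop :=
    tendsto_const_nhds.add_atTop tendsto_neg_atBot_atTop
  set F : ℝ → ℂ := fun φ => (S⁻¹) ^ 2 * (-I * ((1 : ℝ) - φ * I : ℂ)⁻¹ +
    I * ((1 : ℝ) - (u - φ : ℝ) * I : ℂ)⁻¹ +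
    2 * S⁻¹ * (I * (log ((1 : ℝ) - φ * I) - log ((1 : ℝ) - (u - φ : ℝ) * I)))) with hF
  have hd : ∀ φ : ℝ, HasDerivAt F ((((1 : ℝ) - φ * I : ℂ)⁻¹) ^ 2 *
      (((1 : ℝ) - (u - φ : ℝ) * I : ℂ)⁻¹) ^ 2) φ := by
    intro φ
    have n1 := sub_mul_I_ne one_pos φ
    have n2 := sub_mul_I_ne one_pos (u - φ)
    have d1 := hasDerivAt_sub_mul_I 1 φ
    have d2 := (hasDerivAt_sub_mul_I 1 (u - φ)).scomp φ ((hasDerivAt_id φ).const_sub u)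
    have s1 : ((1 : ℝ) - φ * I : ℂ) ∈ slitPlane := by simp [slitPlane]
    have s2 : ((1 : ℝ) - (u - φ : ℝ) * I : ℂ) ∈ slitPlane := by simp [slitPlane]
    have h := (((d1.inv n1).const_mul (-I)).add ((d2.inv n2).const_mul I)).add
      (((d1.clog_real s1).sub (d2.clog_real s2)).const_mul I |>.const_mul (2 * S⁻¹))
      |>.const_mul ((S⁻¹) ^ 2)
    refine h.congr_deriv ?_
    simp only [Function.comp_apply]
    have eS : S = ((1 : ℝ) - φ * I : ℂ) + ((1 : ℝ) - (u - φ : ℝ) * I : ℂ) := by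
      rw [hS]; push_cast; ring
    generalize ((1 : ℝ) - φ * I : ℂ) = a at *
    generalize ((1 : ℝ) - (u - φ : ℝ) * I : ℂ) = b at *
    rw [eS] at hS0 ⊢
    simp only [neg_smul, one_smul, neg_neg]
    field_simp
    rw [I_sq]
    ring
  have hl1 : Tendsto F atTop (𝓝 ((S⁻¹) ^ 2 * (-I * 0 + I * 0 +
      2 * S⁻¹ * (I * -(Real.pi * I))))) :=
    ((((tendsto_inv_sub_mul_I le_rfl htop).const_mul _).add
      (((tendsto_inv_sub_mul_I le_rfl hbot).comp sub_top).const_mul I)).add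
      (((tendsto_log_sub_log u).const_mul I).const_mul _)).const_mul _
  have hl2 : Tendsto F atBot (𝓝 ((S⁻¹) ^ 2 * (-I * 0 + I * 0 +
      2 * S⁻¹ * (I * -(-(Real.pi * I)))))) := by
    refine ((((tendsto_inv_sub_mul_I le_rfl hbot).const_mul _).add
      (((tendsto_inv_sub_mul_I le_rfl htop).comp sub_bot).const_mul I)).add
      ((Tendsto.const_mul I ?_).const_mul _)).const_mul _
    refine ((tendsto_log_sub_log u).comp sub_bot).neg.congr fun φ => ?_
    simp
  rw [integral_of_hasDerivAt_of_tendsto hd (integrable_inv_sq_mul_inv_sq u) hl2 hl1]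
  have := I_sq
  linear_combination (-4 * Real.pi * (S⁻¹) ^ 3) * this

end

/-! ### Gaussian measures on the plane -/

noncomputable section

open scoped ENNReal

lemma measurePreserving_circle_exp : MeasurePreserving (fun θ : ℝ => Circle.exp θ)
    (ENNReal.ofReal (2 * Real.pi)⁻¹ • volume.restrict (Ioc (-Real.pi) Real.pi))
    (volume : Measure Circle) := by
  refine ⟨Circle.exp.continuous.measurable, ?_⟩
  have h := (AddCircle.measurePreserving_mk (2 * Real.pi) (-Real.pi)).map_eq
  rw [show -Real.pi + 2 * Real.pi = Real.pi by ring] at h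
  have e : (fun θ : ℝ => Circle.exp θ) =
      AddCircle.toCircle (T := 2 * Real.pi) ∘ fun θ : ℝ => (θ : AddCircle (2 * Real.pi)) := by
    funext θ
    simp only [Function.comp_apply, AddCircle.toCircle_apply_mk]
    congr 1
    field_simp
  rw [e, ← Measure.map_map measurable_toCircle (AddCircle.measurable_mk'), Measure.map_smul, h,
    AddCircle.volume_eq_smul_haarAddCircle, Measure.map_smul, Measure.map_smul, volume_circle_eq, smul_smul,
    ← ENNReal.ofReal_mul (by positivity), inv_mul_cancel₀ (by positivity), ENNReal.ofReal_one, one_smul]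

/-- The rotationally invariant Gaussian probability measure with density `lam / π * exp (-lam |w|²)`. -/
def gau (lam : ℝ) : Measure ℂ :=
  volume.withDensity fun w => ENNReal.ofReal (lam / Real.pi * Real.exp (-lam * ‖w‖ ^ 2))

lemma measurable_gau_density (lam : ℝ) : Measurable fun w : ℂ =>
    ENNReal.ofReal (lam / Real.pi * Real.exp (-lam * ‖w‖ ^ 2)) := by fun_prop

lemma lintegral_circle (f : Circle → ℝ≥0∞) (hf : Measurable f) :
    ∫⁻ θ in Ioo (-Real.pi) Real.pi, f (Circle.exp θ) = ENNReal.ofReal (2 * Real.pi) * ∫⁻ v, f v := by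
  rw [← measurePreserving_circle_exp.lintegral_comp hf, lintegral_smul_measure, smul_eq_mul,
    ← mul_assoc, ← ENNReal.ofReal_mul (by positivity), mul_inv_cancel₀ (by positivity),
    ENNReal.ofReal_one, one_mul]
  exact setLIntegral_congr Ioo_ae_eq_Ioc

lemma measurePreserving_gau {γ : ℝ} (hγ : 0 < γ) :
    MeasurePreserving (fun q : ℝ × Circle => (√q.1 : ℂ) * q.2) (nu γ) (gau (4 * γ)) := by
  have := isProbabilityMeasure_expo hγ
  have hm : Measurable fun q : ℝ × Circle => (√q.1 : ℂ) * q.2 := by fun_prop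
  refine ⟨hm, Measure.ext_of_lintegral _ fun f hf => ?_⟩
  set g : ℝ → ℝ≥0∞ := fun r => ∫⁻ v : Circle, f ((r : ℂ) * v) with hg
  have hfm : Measurable fun p : ℝ × Circle => f ((p.1 : ℂ) * p.2) := hf.comp (by fun_prop)
  have hgm : Measurable g := hfm.lintegral_prod_right'
  rw [lintegral_map hf hm, gau, lintegral_withDensity_eq_lintegral_mul _ (measurable_gau_density _) hf,
    nu, lintegral_prod (fun q : ℝ × Circle => f ((√q.1 : ℂ) * q.2)) (hf.comp hm).aemeasurable]
  change ∫⁻ s, g (√s) ∂expo γ = _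
  rw [expo,
    lintegral_withDensity_eq_lintegral_mul _ (by fun_prop) (by fun_prop : Measurable fun s => g √s),
    ← Complex.lintegral_comp_polarCoord_symm]
  have himg : (fun r : ℝ => r ^ 2) '' Ioi 0 = Ioi 0 := by
    ext s
    constructor
    · rintro ⟨r, hr, rfl⟩
      exact pow_pos (mem_Ioi.1 hr) 2
    · intro hs
      exact ⟨√s, Real.sqrt_pos.2 hs, Real.sq_sqrt (le_of_lt hs)⟩
  conv_lhs => rw [← himg]
  rw [lintegral_image_eq_lintegral_abs_deriv_mul measurableSet_Ioi
    (fun x _ => (hasDerivAt_pow 2 x).hasDerivWithinAt)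
    (fun x hx y hy h => (pow_left_inj₀ (le_of_lt hx) (le_of_lt hy) two_ne_zero).1 h)]
  have htar : polarCoord.target = Ioi (0 : ℝ) ×ˢ Ioo (-Real.pi) Real.pi := rfl
  rw [htar, Measure.volume_eq_prod, ← Measure.prod_restrict, lintegral_prod]
  · refine setLIntegral_congr_fun measurableSet_Ioi fun r hr => ?_
    have hr : 0 < r := hr
    have e : ∀ θ : ℝ, Complex.polarCoord.symm (r, θ) = (r : ℂ) * Circle.exp θ := by
      intro θ
      simp [Complex.polarCoord_symm_apply, Circle.coe_exp, exp_mul_I]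
    have e2 : ∀ θ : ℝ, ‖(r : ℂ) * Circle.exp θ‖ = r := by
      intro θ
      simp [abs_of_pos hr]
    simp only [Pi.mul_apply, e, e2, smul_eq_mul, ← mul_assoc]
    rw [lintegral_const_mul _ (by exact hf.comp (by fun_prop)),
      lintegral_circle (fun v => f ((r : ℂ) * v)) (hf.comp (by fun_prop)), Real.sqrt_sq hr.le, ← mul_assoc,
      ← ENNReal.ofReal_mul (by positivity), ← ENNReal.ofReal_mul (by positivity),
      ← ENNReal.ofReal_mul (by positivity)]
    congr 2
    rw [abs_of_pos (by positivity)]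
    push_cast
    field_simp
  · have hp : Measurable fun p : ℝ × ℝ => Complex.polarCoord.symm p := by
      simp only [Complex.polarCoord_symm_apply]
      fun_prop
    exact (Measurable.mul (by fun_prop) (((measurable_gau_density _).mul hf).comp hp)).aemeasurable

end

/-! ### Gaussian moments and the rotation of a pair of Gaussians -/

noncomputable section

open scoped ENNReal ComplexConjugate

variable {lam γ : ℝ} {α β : ℂ} {h : ℂ → ℂ}

lemma measurePreserving_withDensity {X Y : Type*} [MeasurableSpace X] [MeasurableSpace Y]
    {μ : Measure X} {ν : Measure Y} {T : X → Y} (hT : MeasurePreserving T μ ν) {d : Y → ℝ≥0∞}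
    (hd : Measurable d) :
    MeasurePreserving T (μ.withDensity fun x => d (T x)) (ν.withDensity d) := by
  refine ⟨hT.measurable, Measure.ext fun s hs => ?_⟩
  rw [Measure.map_apply hT.measurable hs, withDensity_apply _ (hT.measurable hs),
    withDensity_apply _ hs, hT.setLIntegral_comp_preimage hs hd]

lemma measurePreserving_conj_gau (lam : ℝ) : MeasurePreserving (fun w : ℂ => conj w) (gau lam) (gau lam) := by
  have h0 : MeasurePreserving (fun w : ℂ => conj w) volume volume := conjLIE.measurePreserving
  simpa [gau] using measurePreserving_withDensity h0 (measurable_gau_density lam)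

def rot (p : ℂ × ℂ) : ℂ × ℂ := (p.1 - p.2 / 2, p.1 + p.2 / 2)

lemma measurePreserving_rot_volume :
    MeasurePreserving rot ((volume : Measure ℂ).prod volume) ((volume : Measure ℂ).prod volume) := by
  have h1 : MeasurePreserving (fun p : ℂ × ℂ => (p.1, p.2 - p.1 / 2))
      ((volume : Measure ℂ).prod volume) ((volume : Measure ℂ).prod volume) :=
    (MeasurePreserving.id volume).skew_product (g := fun x y => y - x / 2) (by fun_prop) <|
      ae_of_all _ fun x => (measurePreserving_sub_right volume (x / 2)).map_eq
  have h2 := (measurePreserving_add_prod (volume : Measure ℂ) (volume : Measure ℂ)).comp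
    (h1.comp (Measure.measurePreserving_swap (μ := (volume : Measure ℂ)) (ν := (volume : Measure ℂ))))
  have h3 := Measure.measurePreserving_swap.comp h2
  convert h3 using 1
  funext p
  simp [rot]
  ring

instance sFinite_gau (lam : ℝ) : SFinite (gau lam) := by unfold gau; infer_instance

lemma measurePreserving_rot (hγ : 0 < γ) : MeasurePreserving rot
    ((gau (8 * γ)).prod (gau (2 * γ))) ((gau (4 * γ)).prod (gau (4 * γ))) := by
  have hm := measurable_gau_density (4 * γ)
  have := measurePreserving_withDensity measurePreserving_rot_volume
    (d := fun p => ENNReal.ofReal (4 * γ / Real.pi * Real.exp (-(4 * γ) * ‖p.1‖ ^ 2)) *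
      ENNReal.ofReal (4 * γ / Real.pi * Real.exp (-(4 * γ) * ‖p.2‖ ^ 2)))
    ((hm.comp measurable_fst).mul (hm.comp measurable_snd))
  simp only [gau]
  rw [prod_withDensity hm hm, prod_withDensity (measurable_gau_density _) (measurable_gau_density _)]
  convert this using 3 with p
  rw [← ENNReal.ofReal_mul (by positivity), ← ENNReal.ofReal_mul (by positivity)]
  congr 1
  have e : ‖(rot p).1‖ ^ 2 + ‖(rot p).2‖ ^ 2 = 2 * ‖p.1‖ ^ 2 + ‖p.2‖ ^ 2 / 2 := by
    simp only [rot, ← normSq_eq_norm_sq, normSq_apply]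
    simp
    ring
  rw [mul_mul_mul_comm, ← Real.exp_add, mul_mul_mul_comm, ← Real.exp_add]
  congr 1
  · field_simp; ring
  · congr 1
    linear_combination (4 * γ) * e

lemma ae_gau_ne (lam : ℝ) : ∀ᵐ w ∂gau lam, w ≠ 0 := by
  have : gau lam {0} = 0 := withDensity_absolutelyContinuous _ _ (by simp)
  rw [ae_iff]
  simpa using this

lemma integrable_gau_majorant (hl : 0 < lam) (K : ℝ) :
    Integrable (fun w : ℂ => (1 + ‖w‖⁻¹) * Real.exp (K * ‖w‖)) (gau lam) := by
  obtain ⟨γ, hγ, rfl⟩ : ∃ γ, 0 < γ ∧ lam = 4 * γ := ⟨lam / 4, by positivity, by ring⟩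
  have := isProbabilityMeasure_expo hγ
  rw [← (measurePreserving_gau hγ).map_eq, integrable_map_measure (by fun_prop)
    (measurePreserving_gau hγ).measurable.aemeasurable]
  have hs : Integrable (fun s : ℝ => (1 + (√s)⁻¹) * Real.exp (K * √s)) (expo γ) := by
    simp only [add_mul, one_mul]
    refine (integrable_exp_sqrt hγ K).add ?_
    unfold expo
    rw [integrable_withDensity_iff_integrable_smul' (by fun_prop) (by simp)]
    have h := (integrableOn_rpow_mul_exp_neg_mul_rpow (s := -(1 / 2)) (p := 1) (b := 2 * γ)
      (by norm_num) one_pos (by positivity)).const_mul (4 * γ * Real.exp (K ^ 2 / (8 * γ)))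
    refine h.mono' (by fun_prop) ?_
    filter_upwards [ae_restrict_mem measurableSet_Ioi] with s hs
    have hs' : 0 < s := hs
    rw [ENNReal.toReal_ofReal (by positivity), smul_eq_mul, Real.norm_of_nonneg (by positivity)]
    have h0 : √s ^ 2 = s := Real.sq_sqrt (le_of_lt hs)
    have h1 : K * √s ≤ K ^ 2 / (8 * γ) + 2 * γ * s := by
      rw [div_add' _ _ _ (by positivity), le_div_iff₀ (by positivity), ← h0]
      simp only [Real.sqrt_sq (Real.sqrt_nonneg s)]
      nlinarith [sq_nonneg (K - 4 * γ * √s)]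
    rw [Real.rpow_neg hs'.le, ← Real.sqrt_eq_rpow, Real.rpow_one]
    calc _ = 4 * γ * ((√s)⁻¹ * Real.exp (-(4 * γ) * s + K * √s)) := by rw [Real.exp_add]; ring
      _ ≤ 4 * γ * ((√s)⁻¹ * Real.exp (K ^ 2 / (8 * γ) + -(2 * γ) * s)) := by
          have h2 : -(4 * γ) * s + K * √s ≤ K ^ 2 / (8 * γ) + -(2 * γ) * s := by linarith
          gcongr
      _ = _ := by rw [Real.exp_add]; ring
  refine (hs.comp_fst (volume : Measure Circle)).congr (ae_of_all _ fun q => ?_)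
  have hn : ‖(√q.1 : ℂ) * q.2‖ = √q.1 := by
    rw [norm_mul, Circle.norm_coe, mul_one, norm_real, Real.norm_of_nonneg (Real.sqrt_nonneg _)]
  simp only [Function.comp_apply, hn]

/-- Measurable functions with at most a simple pole at the origin and exponential growth. -/
structure GaussTame (h : ℂ → ℂ) : Prop where
  meas : Measurable h
  bound : ∃ C K : ℝ, ∀ w, w ≠ 0 → ‖h w‖ ≤ C * ((1 + ‖w‖⁻¹) * Real.exp (K * ‖w‖))

lemma GaussTame.integrable (hh : GaussTame h) (hl : 0 < lam) : Integrable h (gau lam) := by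
  obtain ⟨C, K, hC⟩ := hh.bound
  exact ((integrable_gau_majorant hl K).const_mul C).mono' hh.meas.aestronglyMeasurable
    ((ae_gau_ne lam).mono hC)

lemma GaussTame.mul_exp (hh : GaussTame h) {f : ℂ → ℂ} (hf : Measurable f) {K' : ℝ}
    (hb : ∀ w, ‖f w‖ ≤ Real.exp (K' * ‖w‖)) : GaussTame fun w => h w * f w := by
  obtain ⟨C, K, hC⟩ := hh.bound
  refine ⟨hh.meas.mul hf, C, K + K', fun w hw => ?_⟩
  rw [norm_mul, add_mul K, Real.exp_add, ← mul_assoc, ← mul_assoc]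
  have := hC w hw
  rw [← mul_assoc] at this
  exact mul_le_mul this (hb w) (norm_nonneg _) ((norm_nonneg _).trans this)

lemma norm_exp_add_conj_le (α β w : ℂ) : ‖exp (α * w + β * conj w)‖ ≤ Real.exp ((‖α‖ + ‖β‖) * ‖w‖) := by
  refine (norm_exp_le_exp_norm _).trans (Real.exp_le_exp.2 ?_)
  refine (norm_add_le _ _).trans_eq ?_
  rw [norm_mul, norm_mul, RCLike.norm_conj]
  ring

lemma GaussTame.mul_cexp (hh : GaussTame h) (α β : ℂ) :
    GaussTame fun w => h w * exp (α * w + β * conj w) :=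
  hh.mul_exp (by fun_prop) (norm_exp_add_conj_le α β)

lemma GaussTame.conj_mul (hh : GaussTame h) : GaussTame fun w => conj w * h w := by
  have := hh.mul_exp (f := fun w => conj w) (by fun_prop) (K' := 1) fun w => by
    rw [RCLike.norm_conj, one_mul]
    linarith [Real.add_one_le_exp ‖w‖]
  simpa only [mul_comm] using this

lemma gaussTame_one : GaussTame fun _ => 1 :=
  ⟨measurable_const, 1, 0, fun w _ => by simp⟩

lemma gaussTame_inv : GaussTame fun w => (conj w)⁻¹ :=
  ⟨by fun_prop, 1, 0, fun w _ => by simp⟩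

/-- The Laplace transform of a tame function. -/
def gint (lam : ℝ) (h : ℂ → ℂ) (α β : ℂ) : ℂ := ∫ w, h w * exp (α * w + β * conj w) ∂gau lam

lemma hasDerivAt_gint (hl : 0 < lam) (hh : GaussTame h) (α β : ℂ) :
    HasDerivAt (fun β => gint lam h α β) (gint lam (fun w => conj w * h w) α β) β := by
  have hb : GaussTame fun w => conj w * h w * ((Real.exp ((‖α‖ + (‖β‖ + 1)) * ‖w‖) : ℝ) : ℂ) :=
    hh.conj_mul.mul_exp (by fun_prop) fun w => by
      rw [norm_real, Real.norm_of_nonneg (by positivity)]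
  refine (hasDerivAt_integral_of_dominated_loc_of_deriv_le (s := Metric.ball β 1)
    (bound := fun w => ‖conj w * h w * ((Real.exp ((‖α‖ + (‖β‖ + 1)) * ‖w‖) : ℝ) : ℂ)‖)
    (F' := fun β w => conj w * h w * exp (α * w + β * conj w))
    (Metric.ball_mem_nhds _ one_pos) (Eventually.of_forall fun b =>
      (hh.mul_cexp α b).meas.aestronglyMeasurable) ((hh.mul_cexp α β).integrable hl)
      (hh.conj_mul.mul_cexp α β).meas.aestronglyMeasurable ?_ (hb.integrable hl).norm ?_).2
  · refine ae_of_all _ fun w b hb => ?_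
    rw [norm_mul, norm_mul (conj w * h w) ((Real.exp _ : ℝ) : ℂ), norm_real,
      Real.norm_of_nonneg (by positivity)]
    gcongr
    refine (norm_exp_add_conj_le α b w).trans (Real.exp_le_exp.2 ?_)
    have : ‖b‖ ≤ ‖β‖ + 1 := by
      have h1 := norm_sub_norm_le b β
      rw [Metric.mem_ball, dist_eq_norm] at hb
      linarith
    gcongr
  · refine ae_of_all _ fun w b _ => ?_
    have := ((((hasDerivAt_id b).mul_const (conj w)).const_add (α * w)).cexp).const_mul (h w)
    refine this.congr_deriv ?_
    simp
    ring

lemma gint_one (hl : 0 < lam) (α β : ℂ) : gint lam (fun _ => 1) α β = exp (α * β / lam) := by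
  have h1 := GaussianFourier.integral_cexp_neg_mul_sum_add (ι := Fin 2) (b := lam) (by simpa using hl)
    ![α + β, I * (α - β)]
  rw [gint, gau, integral_withDensity_eq_integral_toReal_smul (measurable_gau_density _) (by simp),
    ← volume_preserving_equiv_pi.symm.integral_comp' ]
  have e : ∀ v : Fin 2 → ℝ, (ENNReal.ofReal (lam / Real.pi *
      Real.exp (-lam * ‖measurableEquivPi.symm v‖ ^ 2))).toReal •
      (1 * exp (α * measurableEquivPi.symm v + β * conj (measurableEquivPi.symm v))) =
      (lam / Real.pi) * exp (-lam * ∑ i, (v i : ℂ) ^ 2 + ∑ i, ![α + β, I * (α - β)] i * v i) := by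
    intro v
    rw [ENNReal.toReal_ofReal (by positivity), ← normSq_eq_norm_sq, measurableEquivPi_symm_apply,
      real_smul, one_mul]
    push_cast
    rw [mul_assoc, ← exp_add]
    congr 2
    simp [normSq_apply, Fin.sum_univ_two]
    ring
  simp_rw [e]
  rw [integral_const_mul, h1]
  simp only [Fintype.card_fin, Fin.sum_univ_two]
  have hp : (Real.pi : ℂ) ≠ 0 := by exact_mod_cast Real.pi_pos.ne'
  have hlc : (lam : ℂ) ≠ 0 := by exact_mod_cast hl.ne'
  simp only [Nat.cast_ofNat, div_self (two_ne_zero' ℂ), cpow_one, Matrix.cons_val_zero, Matrix.cons_val_one]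
  rw [← mul_assoc, show (lam / Real.pi * (Real.pi / lam) : ℂ) = 1 by field_simp, one_mul]
  congr 1
  field_simp
  rw [I_sq]
  ring

lemma hasDerivAt_exp_div (α β : ℂ) (lam : ℝ) :
    HasDerivAt (fun β => exp (α * β / lam)) (α / lam * exp (α * β / lam)) β := by
  refine ((((hasDerivAt_id β).const_mul α).div_const (lam : ℂ)).cexp).congr_deriv ?_
  simp
  ring

lemma gint_conj (hl : 0 < lam) (α β : ℂ) :
    gint lam (fun w => conj w) α β = α / lam * exp (α * β / lam) := by
  have h := hasDerivAt_gint hl gaussTame_one α β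
  simp only [gint_one hl, mul_one] at h
  exact h.unique (hasDerivAt_exp_div α β lam)

lemma gint_conj_sq (hl : 0 < lam) (α β : ℂ) :
    gint lam (fun w => conj w ^ 2) α β = (α / lam) ^ 2 * exp (α * β / lam) := by
  have h := hasDerivAt_gint hl gaussTame_one.conj_mul α β
  simp only [mul_one, gint_conj hl] at h
  have := h.unique ((hasDerivAt_exp_div α β lam).const_mul _)
  simp only [← pow_two] at this
  rw [this]
  ring

lemma gint_inv_zero (hl : 0 < lam) (α : ℂ) : gint lam (fun w => (conj w)⁻¹) α 0 = 0 := by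
  obtain ⟨γ, hγ, rfl⟩ : ∃ γ, 0 < γ ∧ lam = 4 * γ := ⟨lam / 4, by positivity, by ring⟩
  have := isProbabilityMeasure_expo hγ
  have hT := gaussTame_inv.mul_cexp α 0
  have hi := hT.integrable hl
  rw [← (measurePreserving_gau hγ).map_eq, integrable_map_measure hT.meas.aestronglyMeasurable
    (measurePreserving_gau hγ).measurable.aemeasurable] at hi
  rw [gint, ← (measurePreserving_gau hγ).map_eq, integral_map
    (measurePreserving_gau hγ).measurable.aemeasurable hT.meas.aestronglyMeasurable]
  refine (integral_prod _ hi).trans ?_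
  have e : ∀ s : ℝ, ∫ v : Circle, (conj ((√s : ℂ) * v))⁻¹ * exp (α * ((√s : ℂ) * v) +
      0 * conj ((√s : ℂ) * v)) = 0 := by
    intro s
    have h1 := cint_disc (R := 1) one_pos (f := fun z => (√s : ℂ)⁻¹ * z * exp (α * ((√s : ℂ) * z)))
      (fun z _ => by fun_prop)
    rw [cint_eq 1 one_ne_zero] at h1
    rw [mul_zero, zero_mul] at h1
    refine Eq.trans ?_ h1
    congr 1
    funext v
    simp only [map_mul, conj_ofReal, ← Circle.coe_inv_eq_conj, Circle.coe_inv, mul_inv, inv_inv]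
    simp
  exact (integral_congr_ae (ae_of_all _ e)).trans (by simp)

lemma mul_gint_inv (hl : 0 < lam) (α β : ℂ) :
    α * gint lam (fun w => (conj w)⁻¹) α β = lam * (exp (α * β / lam) - 1) := by
  have hlc : (lam : ℂ) ≠ 0 := by exact_mod_cast hl.ne'
  have hd : ∀ β, HasDerivAt (fun β => α * gint lam (fun w => (conj w)⁻¹) α β -
      lam * exp (α * β / lam)) 0 β := by
    intro β
    have h := hasDerivAt_gint hl gaussTame_inv α β
    have e : gint lam (fun w => conj w * (conj w)⁻¹) α β = exp (α * β / lam) := by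
      rw [← gint_one hl]
      refine integral_congr_ae ((ae_gau_ne lam).mono fun w hw => ?_)
      have : conj w ≠ 0 := by simpa using hw
      simp [this]
    rw [e] at h
    refine ((h.const_mul α).sub ((hasDerivAt_exp_div α β lam).const_mul (lam : ℂ))).congr_deriv ?_
    field_simp
    ring
  have := is_const_of_deriv_eq_zero (fun β => (hd β).differentiableAt) (fun β => (hd β).deriv) β 0
  simp only [gint_inv_zero hl, mul_zero, zero_div, exp_zero, zero_sub, mul_one] at this
  linear_combination this

end

/-! ### The singular Gaussian integral -/

noncomputable section

open scoped ENNReal ComplexConjugate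

variable {γ : ℝ}

def pairKernel (a b : ℂ) (p : ℂ × ℂ) : ℂ :=
  conj p.1 * conj p.2 / (conj p.2 - conj p.1) * exp (a * (p.1 + conj p.1) + b * (p.2 + conj p.2))

def pairInt (γ : ℝ) (a b : ℂ) : ℂ := ∫ p, pairKernel a b p ∂(gau (4 * γ)).prod (gau (4 * γ))

lemma measurable_pairKernel (a b : ℂ) : Measurable (pairKernel a b) := by
  unfold pairKernel
  fun_prop

lemma pairKernel_rot (a b : ℂ) (q : ℂ × ℂ) : pairKernel a b (rot q) =
    conj q.1 ^ 2 * exp ((a + b) * q.1 + (a + b) * conj q.1) *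
      ((conj q.2)⁻¹ * exp ((b - a) / 2 * q.2 + (b - a) / 2 * conj q.2)) -
    1 / 4 * (1 * exp ((a + b) * q.1 + (a + b) * conj q.1) *
      (conj q.2 * exp ((b - a) / 2 * q.2 + (b - a) / 2 * conj q.2))) := by
  have e : exp (a * ((rot q).1 + conj (rot q).1) + b * ((rot q).2 + conj (rot q).2)) =
      exp ((a + b) * q.1 + (a + b) * conj q.1) *
        exp ((b - a) / 2 * q.2 + (b - a) / 2 * conj q.2) := by
    rw [← exp_add]
    congr 1
    simp only [rot, map_add, map_sub, map_div₀, conj_ofNat]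
    ring
  rw [pairKernel, e]
  generalize exp ((a + b) * q.1 + (a + b) * conj q.1) = E1
  generalize exp ((b - a) / 2 * q.2 + (b - a) / 2 * conj q.2) = E2
  simp only [rot, map_add, map_sub, map_div₀, conj_ofNat]
  by_cases h : conj q.2 = 0
  · simp [h]
  · rw [show conj q.1 + conj q.2 / 2 - (conj q.1 - conj q.2 / 2) = conj q.2 by ring]
    field_simp
    ring

lemma gaussTame_conj_sq : GaussTame fun w => conj w ^ 2 := by
  have := gaussTame_one.conj_mul.conj_mul
  simpa only [mul_one, ← pow_two] using this

lemma mul_pairInt (hγ : 0 < γ) (a b : ℂ) : (b - a) * pairInt γ a b =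
    (4 * γ)⁻¹ * (a * b * exp ((a ^ 2 + b ^ 2) / (4 * γ)) -
      (a + b) ^ 2 / 4 * exp ((a + b) ^ 2 / (8 * γ))) := by
  have hc : GaussTame fun w => conj w := by simpa only [mul_one] using gaussTame_one.conj_mul
  have h8 : 0 < 8 * γ := by positivity
  have h2 : 0 < 2 * γ := by positivity
  have i1 := (((gaussTame_conj_sq.mul_cexp (a + b) (a + b)).integrable h8).mul_prod
    ((gaussTame_inv.mul_cexp ((b - a) / 2) ((b - a) / 2)).integrable h2))
  have i2 := (((gaussTame_one.mul_cexp (a + b) (a + b)).integrable h8).mul_prod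
    ((hc.mul_cexp ((b - a) / 2) ((b - a) / 2)).integrable h2)).const_mul (1 / 4)
  have hL : pairInt γ a b = gint (8 * γ) (fun w => conj w ^ 2) (a + b) (a + b) *
        gint (2 * γ) (fun w => (conj w)⁻¹) ((b - a) / 2) ((b - a) / 2) -
      1 / 4 * (gint (8 * γ) (fun _ => 1) (a + b) (a + b) *
        gint (2 * γ) (fun w => conj w) ((b - a) / 2) ((b - a) / 2)) := by
    rw [pairInt, ← (measurePreserving_rot hγ).map_eq, integral_map
      (measurePreserving_rot hγ).measurable.aemeasurable
      (measurable_pairKernel a b).aestronglyMeasurable]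
    simp only [pairKernel_rot]
    rw [integral_sub i1 i2, integral_const_mul]
    simp only [gint]
    rw [← integral_prod_mul, ← integral_prod_mul]
  have h3 := mul_gint_inv h2 ((b - a) / 2) ((b - a) / 2)
  have e : exp ((a ^ 2 + b ^ 2) / (4 * γ)) = exp ((a + b) ^ 2 / (8 * γ)) *
      exp ((b - a) / 2 * ((b - a) / 2) / (2 * γ)) := by
    rw [← exp_add]
    congr 1
    have : (γ : ℂ) ≠ 0 := by exact_mod_cast hγ.ne'
    field_simp
    ring
  have hg : (γ : ℂ) ≠ 0 := by exact_mod_cast hγ.ne'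
  rw [hL, gint_conj_sq h8, gint_one h8, gint_conj h2, e]
  push_cast at h3 ⊢
  rw [← pow_two (a + b)]
  generalize exp ((a + b) ^ 2 / (8 * γ)) = E1 at *
  generalize exp ((b - a) / 2 * ((b - a) / 2) / (2 * γ)) = E2 at *
  generalize gint (2 * γ) (fun w => (conj w)⁻¹) ((b - a) / 2) ((b - a) / 2) = G at *
  have e2 : (b - a) * (((a + b) / (8 * γ)) ^ 2 * E1 * G -
      1 / 4 * (E1 * ((b - a) / 2 / (2 * γ) * E2))) = ((a + b) / (8 * γ)) ^ 2 * E1 * (2 * ((b - a) / 2 * G)) -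
      (b - a) * (1 / 4 * (E1 * ((b - a) / 2 / (2 * γ) * E2))) := by ring
  rw [e2, h3]
  field_simp
  ring

lemma pairInt_swap (γ : ℝ) (a b : ℂ) : pairInt γ b a = -pairInt γ a b := by
  rw [pairInt, pairInt, ← integral_neg, ← integral_prod_swap]
  congr 1
  funext p
  simp only [pairKernel, Prod.fst_swap, Prod.snd_swap]
  rw [← neg_sub (conj p.2) (conj p.1), div_neg, mul_comm (conj p.2),
    add_comm (b * _)]
  ring

lemma integrable_pair_majorant (hγ : 0 < γ) {K : ℝ} (hK : 0 ≤ K) :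
    Integrable (fun p : ℂ × ℂ => Real.exp (K * (‖p.1‖ + ‖p.2‖)) * (1 + ‖p.2 - p.1‖⁻¹))
      ((gau (4 * γ)).prod (gau (4 * γ))) := by
  rw [← (measurePreserving_rot hγ).map_eq, integrable_map_measure (by fun_prop)
    (measurePreserving_rot hγ).measurable.aemeasurable]
  refine ((integrable_gau_majorant (by positivity : 0 < 8 * γ) (2 * K)).mul_prod
    (integrable_gau_majorant (by positivity : 0 < 2 * γ) K)).mono' ?_ (ae_of_all _ fun q => ?_)
  · exact (Measurable.comp (by fun_prop) (measurePreserving_rot hγ).measurable).aestronglyMeasurable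
  · have e : (rot q).2 - (rot q).1 = q.2 := by simp only [rot]; ring
    simp only [Function.comp_apply, e]
    rw [Real.norm_of_nonneg (by positivity)]
    have h1 : ‖(rot q).1‖ ≤ ‖q.1‖ + ‖q.2‖ / 2 := by
      refine (norm_sub_le _ _).trans_eq ?_
      simp
    have h2 : ‖(rot q).2‖ ≤ ‖q.1‖ + ‖q.2‖ / 2 := by
      refine (norm_add_le _ _).trans_eq ?_
      simp
    have h3 : Real.exp (K * (‖(rot q).1‖ + ‖(rot q).2‖)) ≤
        Real.exp (2 * K * ‖q.1‖) * Real.exp (K * ‖q.2‖) := by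
      rw [← Real.exp_add]
      refine Real.exp_le_exp.2 ?_
      nlinarith
    have h4 : 0 ≤ ‖q.1‖⁻¹ := by positivity
    calc _ ≤ Real.exp (2 * K * ‖q.1‖) * Real.exp (K * ‖q.2‖) * (1 + ‖q.2‖⁻¹) := by gcongr
      _ ≤ (1 + ‖q.1‖⁻¹) * (Real.exp (2 * K * ‖q.1‖) * Real.exp (K * ‖q.2‖) * (1 + ‖q.2‖⁻¹)) := by
          refine le_mul_of_one_le_left (by positivity) (by linarith)
      _ = _ := by ring

def gaussPair (q : (ℝ × Circle) × ℝ × Circle) : ℂ × ℂ :=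
  ((√q.1.1 : ℂ) * q.1.2, conj ((√q.2.1 : ℂ) * q.2.2))

lemma measurePreserving_gaussPair (hγ : 0 < γ) : MeasurePreserving gaussPair
    ((nu γ).prod (nu γ)) ((gau (4 * γ)).prod (gau (4 * γ))) := by
  have := isProbabilityMeasure_nu hγ
  exact (measurePreserving_gau hγ).prod ((measurePreserving_conj_gau _).comp (measurePreserving_gau hγ))

lemma norm_gaussPair (q : (ℝ × Circle) × ℝ × Circle) :
    ‖(gaussPair q).1‖ = √q.1.1 ∧ ‖(gaussPair q).2‖ = √q.2.1 := by
  constructor <;>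
    simp [gaussPair, abs_of_nonneg (Real.sqrt_nonneg _), Circle.norm_coe]

lemma integrable_nu_majorant (hγ : 0 < γ) {K : ℝ} (hK : 0 ≤ K) :
    Integrable (fun q : (ℝ × Circle) × ℝ × Circle => Real.exp (K * (√q.1.1 + √q.2.1)) *
      (1 + ‖(gaussPair q).2 - (gaussPair q).1‖⁻¹)) ((nu γ).prod (nu γ)) := by
  have h := (measurePreserving_gaussPair hγ).integrable_comp_of_integrable (integrable_pair_majorant hγ hK)
  refine h.congr (ae_of_all _ fun q => ?_)
  simp only [Function.comp_apply, (norm_gaussPair q).1, (norm_gaussPair q).2]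

end

/-! ### Points on the scale of the diffusive window -/

noncomputable section

open scoped ENNReal ComplexConjugate

variable {γ t s φ c : ℝ} {x v : ℂ}

def pt (t : ℝ) (k : ℂ) : ℂ := exp (-k * del t)

lemma pt_div (t : ℝ) (k l : ℂ) : pt t k / pt t l = pt t (k - l) := by
  rw [pt, pt, pt, ← exp_sub]
  congr 1
  ring

lemma rho_mul_exp (t φ : ℝ) : (rho t : ℂ) * Circle.exp (φ * del t) = pt t (1 - φ * I) := by
  rw [rho, Circle.coe_exp, ofReal_exp, ← exp_add, pt]
  congr 1
  push_cast
  ring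

lemma rho_sq_mul_exp (t φ : ℝ) : (rho t : ℂ) ^ 2 * Circle.exp (φ * del t) = pt t (2 - φ * I) := by
  rw [rho, Circle.coe_exp, ofReal_exp, ← exp_nat_mul, ← exp_add, pt]
  congr 1
  push_cast
  ring

lemma pt_eq (t c φ : ℝ) : pt t (c - φ * I) = Real.exp (-c * del t) * exp ((φ * del t : ℝ) * I) := by
  rw [pt, ofReal_exp, ← exp_add]
  congr 1
  push_cast
  ring

lemma norm_pt (t c φ : ℝ) : ‖pt t (c - φ * I)‖ = Real.exp (-c * del t) := by
  rw [pt_eq, norm_mul, norm_exp_ofReal_mul_I, mul_one, norm_real, Real.norm_of_nonneg (Real.exp_pos _).le]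

lemma norm_pt_one (t φ : ℝ) : ‖pt t (1 - φ * I)‖ = rho t := by
  have := norm_pt t 1 φ
  rwa [ofReal_one, neg_one_mul] at this

lemma abs_mul_del_le (ht : 1 ≤ t) (hφ : |φ| ≤ Real.pi * √t) : |φ * del t| ≤ Real.pi := by
  rw [abs_mul, abs_of_pos (del_pos ht), del]
  have : 0 < √t := by positivity
  rwa [← div_eq_mul_inv, div_le_iff₀ this]

lemma sqrt_inv_le (ht : 1 ≤ t) (hφ : |φ| ≤ Real.pi * √t) : del t ≤ 5 / (1 + |φ|) := by
  have h0 : 1 ≤ √t := Real.one_le_sqrt.2 ht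
  rw [le_div_iff₀ (by positivity), del, inv_mul_le_iff₀ (by positivity)]
  nlinarith [Real.pi_lt_four]

lemma norm_one_sub_pt_ge (ht : 1 ≤ t) (hc : 1 ≤ c) (hc2 : c ≤ 2) (hφ : |φ| ≤ Real.pi * √t) :
    (1 + |φ|) * del t / 10 ≤ ‖1 - pt t (c - φ * I)‖ := by
  have hd := del_pos ht
  have hd1 := del_le_one ht
  refine abs_le_of_sq_le_sq' ?_ (norm_nonneg _) |>.2
  set R := Real.exp (-c * del t) with hR
  have hcos := Real.cos_le_one_sub_mul_cos_sq (abs_mul_del_le ht hφ)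
  have h1 : ‖1 - pt t (c - φ * I)‖ ^ 2 = (1 - R) ^ 2 + 2 * R * (1 - Real.cos (φ * del t)) := by
    rw [pt_eq, ← hR, ← normSq_eq_norm_sq, normSq_apply]
    simp only [sub_re, sub_im, one_re, one_im, re_ofReal_mul, im_ofReal_mul, exp_ofReal_mul_I_re,
      exp_ofReal_mul_I_im]
    linear_combination R ^ 2 * Real.sin_sq_add_cos_sq (φ * del t)
  have hR0 : 1 / 9 ≤ R := by
    have e : Real.exp (-2) ≤ R := Real.exp_le_exp.2 (by nlinarith)
    have h3 : Real.exp 1 ≤ 3 := by linarith [Real.exp_one_lt_d9]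
    have : Real.exp (-2) = (Real.exp 1 ^ 2)⁻¹ := by
      rw [← Real.exp_nat_mul, ← Real.exp_neg]; norm_num
    rw [this] at e
    refine le_trans ?_ e
    rw [one_div]
    gcongr
    nlinarith [Real.exp_pos 1]
  have hR1 : del t / 2 ≤ 1 - R := by
    refine (half_mul_le_one_sub_exp hd.le hd1).trans (sub_le_sub_left (Real.exp_le_exp.2 ?_) 1)
    nlinarith
  have hpi : 1 / 10 ≤ 1 / Real.pi ^ 2 := by
    refine one_div_le_one_div_of_le (by positivity) ?_
    nlinarith [Real.pi_lt_d2, Real.pi_pos]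
  have h2 : 2 / 10 * (φ * del t) ^ 2 ≤ 1 - Real.cos (φ * del t) := by
    have : 2 / Real.pi ^ 2 * (φ * del t) ^ 2 = 2 * (1 / Real.pi ^ 2) * (φ * del t) ^ 2 := by ring
    rw [this] at hcos
    nlinarith [sq_nonneg (φ * del t)]
  rw [h1]
  have h4 : 2 * (1 / 9) * (2 / 10 * (φ * del t) ^ 2) ≤ 2 * R * (1 - Real.cos (φ * del t)) := by
    gcongr
  have h5 : (del t / 2) ^ 2 ≤ (1 - R) ^ 2 := by gcongr
  have h6 : (1 + |φ|) ^ 2 ≤ 2 + 2 * φ ^ 2 := by nlinarith [sq_nonneg (1 - |φ|), sq_abs φ]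
  have h7 : ((1 + |φ|) * del t / 10) ^ 2 ≤ (2 + 2 * φ ^ 2) * del t ^ 2 / 100 := by
    rw [div_pow, mul_pow]
    norm_num
    gcongr
  nlinarith [sq_nonneg (del t), sq_nonneg (φ * del t)]

lemma norm_pt_le_one (ht : 1 ≤ t) (hc : 0 ≤ c) (φ : ℝ) : ‖pt t (c - φ * I)‖ ≤ 1 := by
  rw [norm_pt]
  exact Real.exp_le_one_iff.2 (by nlinarith [del_pos ht])

lemma norm_geo_pt_le (ht : 1 ≤ t) (hc : 1 ≤ c) (hc2 : c ≤ 2) (hφ : |φ| ≤ Real.pi * √t) :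
    ‖geo (pt t (c - φ * I))‖ ≤ 10 * √t * (1 + |φ|)⁻¹ := by
  have hd := del_pos ht
  refine (norm_geo_le (norm_pt_le_one ht (by linarith) φ) (by positivity)
    (norm_one_sub_pt_ge ht hc hc2 hφ)).trans_eq ?_
  rw [del]
  field_simp

lemma norm_koebe_pt_le (ht : 1 ≤ t) (hc : 1 ≤ c) (hc2 : c ≤ 2) (hφ : |φ| ≤ Real.pi * √t) :
    ‖koebe (pt t (c - φ * I))‖ ≤ 100 * t * (1 + φ ^ 2)⁻¹ := by
  have hd := del_pos ht
  refine (norm_koebe_le (norm_pt_le_one ht (by linarith) φ) (by positivity)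
    (norm_one_sub_pt_ge ht hc hc2 hφ)).trans ?_
  have e : (((1 + |φ|) * del t / 10) ^ 2)⁻¹ = 100 * t * ((1 + |φ|) ^ 2)⁻¹ := by
    have : √t ^ 2 = t := Real.sq_sqrt (by linarith)
    rw [del]
    field_simp
    rw [this]
    ring
  rw [e]
  have : 1 + φ ^ 2 ≤ (1 + |φ|) ^ 2 := by nlinarith [abs_nonneg φ, sq_abs φ]
  gcongr

lemma tendsto_del : Tendsto del atTop (𝓝 0) :=
  tendsto_inv_atTop_zero.comp Real.tendsto_sqrt_atTop

lemma tendsto_pt (k : ℂ) : Tendsto (fun t => pt t k) atTop (𝓝 1) := by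
  have : Tendsto (fun t => exp (-k * (del t : ℂ))) atTop (𝓝 (exp (-k * ((0 : ℝ) : ℂ)))) :=
    (continuous_exp.tendsto _).comp (((continuous_ofReal.tendsto 0).comp tendsto_del).const_mul _)
  simpa [pt] using this

lemma tendsto_sqrt_mul_one_sub_pt (k : ℂ) :
    Tendsto (fun t : ℝ => (√t : ℂ) * (1 - pt t k)) atTop (𝓝 k) := by
  have hd : HasDerivAt (fun d : ℝ => -exp (-k * (d : ℂ))) k 0 := by
    have := ((((hasDerivAt_id (0 : ℝ)).ofReal_comp).const_mul (-k)).cexp).neg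
    exact this.congr_deriv (by simp)
  have h1 := hd.tendsto_slope_zero_right
  have h2 : Tendsto del atTop (𝓝[>] 0) := tendsto_nhdsWithin_iff.2 ⟨tendsto_del, by
    filter_upwards [eventually_ge_atTop 1] with t ht using del_pos ht⟩
  refine (h1.comp h2).congr fun t => ?_
  simp only [Function.comp_apply, del, pt, inv_inv, zero_add, ofReal_zero, mul_zero, exp_zero,
    real_smul]
  ring

lemma tendsto_geo_pt {k : ℂ} (hk : k ≠ 0) :
    Tendsto (fun t : ℝ => geo (pt t k) / √t) atTop (𝓝 k⁻¹) := by
  have := (tendsto_pt k).mul ((tendsto_sqrt_mul_one_sub_pt k).inv₀ hk)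
  rw [one_mul] at this
  refine this.congr fun t => ?_
  rw [geo, mul_inv]
  ring

lemma tendsto_koebe_pt {k : ℂ} (hk : k ≠ 0) :
    Tendsto (fun t : ℝ => koebe (pt t k) / t) atTop (𝓝 (k⁻¹ ^ 2)) := by
  have := (tendsto_pt k).mul (((tendsto_sqrt_mul_one_sub_pt k).inv₀ hk).pow 2)
  rw [one_mul] at this
  refine this.congr' ?_
  filter_upwards [eventually_ge_atTop 1] with t ht
  have e : (t : ℂ) = (√t : ℂ) ^ 2 := by exact_mod_cast (Real.sq_sqrt (by linarith : 0 ≤ t)).symm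
  rw [koebe, e]
  simp only [div_eq_mul_inv, mul_inv, inv_pow, mul_pow]
  ring

end

/-! ### The one-variable transform in the diffusive window -/

noncomputable section

open scoped ENNReal ComplexConjugate

variable {γ t s φ κ : ℝ} {x v : ℂ}

def gaussExp (γ t : ℝ) (x : ℂ) : ℂ := exp (t * (1 - x) ^ 2 / (2 * γ * x))

lemma EE_sqrt_eq (ht : 0 ≤ t) (s : ℝ) (x : ℂ) (v : Circle) : EE (√(2 * t * s)) x v =
    exp (√(2 * t) * (x⁻¹ - 1) * ((√s : ℂ) * v) + √(2 * t) * (1 - x) * conj ((√s : ℂ) * v)) := by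
  rw [EE, Real.sqrt_mul (by positivity), map_mul, conj_ofReal, ← Circle.coe_inv_eq_conj, Circle.coe_inv]
  congr 1
  push_cast
  ring

lemma integral_EE_sqrt (hγ : 0 < γ) (ht : 0 ≤ t) (hx : x ≠ 0) :
    ∫ p : ℝ × Circle, EE (√(2 * t * p.1)) x p.2 ∂nu γ = gaussExp γ t x := by
  have h := gint_one (by positivity : 0 < 4 * γ) (√(2 * t) * (x⁻¹ - 1)) (√(2 * t) * (1 - x))
  rw [gint, ← (measurePreserving_gau hγ).map_eq, integral_map
    (measurePreserving_gau hγ).measurable.aemeasurable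
    (gaussTame_one.mul_cexp _ _).meas.aestronglyMeasurable] at h
  simp only [EE_sqrt_eq ht, gaussExp]
  simp only [one_mul] at h
  rw [h]
  congr 1
  have h2 : ((√(2 * t) : ℝ) : ℂ) ^ 2 = 2 * t := by
    rw [← ofReal_pow, Real.sq_sqrt (by positivity)]
    push_cast
    ring
  have hg : (γ : ℂ) ≠ 0 := by exact_mod_cast hγ.ne'
  have e : (√(2 * t) * (x⁻¹ - 1) * (√(2 * t) * (1 - x)) : ℂ) = (√(2 * t) : ℂ) ^ 2 * ((1 - x) ^ 2 / x) := by
    field_simp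
  rw [e, h2]
  push_cast
  field_simp
  ring

lemma norm_linear_le (ht : 1 ≤ t) (hx : ‖x‖ = rho t) (hv : ‖v‖ = 1) :
    ‖(x⁻¹ - 1) * v + (1 - x) * v⁻¹‖ ≤ 4 * ‖1 - x‖ := by
  have hx0 : x ≠ 0 := norm_pos_iff.1 (hx ▸ rho_pos)
  have e : x⁻¹ - 1 = (1 - x) * x⁻¹ := by field_simp
  refine (norm_add_le _ _).trans ?_
  rw [e, norm_mul, norm_mul, norm_mul, norm_inv, norm_inv, hv, inv_one, hx]
  have h1 : (rho t)⁻¹ ≤ 3 := by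
    rw [rho, ← Real.exp_neg, neg_neg]
    refine (Real.exp_le_exp.2 (del_le_one ht)).trans ?_
    linarith [Real.exp_one_lt_d9]
  nlinarith [norm_nonneg (1 - x), mul_le_mul_of_nonneg_left h1 (norm_nonneg (1 - x))]

lemma norm_EE_sub_le (ht : 1 ≤ t) (hx : ‖x‖ = rho t) (hv : ‖v‖ = 1) {M κ₁ κ₂ : ℝ} (h1 : 0 ≤ κ₁)
    (h1M : κ₁ ≤ M) (h2 : 0 ≤ κ₂) (h2M : κ₂ ≤ M) :
    ‖EE κ₁ x v - EE κ₂ x v‖ ≤ 4 * ‖1 - x‖ * Real.exp (M * (9 * del t)) * |κ₁ - κ₂| := by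
  set A := (x⁻¹ - 1) * v + (1 - x) * v⁻¹ with hA
  have hd : ∀ κ : ℝ, HasDerivAt (fun κ : ℝ => EE κ x v) (EE κ x v * A) κ := by
    intro κ
    have := (((hasDerivAt_id κ).ofReal_comp).mul_const A).cexp
    exact this.congr_deriv (by simp [EE, hA])
  have := (convex_Icc 0 M).norm_image_sub_le_of_norm_hasDerivWithin_le
    (C := 4 * ‖1 - x‖ * Real.exp (M * (9 * del t)))
    (fun κ _ => (hd κ).hasDerivWithinAt) (fun κ hκ => ?_) ⟨h2, h2M⟩ ⟨h1, h1M⟩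
  · simpa using this
  · rw [norm_mul, mul_comm]
    refine mul_le_mul (norm_linear_le ht hx hv) ((norm_EE_le ht hκ.1 hx hv).trans ?_)
      (norm_nonneg _) (by positivity)
    have := del_pos ht
    exact Real.exp_le_exp.2 (mul_le_mul_of_nonneg_right hκ.2 (by positivity))

lemma tau_nonneg (t s : ℝ) : 0 ≤ tau t s := Real.sqrt_nonneg _

lemma abs_tau_sub_le (ht : 1 ≤ t) (hs : 0 ≤ s) :
    |tau t (min s t) - √(2 * t * s)| ≤ 2 * (s * √s) * del t := by
  have ht0 : 0 ≤ t := by linarith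
  have hst : 0 < √t := by positivity
  rw [del, ← div_eq_mul_inv]
  rcases le_total s t with h | h
  · rw [min_eq_left h, tau, mul_comm s, Real.sqrt_mul (by linarith), Real.sqrt_mul (by linarith)]
    have h1 : √(2 * t - s) ≤ √(2 * t) := Real.sqrt_le_sqrt (by linarith)
    have h2 : √t ≤ √(2 * t - s) := Real.sqrt_le_sqrt (by linarith)
    rw [← sub_mul, abs_mul, abs_of_nonneg (Real.sqrt_nonneg s), abs_of_nonpos (by linarith),
      le_div_iff₀ hst]
    have h3 : √(2 * t) ^ 2 = 2 * t := Real.sq_sqrt (by linarith)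
    have h4 : √(2 * t - s) ^ 2 = 2 * t - s := Real.sq_sqrt (by linarith)
    have h5 : (√(2 * t) - √(2 * t - s)) * √t ≤ s := by nlinarith
    nlinarith [Real.sqrt_nonneg s, mul_le_mul_of_nonneg_right h5 (Real.sqrt_nonneg s),
      mul_nonneg hs (Real.sqrt_nonneg s)]
  · rw [min_eq_right h, tau, show t * (2 * t - t) = t ^ 2 by ring, Real.sqrt_sq ht0]
    have h1 : t ≤ √(2 * t * s) := Real.le_sqrt_of_sq_le (by nlinarith)
    rw [abs_of_nonpos (by linarith), le_div_iff₀ hst]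
    have h2 : √(2 * t * s) ≤ 2 * (√t * √s) := by
      rw [Real.sqrt_mul (by linarith), Real.sqrt_mul (by norm_num), mul_assoc]
      gcongr
      rw [Real.sqrt_le_left (by norm_num)]
      norm_num
    have h3 : √t * √t = t := Real.mul_self_sqrt ht0
    calc _ ≤ 2 * (√t * √s) * √t := by gcongr; linarith
      _ = 2 * (t * √s) := by linear_combination 2 * √s * h3
      _ ≤ _ := by gcongr

lemma mul_sqrt_le_exp (hs : 0 ≤ s) : s * √s ≤ 6 * Real.exp √s := by
  have h := Real.pow_div_factorial_le_exp √s (Real.sqrt_nonneg s) 3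
  have h2 : √s * √s = s := Real.mul_self_sqrt hs
  have h3 : √s ^ 3 = s * √s := by linear_combination √s * h2
  rw [h3] at h
  norm_num [Nat.factorial] at h
  linarith

lemma sqrt_le_two_mul (ht : 0 ≤ t) : √(2 * t * s) ≤ 2 * √t * √s := by
  rw [Real.sqrt_mul (by linarith), Real.sqrt_mul (by norm_num)]
  gcongr
  rw [Real.sqrt_le_left (by norm_num)]
  norm_num

lemma norm_EE_tau_sub_le (ht : 1 ≤ t) (hs : 0 ≤ s) (hx : ‖x‖ = rho t) (hv : ‖v‖ = 1) :
    ‖EE (tau t (min s t)) x v - EE (√(2 * t * s)) x v‖ ≤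
      48 * ‖1 - x‖ * del t * Real.exp (19 * √s) := by
  have ht0 : 0 ≤ t := by linarith
  have hτ : tau t (min s t) ≤ 2 * √t * √s :=
    (tau_le (min_le_right s t) (le_min hs ht0)).trans (by gcongr; exact min_le_left _ _)
  refine (norm_EE_sub_le ht hx hv (tau_nonneg _ _) hτ (Real.sqrt_nonneg _)
    (sqrt_le_two_mul ht0)).trans ?_
  have hd := del_pos ht
  have e : 2 * √t * √s * (9 * del t) = 18 * √s := by
    linear_combination 18 * √s * sqrt_mul_del ht
  rw [e]
  calc _ ≤ 4 * ‖1 - x‖ * Real.exp (18 * √s) * (2 * (6 * Real.exp √s) * del t) := by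
        gcongr
        refine (abs_tau_sub_le ht hs).trans ?_
        exact mul_le_mul_of_nonneg_right (mul_le_mul_of_nonneg_left (mul_sqrt_le_exp hs) zero_le_two)
          hd.le
    _ = _ := by
        rw [show (19 : ℝ) * √s = 18 * √s + √s by ring, Real.exp_add]
        ring

lemma norm_psi_sub_le (hγ : 0 < γ) (ht : 1 ≤ t) (hx : ‖x‖ = rho t) : ‖psi γ t x - gaussExp γ t x‖ ≤
    48 * ‖1 - x‖ * del t * ∫ p : ℝ × Circle, Real.exp (19 * √p.1) ∂nu γ := by
  have hx0 : x ≠ 0 := norm_pos_iff.1 (hx ▸ rho_pos)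
  have hi : Integrable (fun p : ℝ × Circle => EE (√(2 * t * p.1)) x p.2) (nu γ) := by
    have h := (gaussTame_one.mul_cexp (√(2 * t) * (x⁻¹ - 1)) (√(2 * t) * (1 - x))).integrable
      (by positivity : 0 < 4 * γ)
    refine ((measurePreserving_gau hγ).integrable_comp_of_integrable h).congr
      (ae_of_all _ fun p => ?_)
    simp only [Function.comp_apply, one_mul, EE_sqrt_eq (by linarith : 0 ≤ t)]
  have hE : Integrable (fun p : ℝ × Circle => EE (tau t (min p.1 t)) x p.2) (nu γ) :=
    integrable_EE hγ ht hx
  rw [← integral_EE_sqrt hγ (by linarith) hx0, psi, ← nu, ← integral_sub hE hi,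
    ← integral_const_mul]
  refine norm_integral_le_of_norm_le ((integrable_prod_exp_sqrt hγ 19).const_mul _) ?_
  filter_upwards [ae_prod_pos γ] with p hp
  exact norm_EE_tau_sub_le ht hp.le hx (Circle.norm_coe _)

lemma norm_gaussExp_pt_le (hγ : 0 < γ) (ht : 1 ≤ t) (hφ : |φ| ≤ Real.pi * √t) :
    ‖gaussExp γ t (pt t (1 - φ * I))‖ ≤ Real.exp (γ⁻¹ * (1 - φ ^ 2 / 5)) := by
  have hd := del_pos ht
  have hd1 := del_le_one ht
  have htd : t * del t ^ 2 = 1 := by rw [pow_two, ← mul_assoc, mul_del ht, sqrt_mul_del ht]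
  have e : (t * (1 - pt t (1 - φ * I)) ^ 2 / (2 * γ * pt t (1 - φ * I)) : ℂ) =
      (t / γ : ℝ) * (cosh ((del t : ℝ) - (φ * del t : ℝ) * I) - 1) := by
    have hg : (γ : ℂ) ≠ 0 := by exact_mod_cast hγ.ne'
    have h1 : pt t (1 - φ * I) = exp (-((del t : ℝ) - (φ * del t : ℝ) * I)) := by
      rw [pt]
      congr 1
      push_cast
      ring
    have h2 : exp ((del t : ℝ) - (φ * del t : ℝ) * I) * exp (-((del t : ℝ) - (φ * del t : ℝ) * I)) = 1 := by
      rw [← exp_add, add_neg_cancel, exp_zero]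
    rw [h1, cosh]
    generalize ((del t : ℝ) - (φ * del t : ℝ) * I : ℂ) = w at *
    have h3 : exp (-w) ≠ 0 := exp_ne_zero _
    push_cast
    field_simp
    linear_combination -t * h2
  rw [gaussExp, e, norm_exp, re_ofReal_mul]
  refine Real.exp_le_exp.2 ?_
  have h4 : (cosh ((del t : ℝ) - (φ * del t : ℝ) * I) - 1).re =
      Real.cosh (del t) * Real.cos (φ * del t) - 1 := by
    rw [sub_re, one_re, cosh_sub, cosh_mul_I, sinh_mul_I]
    rw [← ofReal_cosh, ← ofReal_sinh, ← ofReal_cos, ← ofReal_sin]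
    simp only [sub_re, mul_re, mul_im, ofReal_re, ofReal_im, I_re, I_im]
    ring
  have hcos := Real.cos_le_one_sub_mul_cos_sq (abs_mul_del_le ht hφ)
  have hpi : 1 / 10 ≤ 1 / Real.pi ^ 2 := by
    refine one_div_le_one_div_of_le (by positivity) ?_
    nlinarith [Real.pi_lt_d2, Real.pi_pos]
  have hcos2 : Real.cos (φ * del t) ≤ 1 - (φ * del t) ^ 2 / 5 := by
    have : 2 / Real.pi ^ 2 * (φ * del t) ^ 2 = 2 * (1 / Real.pi ^ 2) * (φ * del t) ^ 2 := by ring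
    rw [this] at hcos
    nlinarith [sq_nonneg (φ * del t)]
  have hch : Real.cosh (del t) ≤ 1 + del t ^ 2 := by
    have h5 := Real.abs_exp_sub_one_sub_id_le (x := del t) (by rwa [abs_of_pos hd])
    have h6 := Real.abs_exp_sub_one_sub_id_le (x := -del t) (by rwa [abs_neg, abs_of_pos hd])
    rw [Real.cosh_eq]
    have := (abs_le.1 h5).2
    have := (abs_le.1 h6).2
    nlinarith
  have hch1 := Real.one_le_cosh (del t)
  have hc1 := Real.cos_le_one (φ * del t)
  rw [h4]
  have h7 : Real.cosh (del t) * Real.cos (φ * del t) - 1 ≤ del t ^ 2 * (1 - φ ^ 2 / 5) := by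
    nlinarith
  calc t / γ * (Real.cosh (del t) * Real.cos (φ * del t) - 1)
      ≤ t / γ * (del t ^ 2 * (1 - φ ^ 2 / 5)) := by gcongr
    _ = γ⁻¹ * (t * del t ^ 2) * (1 - φ ^ 2 / 5) := by ring
    _ = _ := by rw [htd, mul_one]

lemma exists_norm_psi_pt_le (hγ : 0 < γ) : ∃ C, 0 ≤ C ∧ ∀ t φ : ℝ, 1 ≤ t → |φ| ≤ Real.pi * √t →
    ‖psi γ t (pt t (1 - φ * I))‖ ≤ C * (1 + |φ|)⁻¹ := by
  set J := ∫ p : ℝ × Circle, Real.exp (19 * √p.1) ∂nu γ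
  have hJ : 0 ≤ J := integral_nonneg fun _ => (Real.exp_pos _).le
  refine ⟨48 * 2 * 5 * J + Real.exp γ⁻¹ * (2 + 5 * γ), by positivity, fun t φ ht hφ => ?_⟩
  have h1 := norm_psi_sub_le hγ ht (norm_pt_one t φ)
  have h2 := norm_gaussExp_pt_le hγ ht hφ
  have h3 : ‖1 - pt t (1 - φ * I)‖ ≤ 2 := by
    refine (norm_sub_le _ _).trans ?_
    rw [norm_pt_one, norm_one]
    linarith [rho_lt_one ht]
  have h4 := sqrt_inv_le ht hφ
  have h5 : ‖psi γ t (pt t (1 - φ * I))‖ ≤ 48 * 2 * (5 / (1 + |φ|)) * J +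
      Real.exp (γ⁻¹ * (1 - φ ^ 2 / 5)) := by
    have h6 := norm_sub_norm_le (psi γ t (pt t (1 - φ * I))) (gaussExp γ t (pt t (1 - φ * I)))
    have h7 : 48 * ‖1 - pt t (1 - φ * I)‖ * del t * J ≤ 48 * 2 * (5 / (1 + |φ|)) * J := by
      have := del_pos ht
      gcongr
    change _ ≤ 48 * ‖1 - pt t (1 - φ * I)‖ * del t * J at h1
    linarith
  have h8 : Real.exp (γ⁻¹ * (1 - φ ^ 2 / 5)) ≤ Real.exp γ⁻¹ * (2 + 5 * γ) * (1 + |φ|)⁻¹ := by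
    rw [mul_sub, mul_one, sub_eq_add_neg, Real.exp_add, mul_assoc]
    gcongr
    rw [Real.exp_neg, ← div_eq_mul_inv, inv_le_comm₀ (Real.exp_pos _) (by positivity), inv_div,
      div_le_iff₀ (by positivity)]
    have h9 := Real.add_one_le_exp (γ⁻¹ * (φ ^ 2 / 5))
    have h10 : (γ⁻¹ * (φ ^ 2 / 5) + 1) * (2 + 5 * γ) = 2 + 5 * γ + 2 * (γ⁻¹ * (φ ^ 2 / 5)) + φ ^ 2 := by
      field_simp
      ring
    have h11 : 0 ≤ γ⁻¹ * (φ ^ 2 / 5) := by positivity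
    have h12 := mul_le_mul_of_nonneg_right h9 (by positivity : 0 ≤ 2 + 5 * γ)
    nlinarith [sq_nonneg (|φ| - 1), sq_abs φ]
  refine (h5.trans (add_le_add_right h8 _)).trans_eq ?_
  ring

lemma tendsto_gaussExp_pt (γ : ℝ) (k : ℂ) :
    Tendsto (fun t : ℝ => gaussExp γ t (pt t k)) atTop (𝓝 (exp (k ^ 2 / (2 * γ)))) := by
  refine (continuous_exp.tendsto _).comp ?_
  have h := (((tendsto_sqrt_mul_one_sub_pt k).pow 2).div (tendsto_pt k) one_ne_zero).div_const (2 * γ : ℂ)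
  rw [div_one] at h
  refine h.congr' ?_
  filter_upwards [eventually_ge_atTop 1] with t ht
  have e : (t : ℂ) = (√t : ℂ) ^ 2 := by exact_mod_cast (Real.sq_sqrt (by linarith : 0 ≤ t)).symm
  simp only [Pi.div_apply]
  conv_rhs => rw [e]
  rw [mul_pow, div_div, mul_comm (pt t k)]

lemma tendsto_psi_pt (hγ : 0 < γ) (φ : ℝ) : Tendsto (fun t : ℝ => psi γ t (pt t (1 - φ * I))) atTop
    (𝓝 (exp ((1 - φ * I) ^ 2 / (2 * γ)))) := by
  refine tendsto_of_tendsto_of_dist (tendsto_gaussExp_pt γ _) ?_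
  set J := ∫ p : ℝ × Circle, Real.exp (19 * √p.1) ∂nu γ
  have hJ : 0 ≤ J := integral_nonneg fun _ => (Real.exp_pos _).le
  refine squeeze_zero' (g := fun t => 48 * 2 * del t * J) (Eventually.of_forall fun t => dist_nonneg) ?_ ?_
  · filter_upwards [eventually_ge_atTop 1] with t ht
    rw [dist_comm, dist_eq_norm]
    refine (norm_psi_sub_le hγ ht (norm_pt_one t φ)).trans ?_
    have h3 : ‖1 - pt t (1 - φ * I)‖ ≤ 2 := by
      refine (norm_sub_le _ _).trans ?_
      rw [norm_pt_one, norm_one]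
      linarith [rho_lt_one ht]
    have := del_pos ht
    change _ ≤ 48 * 2 * del t * J
    gcongr
  · simpa using (tendsto_del.const_mul (48 * 2)).mul_const J

end

/-! ### Rescaled angles and dominated convergence -/

noncomputable section

open scoped ENNReal

variable {γ t r : ℝ}

/-- The map `e` transports the restriction of `ν` to `S`, rescaled by `c`, to `μ`. -/
structure IsWindow {X Y : Type*} [MeasurableSpace X] [MeasurableSpace Y] (e : X → Y) (c : ℝ) (S : Set X)
    (ν : Measure X) (μ : Measure Y) : Prop where
  pos : 0 < c
  meas : MeasurableSet S
  map : MeasurePreserving e (ENNReal.ofReal c • ν.restrict S) μ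

section

variable {X Y X' Y' : Type*} [MeasurableSpace X] [MeasurableSpace Y] [MeasurableSpace X']
  [MeasurableSpace Y'] {e : X → Y} {c : ℝ} {S : Set X} {ν : Measure X} {μ : Measure Y}
  {e' : X' → Y'} {c' : ℝ} {S' : Set X'} {ν' : Measure X'} {μ' : Measure Y'}

lemma IsWindow.refl (ν : Measure X) : IsWindow id 1 univ ν ν :=
  ⟨one_pos, MeasurableSet.univ, by
    rw [ENNReal.ofReal_one, one_smul, Measure.restrict_univ]; exact .id ν⟩

lemma IsWindow.prod [SFinite ν] [SFinite ν'] [SFinite μ] [SFinite μ'] (h : IsWindow e c S ν μ)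
    (h' : IsWindow e' c' S' ν' μ') :
    IsWindow (Prod.map e e') (c * c') (S ×ˢ S') (ν.prod ν') (μ.prod μ') := by
  refine ⟨mul_pos h.pos h'.pos, h.meas.prod h'.meas, ?_⟩
  have := h.map.prod h'.map
  rwa [Measure.prod_smul_left, Measure.prod_smul_right, smul_smul,
    Measure.prod_restrict, ← ENNReal.ofReal_mul h.pos.le] at this

lemma IsWindow.integrable (h : IsWindow e c S ν μ) {F : Y → ℂ} (hF : AEStronglyMeasurable F μ) {B : X → ℝ}
    (hB : Integrable B ν) (hb : ∀ᵐ x ∂ν, x ∈ S → c * ‖F (e x)‖ ≤ B x) : Integrable F μ := by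
  rw [← h.map.integrable_comp hF]
  refine Integrable.smul_measure ?_ ENNReal.ofReal_ne_top
  have hm : AEStronglyMeasurable (F ∘ e) (ν.restrict S) :=
    (hF.comp_measurePreserving h.map).mono_ac
      (Measure.absolutelyContinuous_smul (ENNReal.ofReal_pos.2 h.pos).ne')
  refine (hB.integrableOn.const_mul c⁻¹).mono' hm ?_
  filter_upwards [ae_restrict_of_ae hb, ae_restrict_mem h.meas] with x hx hS
  rw [Function.comp_apply, ← div_eq_inv_mul, le_div_iff₀' h.pos]
  exact hx hS

lemma IsWindow.integral_eq (h : IsWindow e c S ν μ) {F : Y → ℂ} (hF : AEStronglyMeasurable F μ) :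
    ∫ y, F y ∂μ = ∫ x, S.indicator (fun x => (c : ℂ) * F (e x)) x ∂ν := by
  conv_lhs => rw [← h.map.map_eq]
  rw [integral_map h.map.measurable.aemeasurable (by rwa [h.map.map_eq]), integral_smul_measure,
    ENNReal.toReal_ofReal h.pos.le, integral_indicator h.meas, integral_const_mul, real_smul]

end

lemma tendsto_integral_window {X Y : Type*} [MeasurableSpace X] [MeasurableSpace Y] {e : ℝ → X → Y}
    {c : ℝ → ℝ} {S : ℝ → Set X} {ν : Measure X} {μ : Measure Y}
    (h : ∀ t, 1 ≤ t → IsWindow (e t) (c t) (S t) ν μ) {F : ℝ → Y → ℂ}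
    (hF : ∀ t, 1 ≤ t → AEStronglyMeasurable (F t) μ) {B : X → ℝ} (hB : Integrable B ν)
    (hb : ∀ t, 1 ≤ t → ∀ᵐ x ∂ν, x ∈ S t → c t * ‖F t (e t x)‖ ≤ B x)
    (hS : ∀ᵐ x ∂ν, ∀ᶠ t in atTop, x ∈ S t) {ℓ : X → ℂ}
    (hl : ∀ᵐ x ∂ν, Tendsto (fun t => (c t : ℂ) * F t (e t x)) atTop (𝓝 (ℓ x))) :
    Tendsto (fun t => ∫ y, F t y ∂μ) atTop (𝓝 (∫ x, ℓ x ∂ν)) := by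
  have key : Tendsto (fun t => ∫ x, (S t).indicator (fun x => (c t : ℂ) * F t (e t x)) x ∂ν) atTop
      (𝓝 (∫ x, ℓ x ∂ν)) := by
    refine tendsto_integral_filter_of_dominated_convergence (fun x => |B x|) ?_ ?_ hB.abs ?_
    · filter_upwards [eventually_ge_atTop 1] with t ht
      have hw := h t ht
      rw [aestronglyMeasurable_indicator_iff hw.meas]
      have hm : AEStronglyMeasurable (F t ∘ e t) (ν.restrict (S t)) :=
        ((hF t ht).comp_measurePreserving hw.map).mono_ac
          (Measure.absolutelyContinuous_smul (ENNReal.ofReal_pos.2 hw.pos).ne')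
      exact hm.const_mul _
    · filter_upwards [eventually_ge_atTop 1] with t ht
      filter_upwards [hb t ht] with x hx
      by_cases hxS : x ∈ S t
      · rw [indicator_of_mem hxS, norm_mul, norm_real, Real.norm_of_nonneg (h t ht).pos.le]
        exact (hx hxS).trans (le_abs_self _)
      · rw [indicator_of_notMem hxS, norm_zero]
        exact abs_nonneg _
    · filter_upwards [hS, hl] with x h1 h2
      refine h2.congr' ?_
      filter_upwards [h1] with t ht
      rw [indicator_of_mem ht]
  refine key.congr' ?_
  filter_upwards [eventually_ge_atTop 1] with t ht
  exact ((h t ht).integral_eq (hF t ht)).symm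

def angle (t φ : ℝ) : Circle := Circle.exp (φ * del t)

def arc (t : ℝ) : Set ℝ := Ioc (-(Real.pi * √t)) (Real.pi * √t)

lemma abs_le_of_mem_arc {φ : ℝ} (h : φ ∈ arc t) : |φ| ≤ Real.pi * √t := abs_le.2 ⟨h.1.le, h.2⟩

lemma eventually_mem_arc (φ : ℝ) : ∀ᶠ t in atTop, φ ∈ arc t := by
  have h : Tendsto (fun t : ℝ => Real.pi * √t) atTop atTop :=
    Real.tendsto_sqrt_atTop.const_mul_atTop Real.pi_pos
  filter_upwards [h.eventually_gt_atTop |φ|] with t ht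
  exact ⟨(abs_lt.1 ht).1, (abs_lt.1 ht).2.le⟩

lemma isWindow_angle (ht : 1 ≤ t) :
    IsWindow (angle t) (2 * Real.pi * √t)⁻¹ (arc t) volume (volume : Measure Circle) := by
  have hd := del_pos ht
  have hs : 0 < √t := by positivity
  refine ⟨by positivity, measurableSet_Ioc, ?_⟩
  have h1 : MeasurePreserving (fun φ : ℝ => φ * del t) volume (ENNReal.ofReal (√t) • volume) := by
    refine ⟨by fun_prop, ?_⟩
    rw [Real.map_volume_mul_right hd.ne', del, inv_inv, abs_of_pos hs]
  have h2 := (h1.restrict_preimage (s := Ioc (-Real.pi) Real.pi) measurableSet_Ioc).smul_measure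
    (ENNReal.ofReal (2 * Real.pi * √t)⁻¹)
  have e : (fun φ : ℝ => φ * del t) ⁻¹' Ioc (-Real.pi) Real.pi = arc t := by
    ext φ
    simp only [mem_preimage, mem_Ioc, arc, del, ← div_eq_mul_inv, lt_div_iff₀ hs, div_le_iff₀ hs, neg_mul]
  rw [e, Measure.restrict_smul, smul_smul, ← ENNReal.ofReal_mul (by positivity)] at h2
  have e2 : (2 * Real.pi * √t)⁻¹ * √t = (2 * Real.pi)⁻¹ := by field_simp
  rw [e2] at h2
  exact measurePreserving_circle_exp.comp h2

lemma integral_exp_sq_div (hγ : 0 < γ) : ∫ φ : ℝ, ((2 * Real.pi)⁻¹ : ℂ) *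
    (((1 - φ * I : ℂ)⁻¹) ^ 2 * exp ((1 - φ * I) ^ 2 / (2 * γ))) = ((1 / √(2 * Real.pi * γ) : ℝ) : ℂ) := by
  have h := integral_inv_sq_mul_exp (c := 1) (lam := (2 * γ)⁻¹) le_rfl (by positivity)
  rw [integral_const_mul]
  have e : ∀ φ : ℝ, exp ((1 - φ * I : ℂ) ^ 2 / (2 * γ)) =
      exp (((2 * γ)⁻¹ : ℝ) * ((1 : ℝ) - φ * I) ^ 2) := by
    intro φ
    congr 1
    push_cast
    ring
  simp only [e]
  simp only [ofReal_one] at h ⊢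
  rw [h]
  have h2 : (2 * Real.pi)⁻¹ * (2 * √(Real.pi * (2 * γ)⁻¹)) = 1 / √(2 * Real.pi * γ) := by
    have h3 : √(2 * Real.pi * γ) * √(Real.pi * (2 * γ)⁻¹) = Real.pi := by
      rw [← Real.sqrt_mul (by positivity), show 2 * Real.pi * γ * (Real.pi * (2 * γ)⁻¹) = Real.pi ^ 2 by
        field_simp, Real.sqrt_sq Real.pi_pos.le]
    have h4 : 0 < √(2 * Real.pi * γ) := by positivity
    rw [eq_div_iff h4.ne']
    have h5 : (2 * Real.pi)⁻¹ * (2 * √(Real.pi * (2 * γ)⁻¹)) * √(2 * Real.pi * γ) =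
        Real.pi⁻¹ * (√(2 * Real.pi * γ) * √(Real.pi * (2 * γ)⁻¹)) := by ring
    rw [h5, h3, inv_mul_cancel₀ Real.pi_pos.ne']
  rw [← h2]
  push_cast
  rfl

lemma continuous_rho_mul (t : ℝ) : Continuous fun a : Circle => (rho t * a : ℂ) := by fun_prop

lemma tendsto_q1 (hγ : 0 < γ) (hr0 : 0 < r) (hr : r < 1 / (4 * γ + 4)) :
    Tendsto (fun t : ℝ => q1 γ r t / (√t : ℂ)) atTop (𝓝 ((1 / √(2 * Real.pi * γ) : ℝ) : ℂ)) := by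
  obtain ⟨C, hC0, hC⟩ := exists_norm_psi_pt_le hγ
  rw [← integral_exp_sq_div hγ]
  have hk : ∀ φ : ℝ, (1 - φ * I : ℂ) ≠ 0 := fun φ => by
    simpa using sub_mul_I_ne one_pos φ
  have key := tendsto_integral_window (fun t ht => isWindow_angle ht)
    (F := fun t a => koebe (rho t * a) * psi γ t (rho t * a) / (√t : ℂ))
    (B := fun φ : ℝ => 100 * C * (1 + φ ^ 2)⁻¹) (ℓ := fun φ : ℝ => ((2 * Real.pi)⁻¹ : ℂ) *
      (((1 - φ * I : ℂ)⁻¹) ^ 2 * exp ((1 - φ * I) ^ 2 / (2 * γ)))) (fun t ht => ?_)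
    (integrable_inv_one_add_sq.const_mul _) (fun t ht => ?_)
    (ae_of_all _ eventually_mem_arc) (ae_of_all _ fun φ => ?_)
  · refine key.congr' ?_
    filter_upwards [eventually_ge_atTop 1] with t ht
    rw [q1_eq hγ ht hr0 hr, integral_div]
  · exact (((continuous_circle_koebe (continuous_rho_mul t) fun a => by
      rw [norm_rho_mul]; exact rho_lt_one ht).mul (continuous_psi hγ ht (continuous_rho_mul t)
        norm_rho_mul)).div_const _).aestronglyMeasurable
  · refine ae_of_all _ fun φ hφ => ?_
    have hφ' := abs_le_of_mem_arc hφ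
    have ht0 : 0 < √t := by positivity
    simp only [angle]
    rw [rho_mul_exp, norm_div, norm_mul, norm_real, Real.norm_of_nonneg ht0.le]
    have h1 := norm_koebe_pt_le ht le_rfl one_le_two hφ'
    rw [ofReal_one] at h1
    have h2 := hC t φ ht hφ'
    have h3 : (1 + |φ|)⁻¹ ≤ 1 := inv_le_one_of_one_le₀ (by linarith [abs_nonneg φ])
    have h4 : √t * √t = t := Real.mul_self_sqrt (by linarith)
    calc _ ≤ (2 * Real.pi * √t)⁻¹ * (100 * t * (1 + φ ^ 2)⁻¹ * (C * 1) / √t) := by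
          gcongr
          exact h2.trans (by gcongr)
      _ = (2 * Real.pi)⁻¹ * (100 * C * (1 + φ ^ 2)⁻¹) * (t / (√t * √t)) := by
          field_simp
      _ ≤ _ := by
          rw [h4, div_self (by linarith), mul_one]
          refine mul_le_of_le_one_left (by positivity) (inv_le_one_of_one_le₀ ?_)
          linarith [Real.pi_gt_three]
  · have h := ((tendsto_koebe_pt (hk φ)).mul (tendsto_psi_pt hγ φ)).const_mul ((2 * Real.pi)⁻¹ : ℂ)
    refine h.congr' ?_
    filter_upwards [eventually_ge_atTop 1] with t ht
    simp only [angle]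
    rw [rho_mul_exp]
    have e : (t : ℂ) = (√t : ℂ) * √t := by exact_mod_cast (Real.mul_self_sqrt (by linarith : 0 ≤ t)).symm
    push_cast
    conv_lhs => rw [e]
    simp only [div_eq_mul_inv, mul_inv]
    ring

end

/-! ### The regular part of the variance -/

noncomputable section

open scoped ENNReal

variable {γ t r : ℝ}

def shearHomeo : Circle × Circle ≃ₜ Circle × Circle where
  toFun p := (p.1, p.2 / p.1)
  invFun p := (p.1, p.1 * p.2)
  left_inv p := by simp
  right_inv p := by simp
  continuous_toFun := by simp only [div_eq_mul_inv]; fun_prop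
  continuous_invFun := by fun_prop

instance : (volume : Measure (Circle × Circle)).IsHaarMeasure :=
  inferInstanceAs (((volume : Measure Circle).prod (volume : Measure Circle)).IsHaarMeasure)

lemma measurePreserving_shear : MeasurePreserving shearHomeo
    (volume : Measure (Circle × Circle)) volume := by
  let h : Circle × Circle →* Circle × Circle :=
    { toFun := shearHomeo, map_one' := by simp [shearHomeo],
      map_mul' := fun p q => by simp [shearHomeo, mul_div_mul_comm] }
  exact MonoidHom.measurePreserving (f := h) shearHomeo.continuous shearHomeo.surjective
    (by simp only [measure_univ])

def flipHomeo : Circle × Circle ≃ₜ Circle × Circle where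
  toFun p := (p.2 / p.1, p.2)
  invFun p := (p.2 / p.1, p.2)
  left_inv p := by simp
  right_inv p := by simp
  continuous_toFun := by simp only [div_eq_mul_inv]; fun_prop
  continuous_invFun := by simp only [div_eq_mul_inv]; fun_prop

lemma measurePreserving_flip : MeasurePreserving flipHomeo
    (volume : Measure (Circle × Circle)) volume := by
  let h : Circle × Circle →* Circle × Circle :=
    { toFun := flipHomeo, map_one' := by simp [flipHomeo],
      map_mul' := fun p q => by simp [flipHomeo, mul_div_mul_comm] }
  exact MonoidHom.measurePreserving (f := h) flipHomeo.continuous flipHomeo.surjective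
    (by simp only [measure_univ])

lemma rho_mul_div (t : ℝ) (p : Circle × Circle) :
    (rho t * ((p.2 / p.1 : Circle) : ℂ)) = rho t ^ 2 * p.2 / (rho t * p.1) := by
  have h1 : (rho t : ℂ) ≠ 0 := by exact_mod_cast rho_pos.ne'
  have h2 := p.1.coe_ne_zero
  rw [Circle.coe_div]
  field_simp

lemma koebe_mul_koebe {x y : ℂ} (hx : 1 - x ≠ 0) (hy : 1 - y ≠ 0) (hxy : 1 - x * y ≠ 0) :
    koebe x * koebe y = koebe (x * y) * (1 + geo x + geo y) ^ 2 := by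
  unfold koebe geo
  field_simp
  ring

def psiPair (γ t : ℝ) (p : Circle × Circle) : ℂ :=
  psi γ t (rho t * p.1) * psi γ t (rho t ^ 2 * p.2 / (rho t * p.1))

lemma continuous_u_div (t : ℝ) :
    Continuous fun p : Circle × Circle => (rho t ^ 2 * p.2 / (rho t * p.1) : ℂ) := by
  have h0 : ∀ p : Circle × Circle, (rho t * p.1 : ℂ) ≠ 0 := fun p =>
    mul_ne_zero (by exact_mod_cast rho_pos.ne') p.1.coe_ne_zero
  fun_prop (disch := assumption)

lemma continuous_psiPair (hγ : 0 < γ) (ht : 1 ≤ t) : Continuous (psiPair γ t) :=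
  (continuous_psi hγ ht (by fun_prop) fun p : Circle × Circle => norm_rho_mul p.1).mul
    (continuous_psi hγ ht (continuous_u_div t) fun p => norm_u_div p.1 p.2)

lemma psiPair_flip (γ t : ℝ) (p : Circle × Circle) : psiPair γ t (flipHomeo p) = psiPair γ t p := by
  have h1 : (rho t : ℂ) ≠ 0 := by exact_mod_cast rho_pos.ne'
  have h2 := p.1.coe_ne_zero
  have h3 := p.2.coe_ne_zero
  simp only [psiPair, flipHomeo, Homeomorph.homeomorph_mk_coe, Equiv.coe_fn_mk]
  rw [rho_mul_div, mul_comm]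
  congr 2
  field_simp

def sideKernel (x u : ℂ) : ℂ := koebe u * (1 + 4 * geo x)

lemma continuous_sideKernel (ht : 1 ≤ t) : Continuous fun p : Circle × Circle =>
    sideKernel (rho t * p.1) (rho t ^ 2 * p.2) := by
  have h1 : ∀ p : Circle × Circle, ‖(rho t * p.1 : ℂ)‖ < 1 := fun p => by
    rw [norm_rho_mul]; exact rho_lt_one ht
  have h2 : ∀ p : Circle × Circle, ‖(rho t ^ 2 * p.2 : ℂ)‖ < 1 := fun p => by
    rw [norm_rho_sq_mul]; exact rho_sq_lt_one ht
  unfold sideKernel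
  exact (continuous_circle_koebe (by fun_prop) h2).mul
    (continuous_const.add (continuous_const.mul (continuous_circle_geo (by fun_prop) h1)))

lemma two_mul_main_sub_sq (hγ : 0 < γ) (ht : 1 ≤ t) :
    2 * (∫ p : Circle × Circle, mainKernel (rho t * p.1) (rho t ^ 2 * p.2) * psiPair γ t p) -
      (∫ a : Circle, koebe (rho t * a) * psi γ t (rho t * a)) ^ 2 =
    -∫ p : Circle × Circle, sideKernel (rho t * p.1) (rho t ^ 2 * p.2) * psiPair γ t p := by
  have hr := rho_lt_one ht
  have hr2 := rho_sq_lt_one ht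
  have cP := continuous_psiPair hγ ht
  have i1 : Integrable (fun p : Circle × Circle =>
      2 * (mainKernel (rho t * p.1) (rho t ^ 2 * p.2) * psiPair γ t p)) volume :=
    (integrable_of_continuous _ ((continuous_mainKernel ht).mul cP)).const_mul 2
  have i2 : Integrable (fun p : Circle × Circle =>
      sideKernel (rho t * p.1) (rho t ^ 2 * p.2) * psiPair γ t p) volume :=
    integrable_of_continuous _ ((continuous_sideKernel ht).mul cP)
  have ck : Continuous fun a : Circle => koebe (rho t * a) * psi γ t (rho t * a) :=
    (continuous_circle_koebe (continuous_rho_mul t) fun a => by rwa [norm_rho_mul]).mul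
      (continuous_psi hγ ht (continuous_rho_mul t) norm_rho_mul)
  set Q : Circle × Circle → ℂ := fun p => koebe (rho t * p.1) * psi γ t (rho t * p.1) *
      (koebe (rho t * p.2) * psi γ t (rho t * p.2)) with hQ
  have cQ : Continuous Q := (ck.comp continuous_fst).mul (ck.comp continuous_snd)
  have e1 : (∫ a : Circle, koebe (rho t * a) * psi γ t (rho t * a)) ^ 2 =
      ∫ p, Q (shearHomeo p) := by
    rw [measurePreserving_shear.integral_comp shearHomeo.measurableEmbedding, pow_two]
    exact (integral_prod_mul _ _).symm
  have i3 : Integrable (fun p => Q (shearHomeo p)) volume :=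
    integrable_of_continuous _ (cQ.comp shearHomeo.continuous)
  set H : Circle × Circle → ℂ := fun p =>
    2 * (mainKernel (rho t * p.1) (rho t ^ 2 * p.2) * psiPair γ t p) - Q (shearHomeo p) +
      sideKernel (rho t * p.1) (rho t ^ 2 * p.2) * psiPair γ t p with hH
  have hval : ∀ p, H p = koebe (rho t ^ 2 * p.2) * psiPair γ t p *
      (geo (rho t * p.1) ^ 2 - geo (rho t ^ 2 * p.2 / (rho t * p.1)) ^ 2 +
        2 * geo (rho t * p.1) - 2 * geo (rho t ^ 2 * p.2 / (rho t * p.1))) := by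
    intro p
    have hx0 : (rho t * p.1 : ℂ) ≠ 0 := mul_ne_zero (by exact_mod_cast rho_pos.ne') p.1.coe_ne_zero
    have hx := norm_rho_mul (t := t) p.1
    have hu := norm_rho_sq_mul (t := t) p.2
    have hy := norm_u_div (t := t) p.1 p.2
    simp only [hH, hQ, shearHomeo, Homeomorph.homeomorph_mk_coe, Equiv.coe_fn_mk, rho_mul_div, psiPair,
      mainKernel, sideKernel]
    generalize (rho t * p.1 : ℂ) = x at *
    generalize (rho t ^ 2 * p.2 : ℂ) = u at *
    have hk := koebe_mul_koebe (one_sub_ne (hx ▸ hr)) (one_sub_ne (hy ▸ hr)) (y := u / x) (x := x) (by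
      rw [mul_div_cancel₀ _ hx0]; exact one_sub_ne (hu ▸ hr2))
    rw [mul_div_cancel₀ _ hx0] at hk
    linear_combination (-psi γ t x * psi γ t (u / x)) * hk
  have hanti : ∀ p, H (flipHomeo p) = -H p := by
    intro p
    have e : (rho t ^ 2 * p.2 / (rho t ^ 2 * p.2 / (rho t * p.1)) : ℂ) = rho t * p.1 := by
      have h1 : (rho t : ℂ) ≠ 0 := by exact_mod_cast rho_pos.ne'
      have h2 := p.1.coe_ne_zero
      have h3 := p.2.coe_ne_zero
      field_simp
    rw [hval, hval, psiPair_flip]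
    simp only [flipHomeo, Homeomorph.homeomorph_mk_coe, Equiv.coe_fn_mk, rho_mul_div, e]
    ring
  have hzero : ∫ p, H p = 0 := by
    have h1 := measurePreserving_flip.integral_comp flipHomeo.measurableEmbedding H
    simp only [hanti] at h1
    rw [integral_neg] at h1
    linear_combination (-1 / 2) * h1
  have hsum : ∫ p, H p = 2 * (∫ p : Circle × Circle, mainKernel (rho t * p.1) (rho t ^ 2 * p.2) *
      psiPair γ t p) - (∫ p, Q (shearHomeo p)) +
      ∫ p : Circle × Circle, sideKernel (rho t * p.1) (rho t ^ 2 * p.2) * psiPair γ t p := by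
    rw [← integral_const_mul]
    exact (integral_add (i1.sub i3) i2).trans (congrArg (· + _) (integral_sub i1 i3))
  rw [e1]
  linear_combination hzero - hsum

def zetaOf (p : ℝ × ℝ) : ℂ := 1 - p.1 * I

def sigmaOf (p : ℝ × ℝ) : ℂ := 2 - p.2 * I

def omegaOf (p : ℝ × ℝ) : ℂ := 1 - (p.2 - p.1 : ℝ) * I

lemma zetaOf_ne (p : ℝ × ℝ) : zetaOf p ≠ 0 := by simpa [zetaOf] using sub_mul_I_ne one_pos p.1

lemma omegaOf_ne (p : ℝ × ℝ) : omegaOf p ≠ 0 := by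
  have := sub_mul_I_ne one_pos (p.2 - p.1)
  rwa [ofReal_one] at this

lemma sigmaOf_ne (p : ℝ × ℝ) : sigmaOf p ≠ 0 := by
  have := sub_mul_I_ne two_pos p.2
  rwa [ofReal_ofNat] at this

lemma sigmaOf_sub_zetaOf (p : ℝ × ℝ) : sigmaOf p - zetaOf p = omegaOf p := by
  simp only [sigmaOf, zetaOf, omegaOf]
  push_cast
  ring

def angle2 (t : ℝ) : ℝ × ℝ → Circle × Circle := Prod.map (angle t) (angle t)

lemma rho_mul_angle2 (t : ℝ) (p : ℝ × ℝ) : (rho t * (angle2 t p).1 : ℂ) = pt t (zetaOf p) :=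
  rho_mul_exp t p.1

lemma rho_sq_mul_angle2 (t : ℝ) (p : ℝ × ℝ) : (rho t ^ 2 * (angle2 t p).2 : ℂ) = pt t (sigmaOf p) :=
  rho_sq_mul_exp t p.2

lemma isWindow_angle2 (ht : 1 ≤ t) : IsWindow (angle2 t) ((2 * Real.pi)⁻¹ ^ 2 * t⁻¹) (arc t ×ˢ arc t)
    volume (volume : Measure (Circle × Circle)) := by
  have := (isWindow_angle ht).prod (isWindow_angle ht)
  have h4 : √t * √t = t := Real.mul_self_sqrt (by linarith)
  have e : (2 * Real.pi * √t)⁻¹ * (2 * Real.pi * √t)⁻¹ = (2 * Real.pi)⁻¹ ^ 2 * t⁻¹ := by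
    have h5 : t⁻¹ = (√t)⁻¹ * (√t)⁻¹ := by rw [← mul_inv, h4]
    rw [h5, mul_inv]
    ring
  rwa [e] at this

lemma integrable_inv_prod : Integrable (fun p : ℝ × ℝ => (1 + p.1 ^ 2)⁻¹ * (1 + p.2 ^ 2)⁻¹) volume :=
  integrable_inv_one_add_sq.mul_prod integrable_inv_one_add_sq

lemma eventually_mem_arc_prod (p : ℝ × ℝ) : ∀ᶠ t in atTop, p ∈ arc t ×ˢ arc t :=
  (eventually_mem_arc p.1).and (eventually_mem_arc p.2)

def sideLimit (γ : ℝ) (p : ℝ × ℝ) : ℂ := (2 * (Real.pi : ℂ))⁻¹ ^ 2 *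
  ((sigmaOf p)⁻¹ ^ 2 * (4 * (zetaOf p)⁻¹) *
    (exp (zetaOf p ^ 2 / (2 * γ)) * exp (omegaOf p ^ 2 / (2 * γ))))

lemma tendsto_side (hγ : 0 < γ) :
    Tendsto (fun t : ℝ => (∫ p : Circle × Circle,
      sideKernel (rho t * p.1) (rho t ^ 2 * p.2) * psiPair γ t p) / (√t : ℂ)) atTop
      (𝓝 (∫ p, sideLimit γ p)) := by
  obtain ⟨C, hC0, hC⟩ := exists_norm_psi_pt_le hγ
  set C' := ∫ s, Real.exp (18 * √s) ∂expo γ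
  have hC' : 0 ≤ C' := integral_nonneg fun _ => (Real.exp_pos _).le
  have key := tendsto_integral_window (fun t ht => isWindow_angle2 ht)
    (F := fun t p => sideKernel (rho t * p.1) (rho t ^ 2 * p.2) * psiPair γ t p / (√t : ℂ))
    (B := fun p : ℝ × ℝ => 100 * 45 * C * C' * ((1 + p.1 ^ 2)⁻¹ * (1 + p.2 ^ 2)⁻¹))
    (ℓ := sideLimit γ) (fun t ht => ?_) (integrable_inv_prod.const_mul _) (fun t ht => ?_)
    (ae_of_all _ eventually_mem_arc_prod) (ae_of_all _ fun p => ?_)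
  · refine key.congr fun t => ?_
    rw [integral_div]
  · exact (((continuous_sideKernel ht).mul (continuous_psiPair hγ ht)).div_const _).aestronglyMeasurable
  · refine ae_of_all _ fun p hp => ?_
    have h1' := abs_le_of_mem_arc hp.1
    have h2' := abs_le_of_mem_arc hp.2
    have ht0 : 0 < √t := by positivity
    have h4 : √t * √t = t := Real.mul_self_sqrt (by linarith)
    have hn := norm_u_div (t := t) (angle2 t p).1 (angle2 t p).2
    rw [psiPair, rho_mul_angle2, rho_sq_mul_angle2] at *
    have k1 : ‖koebe (pt t (sigmaOf p))‖ ≤ 100 * t * (1 + p.2 ^ 2)⁻¹ := by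
      simpa [sigmaOf] using norm_koebe_pt_le ht one_le_two le_rfl h2'
    have k2 : ‖geo (pt t (zetaOf p))‖ ≤ 10 * √t * (1 + |p.1|)⁻¹ := by
      simpa [zetaOf] using norm_geo_pt_le ht le_rfl one_le_two h1'
    have k3 : ‖1 + 4 * geo (pt t (zetaOf p))‖ ≤ 45 * √t * (1 + |p.1|)⁻¹ := by
      have k4 := sqrt_inv_le ht h1'
      have k5 : 1 ≤ 5 * √t * (1 + |p.1|)⁻¹ := by
        calc 1 = √t * del t := (sqrt_mul_del ht).symm
          _ ≤ √t * (5 / (1 + |p.1|)) := by gcongr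
          _ = _ := by ring
      refine (norm_add_le _ _).trans ?_
      rw [norm_one, norm_mul, norm_ofNat]
      linarith
    have k6 : ‖psi γ t (pt t (zetaOf p))‖ ≤ C * (1 + |p.1|)⁻¹ := hC t p.1 ht h1'
    have k7 := norm_psi_le hγ ht hn
    rw [norm_div, norm_real, Real.norm_of_nonneg ht0.le, sideKernel, norm_mul, norm_mul, norm_mul]
    have k8 : (1 + |p.1|)⁻¹ * (1 + |p.1|)⁻¹ ≤ (1 + p.1 ^ 2)⁻¹ := by
      rw [← mul_inv]
      have := abs_nonneg p.1
      refine inv_anti₀ (by positivity) ?_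
      nlinarith [sq_abs p.1]
    have hpi : (2 * Real.pi)⁻¹ ^ 2 ≤ 1 := by
      refine pow_le_one₀ (by positivity) (inv_le_one_of_one_le₀ ?_)
      linarith [Real.pi_gt_three]
    calc _ ≤ 1 * t⁻¹ * (100 * t * (1 + p.2 ^ 2)⁻¹ * (45 * √t * (1 + |p.1|)⁻¹) *
          (C * (1 + |p.1|)⁻¹ * C') / √t) := by gcongr
      _ = 100 * 45 * C * C' * (((1 + |p.1|)⁻¹ * (1 + |p.1|)⁻¹) * (1 + p.2 ^ 2)⁻¹) := by
          field_simp
      _ ≤ _ := by gcongr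
  · have g1 : Tendsto (fun t : ℝ => (1 + 4 * geo (pt t (zetaOf p))) / (√t : ℂ)) atTop
        (𝓝 (4 * (zetaOf p)⁻¹)) := by
      have h0 : Tendsto (fun t : ℝ => ((del t : ℝ) : ℂ)) atTop (𝓝 ((0 : ℝ) : ℂ)) :=
        (continuous_ofReal.tendsto 0).comp tendsto_del
      have := h0.add ((tendsto_geo_pt (zetaOf_ne p)).const_mul 4)
      rw [ofReal_zero, zero_add] at this
      refine this.congr fun t => ?_
      rw [del, ofReal_inv]
      ring
    have h := (((tendsto_koebe_pt (sigmaOf_ne p)).mul g1).mul ((tendsto_psi_pt hγ p.1).mul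
      (tendsto_psi_pt hγ (p.2 - p.1)))).const_mul (((2 * Real.pi)⁻¹ : ℂ) ^ 2)
    rw [sideLimit, zetaOf, omegaOf]
    refine h.congr fun t => ?_
    rw [psiPair, rho_mul_angle2, rho_sq_mul_angle2, pt_div, sigmaOf_sub_zetaOf, sideKernel]
    simp only [zetaOf, omegaOf]
    push_cast
    simp only [div_eq_mul_inv]
    ring

end

/-! ### The singular part of the variance: bounds -/

noncomputable section

variable {γ t s s' : ℝ} {x u : ℂ}

def ratio (t s s' : ℝ) (v w : Circle) : ℂ := w / beta2 t s' / (beta1 t s * v)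

def gap (t s s' : ℝ) (v w : Circle) : ℂ := beta1 t s * v - (w / beta2 t s' : ℂ)⁻¹

def crossKernel (γ : ℝ) (x u n D : ℂ) : ℂ :=
  koebe u * (2 * geo (x * n) ^ 2 - 4 * geo x * geo (x * n) +
    8 * γ * (geo x ^ 2 * ((1 - n) * (1 + geo (x * n)) ^ 2) / D))

lemma one_add_geo {z : ℂ} (hz : 1 - z ≠ 0) : 1 + geo z = (1 - z)⁻¹ := by
  unfold geo
  field_simp
  ring

lemma krest_eq {b c : ℂ} (hx : x ≠ 0) (hb : b ≠ 0) (hc : c ≠ 0) (h1 : 1 - x ≠ 0)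
    (h2 : 1 - x * (c / b) ≠ 0) :
    krest γ (x / b) b c (u / x / c) = crossKernel γ x u (c / b) (b - c⁻¹) := by
  have e1 : x / b * b * c * (u / x / c) = u := by field_simp
  have e2 : x / b * b = x := by field_simp
  have e3 : x / b * c = x * (c / b) := by field_simp
  have e4 : (1 + geo (x * (c / b))) ^ 2 = 1 / (1 - x * (c / b)) ^ 2 := by
    rw [one_add_geo h2, inv_pow, one_div]
  have e5 : Wfun (x / b) b c = 2 * (geo x ^ 2 * ((1 - c / b) * (1 + geo (x * (c / b))) ^ 2) /
      (b - c⁻¹)) := by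
    rw [e4, Wfun, e2, e3, geo]
    by_cases h : 1 - b * c = 0
    · have h' : b - c⁻¹ = 0 := by
        field_simp
        linear_combination -h
      rw [h, h']
      simp
    · have h' : b - c⁻¹ ≠ 0 := by
        intro h0
        field_simp at h0
        exact h (by linear_combination -h0)
      have h3 : b * c - 1 ≠ 0 := fun h0 => h (by linear_combination -h0)
      have e6 : b - c⁻¹ = (b * c - 1) / c := by field_simp
      have e7 : 1 - b * c = -(b * c - 1) := by ring
      rw [e6, e7]
      generalize hw : 1 - x * (c / b) = w at *
      field_simp
  rw [krest, kZ, ksing, e1, e2, e3, e5, crossKernel]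
  ring

def energy1 (t s : ℝ) (x v : ℂ) : ℂ := Es t (min s t) (x / (beta1 t s * v)) (beta1 t s * v)

def energy2 (t s : ℝ) (y v : ℂ) : ℂ := Es t (min s t) (v / beta2 t s) (y / (v / beta2 t s))

lemma beta1_pos (ht : 1 ≤ t) (hs : 0 < s) : 0 < beta1 t s := (Real.exp_pos _).trans_le (beta1_ge ht hs)

lemma beta2_pos (ht : 1 ≤ t) (hs : 0 < s) : 0 < beta2 t s := (Real.exp_pos _).trans_le (beta2_ge ht hs)

lemma norm_ratio (ht : 1 ≤ t) (hs : 0 < s) (hs' : 0 < s') (v w : Circle) :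
    ‖ratio t s s' v w‖ = (beta1 t s * beta2 t s')⁻¹ := by
  have h1 := beta1_pos ht hs
  have h2 := beta2_pos ht hs'
  rw [ratio, norm_div, norm_div, norm_mul, Circle.norm_coe, Circle.norm_coe, norm_real, norm_real,
    Real.norm_of_nonneg h1.le, Real.norm_of_nonneg h2.le]
  field_simp

lemma norm_mul_ratio_le (ht : 1 ≤ t) (hs : 0 < s) (hs' : 0 < s') (v w : Circle) (hx : ‖x‖ = rho t) :
    ‖x * ratio t s s' v w‖ ≤ 1 - del t / 8 := by
  rw [norm_mul, hx, norm_ratio ht hs hs', ← div_eq_mul_inv]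
  refine (rho_lt_beta_mul ht hs hs').trans ?_
  have h1 := del_pos ht
  have h2 := del_le_one ht
  have := half_mul_le_one_sub_exp (x := del t / 4) (by linarith) (by linarith)
  linarith

lemma del_div_le_norm_one_sub (ht : 1 ≤ t) (hs : 0 < s) (hs' : 0 < s') (v w : Circle) (hx : ‖x‖ = rho t) :
    del t / 8 ≤ ‖1 - x * ratio t s s' v w‖ := by
  have h1 := norm_mul_ratio_le ht hs hs' v w hx
  have h2 := one_sub_norm_le (x * ratio t s s' v w)
  linarith

lemma restG_eq (ht : 1 ≤ t) (q : (Circle × Circle) × (ℝ × Circle) × ℝ × Circle) (hs : 0 < q.2.1.1)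
    (hs' : 0 < q.2.2.1) : restG γ t q =
    crossKernel γ (rho t * q.1.1) (rho t ^ 2 * q.1.2) (ratio t q.2.1.1 q.2.2.1 q.2.1.2 q.2.2.2)
      (gap t q.2.1.1 q.2.2.1 q.2.1.2 q.2.2.2) * energy1 t q.2.1.1 (rho t * q.1.1) q.2.1.2 *
      energy2 t q.2.2.1 (rho t ^ 2 * q.1.2 / (rho t * q.1.1)) q.2.2.2 := by
  have h1 : (beta1 t q.2.1.1 : ℂ) ≠ 0 := by exact_mod_cast (beta1_pos ht hs).ne'
  have h2 : (beta2 t q.2.2.1 : ℂ) ≠ 0 := by exact_mod_cast (beta2_pos ht hs').ne'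
  have hx := norm_rho_mul (t := t) q.1.1
  have hx0 : (rho t * q.1.1 : ℂ) ≠ 0 := norm_pos_iff.1 (by rw [hx]; exact rho_pos)
  have h3 : 1 - (rho t * q.1.1 : ℂ) * ratio t q.2.1.1 q.2.2.1 q.2.1.2 q.2.2.2 ≠ 0 := by
    have := del_div_le_norm_one_sub ht hs hs' q.2.1.2 q.2.2.2 hx
    exact norm_pos_iff.1 (lt_of_lt_of_le (by linarith [del_pos ht]) this)
  rw [restG, balF, krest_eq hx0 (mul_ne_zero h1 (Circle.coe_ne_zero _))
    (div_ne_zero (Circle.coe_ne_zero _) h2) (one_sub_ne (by rw [hx]; exact rho_lt_one ht)) h3]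
  rfl

lemma measurable_beta (t : ℝ) : Measurable (beta1 t) ∧ Measurable (beta2 t) := by
  have hb : Measurable (bal t) := by unfold bal; fun_prop
  have hS : MeasurableSet {s | s < t} := measurableSet_Iio
  exact ⟨Measurable.ite hS hb measurable_const, Measurable.ite hS hb measurable_const⟩

lemma measurable_restG (γ t : ℝ) : Measurable (restG γ t) := by
  have h1 := (measurable_beta t).1
  have h2 := (measurable_beta t).2
  have hc : Measurable ((↑) : Circle → ℂ) := (by fun_prop : Continuous ((↑) : Circle → ℂ)).measurable
  unfold restG balF krest kZ ksing Wfun Es koebe geo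
  fun_prop

lemma sq_half_le_exp {m : ℝ} (hm : 0 ≤ m) : m ^ 2 / 2 ≤ Real.exp m := by
  have := Real.quadratic_le_exp_of_nonneg hm
  linarith

lemma norm_energy1_le (ht : 1 ≤ t) (hs : 0 < s) (hx : ‖x‖ = rho t) (v : Circle) :
    ‖energy1 t s x v‖ ≤ Real.exp (18 * √s) := by
  by_cases h : s < t
  · have e : energy1 t s x v = EE (tau t (min s t)) x v := by
      rw [energy1, beta1, if_pos h, min_eq_left h.le, Es_bal hs h.le]
    rw [e]
    exact norm_EE_tau_le ht hs.le hx (Circle.norm_coe v)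
  · have hst : t ≤ s := not_lt.1 h
    have hd := del_pos ht
    have hd1 := del_le_one ht
    have hx0 : x ≠ 0 := norm_pos_iff.1 (by rw [hx]; exact rho_pos)
    have hb : ‖(Real.exp (-(del t / 2)) : ℂ) * v‖ = Real.exp (-(del t / 2)) := by
      rw [norm_mul, Circle.norm_coe, mul_one, norm_real, Real.norm_of_nonneg (Real.exp_pos _).le]
    have hb0 : (Real.exp (-(del t / 2)) : ℂ) * v ≠ 0 := norm_pos_iff.1 (by rw [hb]; exact Real.exp_pos _)
    have ha : ‖x / ((Real.exp (-(del t / 2)) : ℂ) * v)‖ = Real.exp (-(del t / 2)) := by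
      rw [norm_div, hb, hx, rho, ← Real.exp_sub]
      congr 1
      ring
    rw [energy1, beta1, if_neg h, min_eq_right hst]
    refine (norm_Es_le_radii t t (div_ne_zero hx0 hb0) hb0).trans (Real.exp_le_exp.2 ?_)
    rw [ha, hb]
    have e : t / Real.exp (-(del t / 2)) - (2 * t - t) * Real.exp (-(del t / 2)) =
        t * (Real.exp (del t / 2) - Real.exp (-(del t / 2))) := by
      rw [Real.exp_neg]
      field_simp
      ring
    have e' : (2 * t - t) / Real.exp (-(del t / 2)) - t * Real.exp (-(del t / 2)) =
        t * (Real.exp (del t / 2) - Real.exp (-(del t / 2))) := by rw [← e]; ring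
    have h1 := exp_sub_exp_neg_le (x := del t / 2) (by linarith) (by linarith)
    have h0 : Real.exp (-(del t / 2)) ≤ Real.exp (del t / 2) := Real.exp_le_exp.2 (by linarith)
    have h2 : t * (Real.exp (del t / 2) - Real.exp (-(del t / 2))) ≤ t * (9 * (del t / 2)) := by gcongr
    have h3 := mul_del ht
    have h4 : √t ≤ √s := Real.sqrt_le_sqrt hst
    rw [e, e', abs_of_nonneg (mul_nonneg (by linarith) (by linarith))]
    linarith [Real.sqrt_nonneg s]

lemma norm_energy2_le (ht : 1 ≤ t) (hs : 0 < s) (hx : ‖x‖ = rho t) (v : Circle) :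
    ‖energy2 t s x v‖ ≤ Real.exp (18 * √s) := by
  by_cases h : s < t
  · have e : energy2 t s x v = EE (tau t (min s t)) x v := by
      rw [energy2, beta2, if_pos h, min_eq_left h.le, Es_bal' hs h.le]
    rw [e]
    exact norm_EE_tau_le ht hs.le hx (Circle.norm_coe v)
  · have hst : t ≤ s := not_lt.1 h
    have hd := del_pos ht
    have hd1 := del_le_one ht
    have hx0 : x ≠ 0 := norm_pos_iff.1 (by rw [hx]; exact rho_pos)
    have ha : ‖(v : ℂ) / (Real.exp (-(del t / 4)) : ℂ)‖ = Real.exp (del t / 4) := by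
      rw [norm_div, Circle.norm_coe, norm_real, Real.norm_of_nonneg (Real.exp_pos _).le, one_div,
        ← Real.exp_neg, neg_neg]
    have ha0 : (v : ℂ) / (Real.exp (-(del t / 4)) : ℂ) ≠ 0 := norm_pos_iff.1 (by rw [ha]; exact Real.exp_pos _)
    have hb : ‖x / ((v : ℂ) / (Real.exp (-(del t / 4)) : ℂ))‖ = Real.exp (-(5 * del t / 4)) := by
      rw [norm_div, ha, hx, rho, ← Real.exp_sub]
      congr 1
      ring
    rw [energy2, beta2, if_neg h, min_eq_right hst]
    refine (norm_Es_le_radii t t ha0 (div_ne_zero hx0 ha0)).trans (Real.exp_le_exp.2 ?_)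
    rw [ha, hb]
    have e : t / Real.exp (del t / 4) - (2 * t - t) * Real.exp (del t / 4) =
        -(t * (Real.exp (del t / 4) - Real.exp (-(del t / 4)))) := by
      rw [Real.exp_neg]
      field_simp
      ring
    have e' : (2 * t - t) / Real.exp (-(5 * del t / 4)) - t * Real.exp (-(5 * del t / 4)) =
        t * (Real.exp (5 * del t / 4) - Real.exp (-(5 * del t / 4))) := by
      rw [Real.exp_neg]
      field_simp
      ring
    have h1 := exp_sub_exp_neg_le (x := del t / 4) (by linarith) (by linarith)
    have h1' := exp_sub_exp_neg_le (x := 5 * del t / 4) (by linarith) (by linarith)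
    have h0 : Real.exp (-(del t / 4)) ≤ Real.exp (del t / 4) := Real.exp_le_exp.2 (by linarith)
    have h0' : Real.exp (-(5 * del t / 4)) ≤ Real.exp (5 * del t / 4) := Real.exp_le_exp.2 (by linarith)
    have h2 : t * (Real.exp (del t / 4) - Real.exp (-(del t / 4))) ≤ t * (9 * (del t / 4)) := by gcongr
    have h2' : t * (Real.exp (5 * del t / 4) - Real.exp (-(5 * del t / 4))) ≤
        t * (9 * (5 * del t / 4)) := by gcongr
    have h3 := mul_del ht
    have h4 : √t ≤ √s := Real.sqrt_le_sqrt hst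
    rw [e, e', abs_neg, abs_of_nonneg (mul_nonneg (by linarith) (by linarith)),
      abs_of_nonneg (mul_nonneg (by linarith) (by linarith))]
    linarith [Real.sqrt_nonneg s]

end

noncomputable section

open scoped ComplexConjugate

variable {γ t s s' : ℝ} {x u : ℂ}

lemma le_exp_sqrt (s : ℝ) : √s ≤ Real.exp √s := by linarith [Real.add_one_le_exp √s]

lemma le_two_mul_exp_sqrt (hs : 0 ≤ s) : s ≤ 2 * Real.exp √s := by
  have := sq_half_le_exp (Real.sqrt_nonneg s)
  rw [Real.sq_sqrt hs] at this
  linarith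

lemma le_exp_add_of_le (ht : t ≤ s ∨ t ≤ s') (hs : 0 ≤ s) (hs' : 0 ≤ s') :
    t ≤ 2 * Real.exp (√s + √s') := by
  have h0 := Real.sqrt_nonneg s
  have h0' := Real.sqrt_nonneg s'
  have h1 : Real.exp √s ≤ Real.exp (√s + √s') := Real.exp_le_exp.2 (by linarith)
  have h2 : Real.exp √s' ≤ Real.exp (√s + √s') := Real.exp_le_exp.2 (by linarith)
  rcases ht with h | h
  · linarith [le_two_mul_exp_sqrt hs]
  · linarith [le_two_mul_exp_sqrt hs']

lemma bal_mul_sqrt (hs : 0 < s) : bal t s * √s = √(2 * t - s) := by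
  rw [bal, Real.sqrt_div' _ hs.le, div_mul_cancel₀ _ (by positivity)]

lemma sqrt_le_bal_mul (hs : 0 < s) (hst : s ≤ t) : √t ≤ bal t s * √s := by
  rw [bal_mul_sqrt hs]
  exact Real.sqrt_le_sqrt (by linarith)

lemma norm_ratio_le (ht : 1 ≤ t) (hs : 0 < s) (hs' : 0 < s') (v w : Circle) :
    ‖ratio t s s' v w‖ ≤ 6 * Real.exp (√s + √s') / t := by
  have p1 := beta1_pos ht hs
  have p2 := beta2_pos ht hs'
  have ht0 : 0 < t := by linarith
  have m1 : 0 < √s := by positivity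
  have m2 : 0 < √s' := by positivity
  rw [norm_ratio ht hs hs', inv_le_comm₀ (by positivity) (by positivity), inv_div]
  by_cases h : s < t ∧ s' < t
  · rw [beta1, beta2, if_pos h.1, if_pos h.2]
    have h1 := sqrt_le_bal_mul hs h.1.le
    have h2 := sqrt_le_bal_mul hs' h.2.le
    have b1 := bal_ge_one hs h.1.le
    have b2 := bal_ge_one hs' h.2.le
    have h3 : t ≤ bal t s * √s * (bal t s' * √s') := by
      calc t = √t * √t := (Real.mul_self_sqrt ht0.le).symm
        _ ≤ _ := by gcongr
    have h4 : √s * √s' ≤ Real.exp (√s + √s') := by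
      rw [Real.exp_add]
      exact mul_le_mul (le_exp_sqrt s) (le_exp_sqrt s') m2.le (Real.exp_pos _).le
    rw [div_le_iff₀ (by positivity)]
    calc t ≤ bal t s * bal t s' * (√s * √s') := by linarith
      _ ≤ bal t s * bal t s' * (6 * Real.exp (√s + √s')) := by
        have := Real.exp_pos (√s + √s')
        refine mul_le_mul_of_nonneg_left ?_ (by positivity)
        linarith
  · have h' : t ≤ s ∨ t ≤ s' := by
      by_contra! h0
      exact h h0
    have h1 := le_exp_add_of_le h' hs.le hs'.le
    have hd := del_pos ht
    have hd1 := del_le_one ht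
    have h2 : (1 : ℝ) / 3 ≤ beta1 t s * beta2 t s' := by
      have e1 := beta1_ge ht hs
      have e2 := beta2_ge ht hs'
      calc (1 : ℝ) / 3 ≤ Real.exp (-1) := by
            rw [Real.exp_neg, one_div]
            exact inv_anti₀ (Real.exp_pos 1) (by linarith [Real.exp_one_lt_d9])
        _ ≤ Real.exp (-(del t / 2)) * Real.exp (-(del t / 4)) := by
            rw [← Real.exp_add]
            exact Real.exp_le_exp.2 (by linarith)
        _ ≤ _ := by gcongr
    rw [div_le_iff₀ (by positivity)]
    nlinarith [Real.exp_pos (√s + √s')]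

lemma norm_geo_mul_ratio_le (ht : 1 ≤ t) (hs : 0 < s) (hs' : 0 < s') (v w : Circle) (hx : ‖x‖ = rho t) :
    ‖geo (x * ratio t s s' v w)‖ ≤ 1152 * Real.exp (√s + √s') ^ 2 / t := by
  have h1 := norm_ratio_le ht hs hs' v w
  have h2 := del_div_le_norm_one_sub ht hs hs' v w hx
  have h3 := norm_mul_ratio_le ht hs hs' v w hx
  have hd := del_pos ht
  have ht0 : 0 < t := by linarith
  have hM : 1 ≤ Real.exp (√s + √s') := Real.one_le_exp (by positivity)
  set M := Real.exp (√s + √s')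
  have h4 : ‖x * ratio t s s' v w‖ ≤ 6 * M / t := by
    rw [norm_mul, hx]
    exact (mul_le_of_le_one_left (norm_nonneg _) (rho_lt_one ht).le).trans h1
  set z := x * ratio t s s' v w
  by_cases h : ‖z‖ ≤ 1 / 2
  · have h5 := one_sub_norm_le z
    rw [geo, norm_div, div_le_iff₀ (by linarith)]
    calc ‖z‖ ≤ 6 * M / t := h4
      _ ≤ 1152 * M ^ 2 / t * (1 / 2) := by
        rw [div_mul_eq_mul_div]
        have : 6 * M ≤ 1152 * M ^ 2 * (1 / 2) := by nlinarith
        gcongr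
      _ ≤ _ := mul_le_mul_of_nonneg_left (by linarith) (by positivity)
  · push Not at h
    have h5 : t < 12 * M := by
      have := h.trans_le h4
      rw [lt_div_iff₀ ht0] at this
      linarith
    have h6 := norm_geo_le (by linarith) (by linarith) h2
    refine h6.trans ?_
    have h7 : (del t / 8)⁻¹ = 8 * √t := by rw [inv_div, del, div_inv_eq_mul]
    have h8 : √t ≤ t := Real.sqrt_le_iff.2 ⟨ht0.le, by nlinarith⟩
    rw [h7, le_div_iff₀ ht0]
    calc 8 * √t * t ≤ 8 * (12 * M) * (12 * M) := by gcongr; linarith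
      _ = _ := by ring

lemma norm_mul_circle_sub_sq (a b : ℝ) (p q : Circle) :
    ‖(a * p - b * q : ℂ)‖ ^ 2 = (a - b) ^ 2 + a * b * ‖(p - q : ℂ)‖ ^ 2 := by
  have hp : (p : ℂ).re * (p : ℂ).re + (p : ℂ).im * (p : ℂ).im = 1 := by
    rw [← normSq_apply, Circle.normSq_coe]
  have hq : (q : ℂ).re * (q : ℂ).re + (q : ℂ).im * (q : ℂ).im = 1 := by
    rw [← normSq_apply, Circle.normSq_coe]
  rw [Complex.sq_norm, Complex.sq_norm, normSq_apply, normSq_apply]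
  simp only [sub_re, sub_im, re_ofReal_mul, im_ofReal_mul]
  linear_combination (a ^ 2 - a * b) * hp + (b ^ 2 - a * b) * hq

lemma gap_eq (t s s' : ℝ) (v w : Circle) :
    gap t s s' v w = beta1 t s * v - beta2 t s' * (w⁻¹ : Circle) := by
  rw [gap, inv_div, Circle.coe_inv, ← div_eq_mul_inv]

lemma gaussPair_sub (s s' : ℝ) (v w : Circle) : (gaussPair ((s, v), s', w)).2 -
    (gaussPair ((s, v), s', w)).1 = √s' * (w⁻¹ : Circle) - √s * v := by
  simp only [gaussPair, map_mul, conj_ofReal]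
  rw [Circle.coe_inv_eq_conj]

lemma bal_sub_sq_ge (hs : 0 < s) (hs' : 0 < s') (hst : s ≤ t) (hst' : s' ≤ t) :
    t * (√s' - √s) ^ 2 ≤ (√s * √s') ^ 2 * (bal t s - bal t s') ^ 2 := by
  have e1 := bal_mul_sqrt (t := t) hs
  have e2 := bal_mul_sqrt (t := t) hs'
  have ht : 0 < t := by linarith
  have q1 : √s ^ 2 = s := Real.sq_sqrt hs.le
  have q2 : √s' ^ 2 = s' := Real.sq_sqrt hs'.le
  have q3 : √(2 * t - s) ^ 2 = 2 * t - s := Real.sq_sqrt (by linarith)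
  have q4 : √(2 * t - s') ^ 2 = 2 * t - s' := Real.sq_sqrt (by linarith)
  have q5 : √(2 * t) ^ 2 = 2 * t := Real.sq_sqrt (by linarith)
  have l1 : √(2 * t - s) ≤ √(2 * t) := Real.sqrt_le_sqrt (by linarith)
  have l2 : √(2 * t - s') ≤ √(2 * t) := Real.sqrt_le_sqrt (by linarith)
  have h1 : (√s * √s') ^ 2 * (bal t s - bal t s') ^ 2 =
      (√s' * √(2 * t - s) - √s * √(2 * t - s')) ^ 2 := by
    rw [← e1, ← e2]
    ring
  have m1 : 0 < √s := by positivity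
  have m2 : 0 < √s' := by positivity
  have n1 := Real.sqrt_nonneg (2 * t - s)
  have n2 := Real.sqrt_nonneg (2 * t - s')
  rw [h1]
  generalize √s = m at *
  generalize √s' = m' at *
  generalize √(2 * t - s) = P at *
  generalize √(2 * t - s') = P' at *
  generalize √(2 * t) = T at *
  have k1 : (m' * P - m * P') * (m' * P + m * P') = 2 * t * ((m' - m) * (m' + m)) := by
    linear_combination m' ^ 2 * q3 - m ^ 2 * q4 - s * q2 + s' * q1
  have k2 : m' * P + m * P' ≤ T * (m' + m) := by nlinarith
  have k3 : (m' * P + m * P') ^ 2 ≤ (T * (m' + m)) ^ 2 := by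
    have : 0 ≤ m' * P + m * P' := by positivity
    gcongr
  have k4 : (2 * t * ((m' - m) * (m' + m))) ^ 2 ≤
      (m' * P - m * P') ^ 2 * (2 * t * (m' + m) ^ 2) := by
    rw [← k1, mul_pow]
    gcongr
    rwa [mul_pow, q5] at k3
  have k5 : 0 < 2 * t * (m' + m) ^ 2 := by positivity
  have k6 : 2 * t * (m' - m) ^ 2 * (2 * t * (m' + m) ^ 2) ≤
      (m' * P - m * P') ^ 2 * (2 * t * (m' + m) ^ 2) := by
    refine le_trans (le_of_eq ?_) k4
    ring
  have k7 := le_of_mul_le_mul_right k6 k5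
  nlinarith [mul_nonneg ht.le (sq_nonneg (m' - m))]

lemma sqrt_mul_norm_le_gap (hs : 0 < s) (hs' : 0 < s') (hst : s < t) (hst' : s' < t) (v w : Circle) :
    √t * ‖(gaussPair ((s, v), s', w)).2 - (gaussPair ((s, v), s', w)).1‖ ≤
      √s * √s' * ‖gap t s s' v w‖ := by
  rw [gap_eq, gaussPair_sub, beta1, beta2, if_pos hst, if_pos hst']
  have ht : 0 < t := by linarith
  have b1 := sqrt_le_bal_mul hs hst.le
  have b2 := sqrt_le_bal_mul hs' hst'.le
  have c1 := bal_ge_one hs hst.le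
  have c2 := bal_ge_one hs' hst'.le
  refine le_of_sq_le_sq ?_ (by positivity)
  rw [mul_pow, mul_pow _ ‖_‖, norm_mul_circle_sub_sq, norm_mul_circle_sub_sq, Real.sq_sqrt ht.le,
    norm_sub_rev ((w⁻¹ : Circle) : ℂ), mul_add, mul_add]
  have h3 : t ≤ bal t s * √s * (bal t s' * √s') := by
    calc t = √t * √t := (Real.mul_self_sqrt ht.le).symm
      _ ≤ _ := by gcongr
  refine add_le_add (bal_sub_sq_ge hs hs' hst.le hst'.le) ?_
  calc t * (√s' * √s * ‖(v - (w⁻¹ : Circle) : ℂ)‖ ^ 2) ≤ (bal t s * √s * (bal t s' * √s')) *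
      (√s' * √s * ‖(v - (w⁻¹ : Circle) : ℂ)‖ ^ 2) := by gcongr
    _ = _ := by ring

lemma del_div_le_gap (ht : 1 ≤ t) (hs : 0 < s) (hs' : 0 < s') (h : t ≤ s ∨ t ≤ s') (v w : Circle) :
    del t / 16 ≤ ‖gap t s s' v w‖ := by
  have hd := del_pos ht
  have hd1 := del_le_one ht
  have p1 := beta1_pos ht hs
  have p2 := beta2_pos ht hs'
  have h1 : |beta1 t s - beta2 t s'| ≤ ‖gap t s s' v w‖ := by
    rw [gap_eq]
    have := abs_norm_sub_norm_le (beta1 t s * v : ℂ) (beta2 t s' * (w⁻¹ : Circle))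
    rwa [norm_mul, norm_mul, Circle.norm_coe, Circle.norm_coe, mul_one, mul_one, norm_real, norm_real,
      Real.norm_of_nonneg p1.le, Real.norm_of_nonneg p2.le] at this
  refine le_trans ?_ h1
  have e4 := half_mul_le_one_sub_exp (x := del t / 4) (by linarith) (by linarith)
  have e2 := half_mul_le_one_sub_exp (x := del t / 2) (by linarith) (by linarith)
  by_cases k1 : s < t
  · have k2 : ¬ s' < t := by
      rcases h with h | h
      · exact absurd k1 (not_lt.2 h)
      · exact not_lt.2 h
    rw [beta1, beta2, if_pos k1, if_neg k2]
    have := bal_ge_one hs k1.le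
    exact le_trans (by linarith) (le_abs_self _)
  · rw [beta1, beta2, if_neg k1, abs_sub_comm]
    refine le_trans ?_ (le_abs_self _)
    split_ifs with k2
    · have := bal_ge_one hs' k2.le
      linarith
    · have e : Real.exp (-(del t / 2)) = Real.exp (-(del t / 4)) * Real.exp (-(del t / 4)) := by
        rw [← Real.exp_add]; congr 1; ring
      have := Real.add_one_le_exp (-(del t / 4))
      rw [e]
      nlinarith

lemma inv_gap_le (ht : 1 ≤ t) (hs : 0 < s) (hs' : 0 < s') (hne : s ≠ s') (v w : Circle) :
    √t * ‖gap t s s' v w‖⁻¹ ≤ 32 * Real.exp (√s + √s') *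
      (1 + ‖(gaussPair ((s, v), s', w)).2 - (gaussPair ((s, v), s', w)).1‖⁻¹) := by
  have ht0 : 0 < √t := by positivity
  have hE := Real.exp_pos (√s + √s')
  by_cases h : s < t ∧ s' < t
  · have h1 := sqrt_mul_norm_le_gap hs hs' h.1 h.2 v w
    have h2 : 0 < ‖(gaussPair ((s, v), s', w)).2 - (gaussPair ((s, v), s', w)).1‖ := by
      rw [gaussPair_sub]
      refine norm_pos_iff.2 fun h0 => hne ?_
      have h3 := congrArg norm (sub_eq_zero.1 h0)
      rw [norm_mul, norm_mul, Circle.norm_coe, Circle.norm_coe, norm_real, norm_real,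
        Real.norm_of_nonneg (Real.sqrt_nonneg _), Real.norm_of_nonneg (Real.sqrt_nonneg _), mul_one, mul_one,
        Real.sqrt_inj hs'.le hs.le] at h3
      exact h3.symm
    set n := ‖(gaussPair ((s, v), s', w)).2 - (gaussPair ((s, v), s', w)).1‖
    have h3 : 0 < √s * √s' := by positivity
    have h4 : 0 < ‖gap t s s' v w‖ := by
      by_contra! h0
      nlinarith [mul_pos ht0 h2]
    have h5 : √s * √s' ≤ Real.exp (√s + √s') := by
      rw [Real.exp_add]
      exact mul_le_mul (le_exp_sqrt s) (le_exp_sqrt s') (Real.sqrt_nonneg _) (Real.exp_pos _).le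
    calc √t * ‖gap t s s' v w‖⁻¹ ≤ √s * √s' * n⁻¹ := by
          rw [← div_eq_mul_inv, ← div_eq_mul_inv, div_le_div_iff₀ h4 h2]
          exact h1
      _ ≤ 32 * Real.exp (√s + √s') * (1 + n⁻¹) := by
          refine mul_le_mul (by linarith) (by linarith) (by positivity) (by positivity)
  · have h' : t ≤ s ∨ t ≤ s' := by
      by_contra! h0
      exact h h0
    have h1 := le_exp_add_of_le h' hs.le hs'.le
    have h2 := del_div_le_gap ht hs hs' h' v w
    have hd := del_pos ht
    calc √t * ‖gap t s s' v w‖⁻¹ ≤ √t * (del t / 16)⁻¹ := by gcongr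
      _ = 16 * t := by
        rw [inv_div, del, div_inv_eq_mul]
        linear_combination 16 * Real.mul_self_sqrt (show 0 ≤ t by linarith)
      _ ≤ 32 * Real.exp (√s + √s') * 1 := by linarith
      _ ≤ _ := by
        gcongr
        have : 0 ≤ ‖(gaussPair ((s, v), s', w)).2 - (gaussPair ((s, v), s', w)).1‖⁻¹ := by positivity
        linarith

end

/-! ### The singular part of the variance: a dominating function -/

noncomputable section

open scoped ComplexConjugate

variable {γ t s s' φ : ℝ} {x u : ℂ}

def crossConst (γ : ℝ) : ℝ := 100 * (1050 + 716800 * γ) * 1152 ^ 2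

lemma inv_sq_one_add_abs_le (φ : ℝ) : (1 + |φ|)⁻¹ ^ 2 ≤ (1 + φ ^ 2)⁻¹ := by
  rw [inv_pow]
  refine inv_anti₀ (by positivity) ?_
  nlinarith [sq_abs φ, abs_nonneg φ]

lemma one_le_mul_of_abs_le (ht : 1 ≤ t) (hφ : |φ| ≤ Real.pi * √t) : 1 ≤ 25 * (1 + φ ^ 2)⁻¹ * t := by
  have h1 := sqrt_inv_le ht hφ
  have hd := del_pos ht
  have h2 : √t * √t = t := Real.mul_self_sqrt (by linarith)
  have h3 := inv_sq_one_add_abs_le φ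
  calc 1 = (√t * del t) ^ 2 := by rw [sqrt_mul_del ht, one_pow]
    _ = del t ^ 2 * t := by linear_combination del t ^ 2 * h2
    _ ≤ (5 / (1 + |φ|)) ^ 2 * t := by gcongr
    _ = 25 * (1 + |φ|)⁻¹ ^ 2 * t := by ring
    _ ≤ _ := by gcongr

lemma norm_crossKernel_le (hγ : 0 < γ) (ht : 1 ≤ t) (hs : 0 < s) (hs' : 0 < s') (hne : s ≠ s')
    (v w : Circle) {p : ℝ × ℝ} (h1 : |p.1| ≤ Real.pi * √t) (h2 : |p.2| ≤ Real.pi * √t) :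
    ‖crossKernel γ (pt t (zetaOf p)) (pt t (sigmaOf p)) (ratio t s s' v w) (gap t s s' v w)‖ ≤
      crossConst γ * (t * √t) * ((1 + p.1 ^ 2)⁻¹ * (1 + p.2 ^ 2)⁻¹) *
        (Real.exp (√s + √s') ^ 6 *
        (1 + ‖(gaussPair ((s, v), s', w)).2 - (gaussPair ((s, v), s', w)).1‖⁻¹)) := by
  have ht0 : 0 < t := by linarith
  have hr0 : 1 ≤ √t := Real.one_le_sqrt.2 ht
  have hrr : √t * √t = t := Real.mul_self_sqrt ht0.le
  have hx : ‖pt t (zetaOf p)‖ = rho t := norm_pt_one t p.1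
  have kP : ‖koebe (pt t (sigmaOf p))‖ ≤ 100 * t * (1 + p.2 ^ 2)⁻¹ := by
    simpa [sigmaOf] using norm_koebe_pt_le ht one_le_two le_rfl h2
  have kX : ‖geo (pt t (zetaOf p))‖ ≤ 10 * √t * (1 + |p.1|)⁻¹ := by
    simpa [zetaOf] using norm_geo_pt_le ht le_rfl one_le_two h1
  have kX' : ‖geo (pt t (zetaOf p))‖ ≤ 10 * √t :=
    kX.trans (mul_le_of_le_one_right (by positivity) (inv_le_one_of_one_le₀ (by simp)))
  have kZ := norm_geo_mul_ratio_le ht hs hs' v w hx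
  have kn := norm_ratio_le ht hs hs' v w
  have kD := inv_gap_le ht hs hs' hne v w
  have ki := one_le_mul_of_abs_le ht h1
  have hM : 1 ≤ Real.exp (√s + √s') := Real.one_le_exp (by positivity)
  have hi := inv_sq_one_add_abs_le p.1
  have hi0 : 0 < (1 + p.1 ^ 2)⁻¹ := by positivity
  have hN : 0 ≤ ‖(gaussPair ((s, v), s', w)).2 - (gaussPair ((s, v), s', w)).1‖⁻¹ := by positivity
  rw [crossKernel]
  generalize ‖(gaussPair ((s, v), s', w)).2 - (gaussPair ((s, v), s', w)).1‖⁻¹ = N at *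
  generalize geo (pt t (zetaOf p) * ratio t s s' v w) = Z at *
  generalize geo (pt t (zetaOf p)) = X at *
  generalize koebe (pt t (sigmaOf p)) = P at *
  generalize ratio t s s' v w = n at *
  generalize gap t s s' v w = D at *
  generalize Real.exp (√s + √s') = M at *
  generalize (1 + p.2 ^ 2)⁻¹ = j at *
  generalize (1 + p.1 ^ 2)⁻¹ = i at *
  generalize (1 + |p.1|)⁻¹ = a at *
  set A := 1152 * M ^ 2 with hA
  have hA1 : 1 ≤ A := by nlinarith
  have hM0 : 0 < M := by linarith
  have kZ1 : ‖Z‖ ≤ A := kZ.trans (div_le_self (by linarith) ht)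
  have b1 : ‖2 * Z ^ 2‖ ≤ 50 * (A ^ 2 * M ^ 2) * (1 + N) * (i * √t) := by
    rw [norm_mul, norm_ofNat, norm_pow]
    have e1 : ‖Z‖ ^ 2 ≤ A ^ 2 * (25 * i) := by
      calc ‖Z‖ ^ 2 = ‖Z‖ * ‖Z‖ := pow_two _
        _ ≤ A * (A / t) := by gcongr
        _ ≤ A * (A * (25 * i)) := by
          rw [div_eq_mul_inv]
          have : t⁻¹ ≤ 25 * i := by rw [inv_le_iff_one_le_mul₀ ht0]; linarith
          gcongr
        _ = _ := by ring
    have e2 : 1 ≤ M ^ 2 * ((1 + N) * √t) := by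
      have : 1 ≤ M ^ 2 := one_le_pow₀ hM
      have : 1 ≤ (1 + N) * √t := by nlinarith
      nlinarith
    calc 2 * ‖Z‖ ^ 2 ≤ 2 * (A ^ 2 * (25 * i)) * 1 := by rw [mul_one]; gcongr
      _ ≤ 2 * (A ^ 2 * (25 * i)) * (M ^ 2 * ((1 + N) * √t)) := by gcongr
      _ = _ := by ring
  have b2 : ‖4 * X * Z‖ ≤ 1000 * (A ^ 2 * M ^ 2) * (1 + N) * (i * √t) := by
    rw [norm_mul, norm_mul, norm_ofNat]
    have e2 : 1 ≤ A * (M ^ 2 * (1 + N)) := by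
      have : 1 ≤ M ^ 2 := one_le_pow₀ hM
      have : 1 ≤ M ^ 2 * (1 + N) := by nlinarith
      nlinarith
    have e3 : A / t ≤ A * (25 * i) := by
      rw [div_eq_mul_inv]
      have : t⁻¹ ≤ 25 * i := by rw [inv_le_iff_one_le_mul₀ ht0]; linarith
      gcongr
    calc 4 * ‖X‖ * ‖Z‖ ≤ 4 * (10 * √t) * (A * (25 * i)) := by
          gcongr
          exact kZ.trans e3
      _ = 1000 * (A * (i * √t)) * 1 := by ring
      _ ≤ 1000 * (A * (i * √t)) * (A * (M ^ 2 * (1 + N))) := by gcongr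
      _ = _ := by ring
  have b3 : ‖8 * γ * (X ^ 2 * ((1 - n) * (1 + Z) ^ 2) / D)‖ ≤
      716800 * γ * (A ^ 2 * M ^ 2) * (1 + N) * (i * √t) := by
    rw [norm_mul, norm_mul, norm_div, norm_mul, norm_mul, norm_pow, norm_pow, norm_ofNat, norm_real,
      Real.norm_of_nonneg hγ.le]
    have e1 : ‖X‖ ^ 2 ≤ 100 * t * i := by
      calc ‖X‖ ^ 2 ≤ (10 * √t * a) ^ 2 := by gcongr
        _ = 100 * (√t * √t) * a ^ 2 := by ring
        _ ≤ _ := by rw [hrr]; gcongr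
    have e2 : ‖1 - n‖ ≤ 7 * M := by
      have h3 : 6 * M / t ≤ 6 * M := div_le_self (by linarith) ht
      refine (norm_sub_le _ _).trans ?_
      rw [norm_one]
      linarith
    have e3 : ‖1 + Z‖ ≤ 2 * A := by
      refine (norm_add_le _ _).trans ?_
      rw [norm_one]
      linarith
    calc 8 * γ * (‖X‖ ^ 2 * (‖1 - n‖ * ‖1 + Z‖ ^ 2) / ‖D‖)
        = 8 * γ * (‖X‖ ^ 2 * (‖1 - n‖ * ‖1 + Z‖ ^ 2)) * (√t * ‖D‖⁻¹) / √t := by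
          field_simp
      _ ≤ 8 * γ * (100 * t * i * (7 * M * (2 * A) ^ 2)) * (32 * M * (1 + N)) / √t := by gcongr
      _ = 716800 * γ * (A ^ 2 * M ^ 2) * (1 + N) * (i * (t / √t)) := by ring
      _ = _ := by rw [Real.div_sqrt]
  rw [norm_mul]
  calc _ ≤ 100 * t * j * (50 * (A ^ 2 * M ^ 2) * (1 + N) * (i * √t) +
        1000 * (A ^ 2 * M ^ 2) * (1 + N) * (i * √t) +
        716800 * γ * (A ^ 2 * M ^ 2) * (1 + N) * (i * √t)) := by
        refine mul_le_mul kP ?_ (norm_nonneg _) ((norm_nonneg _).trans kP)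
        refine (norm_add_le _ _).trans (add_le_add ((norm_sub_le _ _).trans (add_le_add b1 b2)) b3)
    _ = _ := by
      rw [hA, crossConst]
      ring

lemma ae_nu_prod (hγ : 0 < γ) : ∀ᵐ q ∂(nu γ).prod (nu γ),
    (0 < q.1.1 ∧ 0 < q.2.1) ∧ q.1.1 ≠ q.2.1 := by
  have := isProbabilityMeasure_expo hγ
  have h : MeasurePreserving (Prod.fst : ℝ × Circle → ℝ) (nu γ) (expo γ) := measurePreserving_fst
  have := isProbabilityMeasure_nu hγ
  exact (h.prod h).quasiMeasurePreserving.ae (ae_expo_prod hγ)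

def windowMap (t : ℝ) : (ℝ × ℝ) × (ℝ × Circle) × ℝ × Circle →
    (Circle × Circle) × (ℝ × Circle) × ℝ × Circle := Prod.map (angle2 t) id

lemma isWindow_windowMap (hγ : 0 < γ) (ht : 1 ≤ t) : IsWindow (windowMap t)
    ((2 * Real.pi)⁻¹ ^ 2 * t⁻¹) ((arc t ×ˢ arc t) ×ˢ univ) (volume.prod ((nu γ).prod (nu γ)))
    (volume.prod ((nu γ).prod (nu γ))) := by
  have := isProbabilityMeasure_nu hγ
  have h := (isWindow_angle2 ht).prod (IsWindow.refl ((nu γ).prod (nu γ)))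
  rwa [mul_one] at h

def crossMajorant (γ : ℝ) (z : (ℝ × ℝ) × (ℝ × Circle) × ℝ × Circle) : ℝ :=
  crossConst γ * ((1 + z.1.1 ^ 2)⁻¹ * (1 + z.1.2 ^ 2)⁻¹ *
    (Real.exp (24 * (√z.2.1.1 + √z.2.2.1)) * (1 + ‖(gaussPair z.2).2 - (gaussPair z.2).1‖⁻¹)))

lemma integrable_crossMajorant (hγ : 0 < γ) :
    Integrable (crossMajorant γ) (volume.prod ((nu γ).prod (nu γ))) := by
  have := isProbabilityMeasure_nu hγ
  exact (integrable_inv_prod.mul_prod (integrable_nu_majorant hγ (by norm_num))).const_mul _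

lemma restG_windowMap (ht : 1 ≤ t) (z : (ℝ × ℝ) × (ℝ × Circle) × ℝ × Circle) (hs : 0 < z.2.1.1)
    (hs' : 0 < z.2.2.1) : restG γ t (windowMap t z) =
    crossKernel γ (pt t (zetaOf z.1)) (pt t (sigmaOf z.1)) (ratio t z.2.1.1 z.2.2.1 z.2.1.2 z.2.2.2)
      (gap t z.2.1.1 z.2.2.1 z.2.1.2 z.2.2.2) * energy1 t z.2.1.1 (pt t (zetaOf z.1)) z.2.1.2 *
      energy2 t z.2.2.1 (pt t (omegaOf z.1)) z.2.2.2 := by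
  rw [restG_eq ht _ hs hs']
  simp only [windowMap, Prod.map_fst, Prod.map_snd, id, rho_mul_angle2, rho_sq_mul_angle2, pt_div,
    sigmaOf_sub_zetaOf]

lemma norm_restG_le (hγ : 0 < γ) (ht : 1 ≤ t) : ∀ᵐ z ∂(volume : Measure (ℝ × ℝ)).prod ((nu γ).prod (nu γ)),
    z ∈ (arc t ×ˢ arc t) ×ˢ univ →
      ((2 * Real.pi)⁻¹ ^ 2 * t⁻¹) * ‖restG γ t (windowMap t z) / (√t : ℂ)‖ ≤ crossMajorant γ z := by
  have := isProbabilityMeasure_nu hγ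
  filter_upwards [Measure.quasiMeasurePreserving_snd.ae (ae_nu_prod hγ)] with z hz hS
  obtain ⟨⟨hs, hs'⟩, hne⟩ := hz
  have ht0 : 0 < √t := by positivity
  have hx : ‖pt t (zetaOf z.1)‖ = rho t := norm_pt_one t z.1.1
  have hy : ‖pt t (omegaOf z.1)‖ = rho t := norm_pt_one t (z.1.2 - z.1.1)
  have k1 := norm_crossKernel_le hγ ht hs hs' hne z.2.1.2 z.2.2.2 (abs_le_of_mem_arc hS.1.1)
    (abs_le_of_mem_arc hS.1.2)
  have k2 := norm_energy1_le ht hs hx z.2.1.2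
  have k3 := norm_energy2_le ht hs' hy z.2.2.2
  have hpi : (2 * Real.pi)⁻¹ ^ 2 ≤ 1 := by
    refine pow_le_one₀ (by positivity) (inv_le_one_of_one_le₀ ?_)
    linarith [Real.pi_gt_three]
  have eE : Real.exp (√z.2.1.1 + √z.2.2.1) ^ 6 * (Real.exp (18 * √z.2.1.1) * Real.exp (18 * √z.2.2.1)) =
      Real.exp (24 * (√z.2.1.1 + √z.2.2.1)) := by
    rw [← Real.exp_nat_mul, ← Real.exp_add, ← Real.exp_add]
    congr 1
    push_cast
    ring
  rw [restG_windowMap ht z hs hs', norm_div, norm_mul, norm_mul, norm_real, Real.norm_of_nonneg ht0.le,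
    crossMajorant, ← eE]
  change _ ≤ crossConst γ * (_ * (_ * (1 + ‖(gaussPair ((z.2.1.1, z.2.1.2), z.2.2.1, z.2.2.2)).2 -
    (gaussPair ((z.2.1.1, z.2.1.2), z.2.2.1, z.2.2.2)).1‖⁻¹)))
  generalize ‖(gaussPair ((z.2.1.1, z.2.1.2), z.2.2.1, z.2.2.2)).2 -
    (gaussPair ((z.2.1.1, z.2.1.2), z.2.2.1, z.2.2.2)).1‖⁻¹ = N at *
  have hk := (norm_nonneg _).trans k1
  calc _ ≤ 1 * t⁻¹ * (crossConst γ * (t * √t) * ((1 + z.1.1 ^ 2)⁻¹ * (1 + z.1.2 ^ 2)⁻¹) *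
        (Real.exp (√z.2.1.1 + √z.2.2.1) ^ 6 * (1 + N)) * Real.exp (18 * √z.2.1.1) *
          Real.exp (18 * √z.2.2.1) / √t) := by gcongr
    _ = _ := by
      field_simp

lemma integrable_restG (hγ : 0 < γ) (ht : 1 ≤ t) :
    Integrable (restG γ t) (volume.prod ((nu γ).prod (nu γ))) := by
  have ht0 : (√t : ℂ) ≠ 0 := by exact_mod_cast (by positivity : √t ≠ 0)
  have h := ((isWindow_windowMap hγ ht).integrable
    ((measurable_restG γ t).div_const (√t : ℂ)).aestronglyMeasurable
    (integrable_crossMajorant hγ) (norm_restG_le hγ ht)).mul_const (√t : ℂ)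
  refine h.congr (ae_of_all _ fun q => ?_)
  exact div_mul_cancel₀ _ ht0

end

/-! ### The singular part of the variance: the limit -/

noncomputable section

open scoped ComplexConjugate

variable {γ t s s' : ℝ}

lemma tendsto_sqrt_two_mul_sub (s : ℝ) :
    Tendsto (fun t : ℝ => √(2 * t - s) / √t) atTop (𝓝 √2) := by
  have h : Tendsto (fun t : ℝ => 2 - s / t) atTop (𝓝 (2 - 0)) :=
    tendsto_const_nhds.sub (tendsto_const_nhds.div_atTop tendsto_id)
  rw [sub_zero] at h
  refine (h.sqrt).congr' ?_
  filter_upwards [eventually_gt_atTop 0] with t ht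
  rw [← Real.sqrt_div' _ ht.le]
  congr 1
  field_simp

lemma tendsto_bal (hs : 0 < s) :
    Tendsto (fun t : ℝ => ((bal t s : ℝ) : ℂ) / (√t : ℂ)) atTop (𝓝 (√2 * (√s : ℂ)⁻¹)) := by
  have h := (continuous_ofReal.tendsto _).comp ((tendsto_sqrt_two_mul_sub s).mul_const (√s)⁻¹)
  rw [ofReal_mul, ofReal_inv] at h
  refine h.congr fun t => ?_
  have hs' : 0 < √s := Real.sqrt_pos.2 hs
  have e : bal t s = √(2 * t - s) / √s := by
    rw [← bal_mul_sqrt hs, mul_div_cancel_right₀ _ hs'.ne']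
  rw [Function.comp_apply, e, ← ofReal_div]
  congr 1
  ring

lemma tendsto_tau (hs : 0 < s) :
    Tendsto (fun t : ℝ => ((tau t s : ℝ) : ℂ) / (√t : ℂ)) atTop (𝓝 (√2 * (√s : ℂ))) := by
  have h := (continuous_ofReal.tendsto _).comp ((tendsto_sqrt_two_mul_sub s).mul_const √s)
  rw [ofReal_mul] at h
  refine h.congr fun t => ?_
  rw [Function.comp_apply, ← ofReal_div]
  congr 1
  rw [tau, Real.sqrt_mul hs.le]
  ring

lemma tendsto_EE_pt (hs : 0 < s) (k : ℂ) (v : Circle) :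
    Tendsto (fun t : ℝ => EE (tau t s) (pt t k) v) atTop
      (𝓝 (exp (√2 * k * (√s * v + √s * (v : ℂ)⁻¹)))) := by
  have h1 := tendsto_sqrt_mul_one_sub_pt k
  have h2 := tendsto_sqrt_mul_one_sub_pt (-k)
  have h := (tendsto_tau hs).mul ((h2.neg.mul_const (v : ℂ)).add (h1.mul_const (v : ℂ)⁻¹))
  have h' := (continuous_exp.tendsto _).comp h
  rw [show (√2 * k * (√s * v + √s * (v : ℂ)⁻¹)) = √2 * (√s : ℂ) * (- -k * v + k * (v : ℂ)⁻¹) by ring]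
  refine h'.congr' ?_
  filter_upwards [eventually_gt_atTop 0] with t ht
  have ht0 : (√t : ℂ) ≠ 0 := by exact_mod_cast (Real.sqrt_pos.2 ht).ne'
  have e : (pt t k)⁻¹ = pt t (-k) := by rw [pt, pt, ← exp_neg]; congr 1; ring
  rw [Function.comp_apply, EE, e]
  congr 1
  field_simp
  ring

lemma tendsto_energy1 (hs : 0 < s) (k : ℂ) (v : Circle) :
    Tendsto (fun t : ℝ => energy1 t s (pt t k) v) atTop
      (𝓝 (exp (√2 * k * (√s * v + √s * (v : ℂ)⁻¹)))) := by
  refine (tendsto_EE_pt hs k v).congr' ?_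
  filter_upwards [eventually_gt_atTop s] with t h
  rw [energy1, beta1, if_pos h, min_eq_left h.le, Es_bal hs h.le]

lemma tendsto_energy2 (hs : 0 < s) (k : ℂ) (v : Circle) :
    Tendsto (fun t : ℝ => energy2 t s (pt t k) v) atTop
      (𝓝 (exp (√2 * k * (√s * v + √s * (v : ℂ)⁻¹)))) := by
  refine (tendsto_EE_pt hs k v).congr' ?_
  filter_upwards [eventually_gt_atTop s] with t h
  rw [energy2, beta2, if_pos h, min_eq_left h.le, Es_bal' hs h.le]

lemma tendsto_gap (hs : 0 < s) (hs' : 0 < s') (v w : Circle) :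
    Tendsto (fun t : ℝ => gap t s s' v w / (√t : ℂ)) atTop
      (𝓝 (√2 * ((√s : ℂ)⁻¹ * v - (√s' : ℂ)⁻¹ * (w : ℂ)⁻¹))) := by
  have h := ((tendsto_bal hs).mul_const (v : ℂ)).sub ((tendsto_bal hs').mul_const (w : ℂ)⁻¹)
  rw [mul_sub, ← mul_assoc, ← mul_assoc]
  refine h.congr' ?_
  filter_upwards [eventually_gt_atTop s, eventually_gt_atTop s'] with t h h'
  rw [gap_eq, beta1, beta2, if_pos h, if_pos h', Circle.coe_inv]
  ring

lemma tendsto_ratio (hs : 0 < s) (hs' : 0 < s') (v w : Circle) :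
    Tendsto (fun t : ℝ => ratio t s s' v w) atTop (𝓝 0) := by
  refine squeeze_zero_norm' ?_ (tendsto_const_nhds.div_atTop tendsto_id :
    Tendsto (fun t : ℝ => 6 * Real.exp (√s + √s') / t) atTop (𝓝 0))
  filter_upwards [eventually_ge_atTop 1] with t ht
  exact norm_ratio_le ht hs hs' v w

lemma tendsto_geo_mul_ratio (hs : 0 < s) (hs' : 0 < s') (v w : Circle) (φ : ℝ) :
    Tendsto (fun t : ℝ => geo (pt t (1 - φ * I) * ratio t s s' v w)) atTop (𝓝 0) := by
  refine squeeze_zero_norm' ?_ (tendsto_const_nhds.div_atTop tendsto_id :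
    Tendsto (fun t : ℝ => 1152 * Real.exp (√s + √s') ^ 2 / t) atTop (𝓝 0))
  filter_upwards [eventually_ge_atTop 1] with t ht
  exact norm_geo_mul_ratio_le ht hs hs' v w (norm_pt_one t φ)

lemma tendsto_crossKernel (γ : ℝ) (hs : 0 < s) (hs' : 0 < s') (hne : s ≠ s') (v w : Circle) (p : ℝ × ℝ) :
    Tendsto (fun t : ℝ => crossKernel γ (pt t (zetaOf p)) (pt t (sigmaOf p)) (ratio t s s' v w)
      (gap t s s' v w) / (t * √t : ℂ)) atTop (𝓝 ((sigmaOf p)⁻¹ ^ 2 * (8 * γ * ((zetaOf p)⁻¹ ^ 2 /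
        (√2 * ((√s : ℂ)⁻¹ * v - (√s' : ℂ)⁻¹ * (w : ℂ)⁻¹)))))) := by
  have hd : Tendsto (fun t : ℝ => ((del t : ℝ) : ℂ)) atTop (𝓝 ((0 : ℝ) : ℂ)) :=
    (continuous_ofReal.tendsto 0).comp tendsto_del
  have hZ : Tendsto (fun t : ℝ => geo (pt t (zetaOf p) * ratio t s s' v w)) atTop (𝓝 0) :=
    tendsto_geo_mul_ratio hs hs' v w p.1
  have hX := tendsto_geo_pt (zetaOf_ne p)
  have hP := tendsto_koebe_pt (sigmaOf_ne p)
  have hn := tendsto_ratio hs hs' v w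
  have hG := tendsto_gap hs hs' v w
  have hne' : (√2 * ((√s : ℂ)⁻¹ * v - (√s' : ℂ)⁻¹ * (w : ℂ)⁻¹)) ≠ 0 := by
    refine mul_ne_zero (by simp) (sub_ne_zero.2 fun h => hne ?_)
    have := congrArg norm h
    rw [norm_mul, norm_mul, norm_inv, norm_inv, norm_inv, Circle.norm_coe, Circle.norm_coe, norm_real,
      norm_real, inv_one, mul_one, mul_one, inv_inj, Real.norm_of_nonneg (Real.sqrt_nonneg _),
      Real.norm_of_nonneg (Real.sqrt_nonneg _)] at this
    rwa [Real.sqrt_inj hs.le hs'.le] at this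
  have h := hP.mul ((((hd.mul (hZ.pow 2)).const_mul 2).sub ((hX.mul hZ).const_mul 4)).add
    ((((hX.pow 2).mul ((hn.const_sub 1).mul ((hZ.const_add 1).pow 2))).div hG hne').const_mul (8 * γ : ℂ)))
  have e : (sigmaOf p)⁻¹ ^ 2 * (2 * (((0 : ℝ) : ℂ) * 0 ^ 2) - 4 * ((zetaOf p)⁻¹ * 0) +
      8 * γ * ((zetaOf p)⁻¹ ^ 2 * ((1 - 0) * (1 + 0) ^ 2) /
        (√2 * ((√s : ℂ)⁻¹ * v - (√s' : ℂ)⁻¹ * (w : ℂ)⁻¹)))) =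
      (sigmaOf p)⁻¹ ^ 2 * (8 * γ * ((zetaOf p)⁻¹ ^ 2 /
        (√2 * ((√s : ℂ)⁻¹ * v - (√s' : ℂ)⁻¹ * (w : ℂ)⁻¹)))) := by
    simp
  rw [e] at h
  refine h.congr' ?_
  filter_upwards [eventually_gt_atTop 0] with t ht
  have ht1 : (t : ℂ) = √t ^ 2 := by exact_mod_cast (Real.sq_sqrt ht.le).symm
  have ht0 : (√t : ℂ) ≠ 0 := by exact_mod_cast (Real.sqrt_pos.2 ht).ne'
  rw [Pi.div_apply, crossKernel, del, ofReal_inv, ht1]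
  generalize geo (pt t (zetaOf p) * ratio t s s' v w) = Z
  generalize geo (pt t (zetaOf p)) = X
  generalize koebe (pt t (sigmaOf p)) = P
  generalize ratio t s s' v w = n
  generalize gap t s s' v w = D
  generalize (√t : ℂ) = r at *
  by_cases hD : D = 0
  · rw [hD]
    simp
    field_simp
  · field_simp

def crossLimit (γ : ℝ) (z : (ℝ × ℝ) × (ℝ × Circle) × ℝ × Circle) : ℂ :=
  (2 * (Real.pi : ℂ))⁻¹ ^ 2 * ((sigmaOf z.1)⁻¹ ^ 2 * (8 * γ * ((zetaOf z.1)⁻¹ ^ 2 * (√2 : ℂ)⁻¹))) *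
    pairKernel (√2 * zetaOf z.1) (√2 * omegaOf z.1) (gaussPair z.2)

lemma tendsto_restG_windowMap (γ : ℝ) (z : (ℝ × ℝ) × (ℝ × Circle) × ℝ × Circle) (hs : 0 < z.2.1.1)
    (hs' : 0 < z.2.2.1) (hne : z.2.1.1 ≠ z.2.2.1) : Tendsto (fun t : ℝ =>
      (((2 * Real.pi)⁻¹ ^ 2 * t⁻¹ : ℝ) : ℂ) * (restG γ t (windowMap t z) / (√t : ℂ))) atTop
      (𝓝 (crossLimit γ z)) := by
  obtain ⟨p, ⟨s, v⟩, s', w⟩ := z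
  simp only at hs hs' hne
  have h := (((tendsto_crossKernel γ hs hs' hne v w p).mul (tendsto_energy1 hs (zetaOf p) v)).mul
    (tendsto_energy2 hs' (omegaOf p) w)).const_mul ((2 * (Real.pi : ℂ))⁻¹ ^ 2)
  have hs1 : (√s : ℂ) ≠ 0 := by exact_mod_cast (Real.sqrt_pos.2 hs).ne'
  have hs1' : (√s' : ℂ) ≠ 0 := by exact_mod_cast (Real.sqrt_pos.2 hs').ne'
  have hv : (v : ℂ) ≠ 0 := Circle.coe_ne_zero v
  have hw : (w : ℂ) ≠ 0 := Circle.coe_ne_zero w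
  have h2 : (√2 : ℂ) ≠ 0 := by simp
  have e1 : conj (v : ℂ) = (v : ℂ)⁻¹ := by rw [← Circle.coe_inv_eq_conj, Circle.coe_inv]
  have e2 : conj (w : ℂ) = (w : ℂ)⁻¹ := by rw [← Circle.coe_inv_eq_conj, Circle.coe_inv]
  have e : crossLimit γ (p, (s, v), s', w) = (2 * (Real.pi : ℂ))⁻¹ ^ 2 * ((sigmaOf p)⁻¹ ^ 2 *
      (8 * γ * ((zetaOf p)⁻¹ ^ 2 / (√2 * ((√s : ℂ)⁻¹ * v - (√s' : ℂ)⁻¹ * (w : ℂ)⁻¹)))) *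
      exp (√2 * zetaOf p * (√s * v + √s * (v : ℂ)⁻¹)) *
      exp (√2 * omegaOf p * (√s' * w + √s' * (w : ℂ)⁻¹))) := by
    rw [crossLimit]
    simp only [pairKernel, gaussPair, map_mul, conj_ofReal, e1, e2, map_inv₀, inv_inv]
    have e3 : √s * (v : ℂ)⁻¹ * (√s' * w) / (√s' * w - √s * (v : ℂ)⁻¹) =
        ((√s : ℂ)⁻¹ * v - (√s' : ℂ)⁻¹ * (w : ℂ)⁻¹)⁻¹ := by
      rw [show (√s : ℂ)⁻¹ * v - (√s' : ℂ)⁻¹ * (w : ℂ)⁻¹ =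
        (√s' * w - √s * (v : ℂ)⁻¹) / (√s * (v : ℂ)⁻¹ * (√s' * w)) by field_simp, inv_div]
    rw [e3, exp_add, add_comm (√s' * (w : ℂ)⁻¹)]
    simp only [div_eq_mul_inv, mul_inv]
    ring
  rw [e]
  refine h.congr' ?_
  filter_upwards [eventually_ge_atTop 1] with t ht
  have ht1 : (t : ℂ) ≠ 0 := by exact_mod_cast (by linarith : t ≠ 0)
  rw [restG_windowMap ht (p, (s, v), s', w) hs hs']
  push_cast
  simp only [div_eq_mul_inv, mul_inv]
  ring

lemma ae_nu_prod' (hγ : 0 < γ) : ∀ᵐ z ∂(volume : Measure (ℝ × ℝ)).prod ((nu γ).prod (nu γ)),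
    (0 < z.2.1.1 ∧ 0 < z.2.2.1) ∧ z.2.1.1 ≠ z.2.2.1 := by
  have := isProbabilityMeasure_nu hγ
  exact Measure.quasiMeasurePreserving_snd.ae (ae_nu_prod hγ)

lemma eventually_mem_windowSet (z : (ℝ × ℝ) × (ℝ × Circle) × ℝ × Circle) :
    ∀ᶠ t in atTop, z ∈ (arc t ×ˢ arc t) ×ˢ (univ : Set ((ℝ × Circle) × ℝ × Circle)) := by
  filter_upwards [eventually_mem_arc_prod z.1] with t ht
  exact ⟨ht, mem_univ _⟩

lemma tendsto_rest (hγ : 0 < γ) : Tendsto (fun t : ℝ =>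
    (∫ q, restG γ t q ∂(volume.prod ((nu γ).prod (nu γ)))) / (√t : ℂ)) atTop
      (𝓝 (∫ z, crossLimit γ z ∂(volume.prod ((nu γ).prod (nu γ))))) := by
  refine (tendsto_integral_window (fun t ht => isWindow_windowMap hγ ht)
    (F := fun t q => restG γ t q / (√t : ℂ))
    (fun t ht => ((measurable_restG γ t).div_const (√t : ℂ)).aestronglyMeasurable)
    (integrable_crossMajorant hγ) (fun t ht => norm_restG_le hγ ht)
    (ae_of_all _ eventually_mem_windowSet) ?_).congr fun t => ?_
  · filter_upwards [ae_nu_prod' hγ] with z hz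
    exact tendsto_restG_windowMap γ z hz.1.1 hz.1.2 hz.2
  · rw [integral_div]

lemma measurable_crossLimit (γ : ℝ) : Measurable (crossLimit γ) := by
  have hc : Measurable ((↑) : Circle → ℂ) := (by fun_prop : Continuous ((↑) : Circle → ℂ)).measurable
  unfold crossLimit pairKernel gaussPair zetaOf sigmaOf omegaOf
  fun_prop

lemma integrable_crossLimit (hγ : 0 < γ) :
    Integrable (crossLimit γ) (volume.prod ((nu γ).prod (nu γ))) := by
  refine (integrable_crossMajorant hγ).mono' (measurable_crossLimit γ).aestronglyMeasurable ?_
  have hb : ∀ᵐ z ∂(volume : Measure (ℝ × ℝ)).prod ((nu γ).prod (nu γ)), ∀ n : ℕ, z ∈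
      (arc ((n : ℝ) + 1) ×ˢ arc ((n : ℝ) + 1)) ×ˢ univ → ((2 * Real.pi)⁻¹ ^ 2 * ((n : ℝ) + 1)⁻¹) *
        ‖restG γ (n + 1) (windowMap (n + 1) z) / (√(n + 1) : ℂ)‖ ≤ crossMajorant γ z :=
    ae_all_iff.2 fun n => norm_restG_le hγ (by linarith [n.cast_nonneg (α := ℝ)])
  filter_upwards [ae_nu_prod' hγ, hb] with z hz hb
  have hn : Tendsto (fun n : ℕ => (n : ℝ) + 1) atTop atTop :=
    tendsto_atTop_add_const_right _ _ tendsto_natCast_atTop_atTop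
  refine le_of_tendsto ((tendsto_restG_windowMap γ z hz.1.1 hz.1.2 hz.2).comp hn).norm ?_
  filter_upwards [hn.eventually (eventually_mem_windowSet z)] with n h
  refine le_of_eq_of_le ?_ (hb n h)
  rw [Function.comp_apply, norm_mul, norm_real, Real.norm_of_nonneg (by positivity)]

def crossDensity (γ : ℝ) (p : ℝ × ℝ) : ℂ :=
  (2 * (Real.pi : ℂ))⁻¹ ^ 2 * ((sigmaOf p)⁻¹ ^ 2 * (8 * γ * ((zetaOf p)⁻¹ ^ 2 * (√2 : ℂ)⁻¹))) *
    pairInt γ (√2 * zetaOf p) (√2 * omegaOf p)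

lemma integral_crossLimit_snd (hγ : 0 < γ) (p : ℝ × ℝ) :
    ∫ q, crossLimit γ (p, q) ∂((nu γ).prod (nu γ)) = crossDensity γ p := by
  simp only [crossLimit, crossDensity]
  rw [integral_const_mul, pairInt, ← (measurePreserving_gaussPair hγ).map_eq,
    integral_map (measurePreserving_gaussPair hγ).aemeasurable
      (measurable_pairKernel _ _).aestronglyMeasurable]

lemma integrable_crossDensity (hγ : 0 < γ) : Integrable (crossDensity γ) := by
  have := isProbabilityMeasure_nu hγ
  exact (integrable_crossLimit hγ).integral_prod_left.congr
    (ae_of_all _ fun p => integral_crossLimit_snd hγ p)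

lemma tendsto_rest_crossDensity (hγ : 0 < γ) : Tendsto (fun t : ℝ =>
    (∫ q, restG γ t q ∂(volume.prod ((nu γ).prod (nu γ)))) / (√t : ℂ)) atTop
      (𝓝 (∫ p, crossDensity γ p)) := by
  have := isProbabilityMeasure_nu hγ
  have h := tendsto_rest hγ
  rw [integral_prod _ (integrable_crossLimit hγ)] at h
  simpa only [integral_crossLimit_snd hγ] using h

end

/-! ### Evaluation of the limiting integrals -/

noncomputable section

variable {γ : ℝ}

def reflectPlane (p : ℝ × ℝ) : ℝ × ℝ := (p.2 - p.1, p.2)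

lemma measurePreserving_reflectPlane : MeasurePreserving reflectPlane volume volume := by
  have h : MeasurePreserving (fun p : ℝ × ℝ => (p.1, p.1 - p.2)) (volume.prod volume)
      (volume.prod volume) :=
    (MeasurePreserving.id (volume : Measure ℝ)).skew_product (by fun_prop)
      (ae_of_all _ fun u => (Measure.measurePreserving_sub_left volume u).map_eq)
  exact (Measure.measurePreserving_swap.comp h).comp Measure.measurePreserving_swap

lemma zetaOf_reflectPlane (p : ℝ × ℝ) : zetaOf (reflectPlane p) = omegaOf p := rfl

lemma omegaOf_reflectPlane (p : ℝ × ℝ) : omegaOf (reflectPlane p) = zetaOf p := by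
  simp [omegaOf, zetaOf, reflectPlane]

lemma sigmaOf_reflectPlane (p : ℝ × ℝ) : sigmaOf (reflectPlane p) = sigmaOf p := rfl

lemma norm_inv_zetaOf_le (p : ℝ × ℝ) : ‖(zetaOf p)⁻¹‖ ≤ 1 := by
  simpa [zetaOf] using norm_inv_sub_mul_I_le le_rfl p.1

lemma norm_exp_sq_div (γ φ : ℝ) : ‖exp ((1 - φ * I : ℂ) ^ 2 / (2 * γ))‖ =
    Real.exp ((2 * γ)⁻¹) * Real.exp (-(2 * γ)⁻¹ * φ ^ 2) := by
  have h := norm_exp_sq (2 * γ)⁻¹ 1 φ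
  rw [one_pow, mul_one, ofReal_one] at h
  rw [← h]
  congr 2
  push_cast
  ring

lemma integrable_sideLimit (hγ : 0 < γ) : Integrable (sideLimit γ) := by
  set M := Real.exp ((2 * γ)⁻¹) with hM
  have hg : 0 < (2 * γ)⁻¹ := by positivity
  have hi := ((integrable_exp_neg_mul_sq hg).mul_prod integrable_inv_one_add_sq).const_mul
    (‖(2 * (Real.pi : ℂ))⁻¹ ^ 2‖ * (4 * M ^ 2))
  refine hi.mono' ?_ (ae_of_all _ fun p => ?_)
  · have : Measurable (sideLimit γ) := by
      unfold sideLimit zetaOf sigmaOf omegaOf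
      fun_prop
    exact this.aestronglyMeasurable
  · have h1 := norm_inv_zetaOf_le p
    have h2 : ‖(sigmaOf p)⁻¹‖ ^ 2 ≤ (1 + p.2 ^ 2)⁻¹ := by
      simpa [sigmaOf] using norm_inv_sub_mul_I_sq_le one_le_two p.2
    have h3 : ‖exp (zetaOf p ^ 2 / (2 * γ))‖ = M * Real.exp (-(2 * γ)⁻¹ * p.1 ^ 2) :=
      norm_exp_sq_div γ p.1
    have h4 : ‖exp (omegaOf p ^ 2 / (2 * γ))‖ ≤ M := by
      refine (norm_exp_sq_div γ (p.2 - p.1)).le.trans (mul_le_of_le_one_right (Real.exp_pos _).le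
        (Real.exp_le_one_iff.2 ?_))
      nlinarith [sq_nonneg (p.2 - p.1)]
    rw [sideLimit, norm_mul, norm_mul, norm_mul, norm_mul, norm_mul, h3, norm_pow, norm_ofNat]
    rw [norm_pow] at *
    calc _ ≤ ‖(2 * (Real.pi : ℂ))⁻¹‖ ^ 2 * ((1 + p.2 ^ 2)⁻¹ * (4 * 1) *
          (M * Real.exp (-(2 * γ)⁻¹ * p.1 ^ 2) * M)) := by gcongr
      _ = _ := by ring

/-- The limiting density of `2 * q2 - q1 ^ 2`. -/
def limitDensity (γ : ℝ) (p : ℝ × ℝ) : ℂ := -sideLimit γ p + 2 * crossDensity γ p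

lemma integrable_limitDensity (hγ : 0 < γ) : Integrable (limitDensity γ) :=
  (integrable_sideLimit hγ).neg.add ((integrable_crossDensity hγ).const_mul 2)

def symmDensity (γ : ℝ) (p : ℝ × ℝ) : ℂ :=
  -(2 * (Real.pi : ℂ))⁻¹ ^ 2 * (sigmaOf p * exp (sigmaOf p ^ 2 / (4 * γ))) *
    ((zetaOf p)⁻¹ ^ 2 * (omegaOf p)⁻¹ ^ 2)

lemma limitDensity_add_reflectPlane (hγ : 0 < γ) (p : ℝ × ℝ) :
    limitDensity γ p + limitDensity γ (reflectPlane p) = symmDensity γ p := by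
  have hS : sigmaOf p = zetaOf p + omegaOf p := by rw [← sigmaOf_sub_zetaOf]; ring
  have hS0 := sigmaOf_ne p
  have hz := zetaOf_ne p
  have hw := omegaOf_ne p
  have hg : (γ : ℂ) ≠ 0 := by exact_mod_cast hγ.ne'
  have h2 : (√2 : ℂ) ^ 2 = 2 := by exact_mod_cast Real.sq_sqrt (by norm_num : (0 : ℝ) ≤ 2)
  have h20 : (√2 : ℂ) ≠ 0 := by simp
  have hL := mul_pairInt hγ (√2 * zetaOf p) (√2 * omegaOf p)
  have eA : ((√2 * zetaOf p) ^ 2 + (√2 * omegaOf p) ^ 2) / (4 * γ) =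
      zetaOf p ^ 2 / (2 * γ) + omegaOf p ^ 2 / (2 * γ) := by
    rw [mul_pow, mul_pow, h2]
    field_simp
    ring
  have eB : (√2 * zetaOf p + √2 * omegaOf p) ^ 2 / (8 * γ) = sigmaOf p ^ 2 / (4 * γ) := by
    rw [← mul_add, ← hS, mul_pow, h2]
    field_simp
    ring
  rw [eA, eB, exp_add] at hL
  rw [limitDensity, limitDensity, symmDensity, sideLimit, sideLimit, crossDensity, crossDensity,
    zetaOf_reflectPlane, omegaOf_reflectPlane, sigmaOf_reflectPlane, pairInt_swap γ (√2 * zetaOf p)]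
  generalize pairInt γ (√2 * zetaOf p) (√2 * omegaOf p) = L at *
  generalize exp (zetaOf p ^ 2 / (2 * γ)) = a at *
  generalize exp (omegaOf p ^ 2 / (2 * γ)) = b at *
  generalize exp (sigmaOf p ^ 2 / (4 * γ)) = c at *
  generalize zetaOf p = z at *
  generalize omegaOf p = w at *
  generalize sigmaOf p = S at *
  generalize (√2 : ℂ) = q at *
  subst hS
  have hL' : 16 * γ * ((w - z) * L) * q⁻¹ = 4 * z * w * (a * b) - (z + w) ^ 2 * c := by
    have e : 16 * γ * ((w - z) * L) * q⁻¹ = 8 * γ * ((q * w - q * z) * L) := by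
      field_simp
      linear_combination -8 * (w - z) * L * h2
    have hg4 : (γ : ℂ) * ((4 * γ)⁻¹ : ℝ) = 1 / 4 := by
      push_cast
      field_simp
    rw [e, hL]
    linear_combination (8 * (q * z * (q * w) * (a * b) - (q * z + q * w) ^ 2 / 4 * c)) * hg4 +
      (2 * z * w * a * b - (z + w) ^ 2 * c / 2) * h2
  have e1 : -((2 * (Real.pi : ℂ))⁻¹ ^ 2 * ((z + w)⁻¹ ^ 2 * (4 * z⁻¹) * (a * b))) +
      2 * ((2 * (Real.pi : ℂ))⁻¹ ^ 2 * ((z + w)⁻¹ ^ 2 * (8 * γ * (z⁻¹ ^ 2 * q⁻¹))) * L) +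
      (-((2 * (Real.pi : ℂ))⁻¹ ^ 2 * ((z + w)⁻¹ ^ 2 * (4 * w⁻¹) * (b * a))) +
      2 * ((2 * (Real.pi : ℂ))⁻¹ ^ 2 * ((z + w)⁻¹ ^ 2 * (8 * γ * (w⁻¹ ^ 2 * q⁻¹))) * -L)) =
      (2 * (Real.pi : ℂ))⁻¹ ^ 2 * (z + w)⁻¹ ^ 2 * ((z + w) * z⁻¹ ^ 2 * w⁻¹ ^ 2 *
        (16 * γ * ((w - z) * L) * q⁻¹) - 4 * (z + w) * z⁻¹ * w⁻¹ * (a * b)) := by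
    have f1 : z⁻¹ + w⁻¹ = (z + w) * z⁻¹ * w⁻¹ := by field_simp; ring
    have f2 : z⁻¹ ^ 2 - w⁻¹ ^ 2 = (z + w) * z⁻¹ ^ 2 * w⁻¹ ^ 2 * (w - z) := by field_simp; ring
    linear_combination (2 * (Real.pi : ℂ))⁻¹ ^ 2 * (z + w)⁻¹ ^ 2 * (-4 * a * b * f1 +
      16 * γ * L * q⁻¹ * f2)
  rw [e1, hL']
  field_simp
  ring

lemma integral_symmDensity (hγ : 0 < γ) :
    ∫ p, symmDensity γ p = ((-(√(Real.pi * (4 * γ)⁻¹) * 2 / Real.pi) : ℝ) : ℂ) := by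
  have hi : Integrable (symmDensity γ) := by
    refine ((integrable_limitDensity hγ).add (measurePreserving_reflectPlane.integrable_comp_of_integrable
      (integrable_limitDensity hγ))).congr (ae_of_all _ fun p => ?_)
    exact limitDensity_add_reflectPlane hγ p
  have hl : 0 < (4 * γ)⁻¹ := by positivity
  have h1 : ∀ u : ℝ, ∫ x, symmDensity γ (x, u) = -(Real.pi : ℂ)⁻¹ * ((((2 : ℝ) - u * I : ℂ)⁻¹) ^ 2 *
      exp (((4 * γ)⁻¹ : ℝ) * ((2 : ℝ) - u * I) ^ 2)) := fun u => by
    have h := integral_inv_sq_mul_inv_sq u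
    have hS := sub_mul_I_ne two_pos u
    simp only [symmDensity, sigmaOf, zetaOf, omegaOf]
    rw [ofReal_ofNat] at *
    rw [ofReal_one] at h
    rw [integral_const_mul, h]
    have e : ((2 - u * I) ^ 2 / (4 * γ) : ℂ) = ((4 * γ)⁻¹ : ℝ) * (2 - u * I) ^ 2 := by
      push_cast
      ring
    rw [e]
    have hp : (Real.pi : ℂ) ≠ 0 := by exact_mod_cast Real.pi_ne_zero
    field_simp
    ring
  rw [show (volume : Measure (ℝ × ℝ)) = volume.prod volume from rfl, integral_prod_symm _ hi]
  simp only [h1]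
  rw [integral_const_mul, integral_inv_sq_mul_exp one_le_two hl]
  push_cast
  ring

lemma sqrt_pi_div_pi (hγ : 0 < γ) :
    √(Real.pi * (4 * γ)⁻¹) / Real.pi = 1 / √(2 * Real.pi * γ) / √2 := by
  have hp := Real.pi_pos
  rw [div_div, ← Real.sqrt_mul (by positivity)]
  have e : Real.pi * (4 * γ)⁻¹ = Real.pi ^ 2 / (2 * Real.pi * γ * 2) := by
    field_simp
    ring
  rw [e, Real.sqrt_div (by positivity), Real.sqrt_sq hp.le]
  field_simp

lemma integral_limitDensity (hγ : 0 < γ) :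
    ∫ p, limitDensity γ p = ((-(1 / √(2 * Real.pi * γ) / √2) : ℝ) : ℂ) := by
  have hi := integrable_limitDensity hγ
  have hr : ∫ p, limitDensity γ (reflectPlane p) = ∫ p, limitDensity γ p := by
    rw [← integral_map measurePreserving_reflectPlane.aemeasurable,
      measurePreserving_reflectPlane.map_eq]
    rw [measurePreserving_reflectPlane.map_eq]
    exact hi.aestronglyMeasurable
  have h : 2 * ∫ p, limitDensity γ p = ∫ p, symmDensity γ p := by
    rw [two_mul]
    nth_rw 2 [← hr]
    have hi' : Integrable fun p => limitDensity γ (reflectPlane p) :=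
      measurePreserving_reflectPlane.integrable_comp_of_integrable hi
    rw [← integral_add hi hi']
    simp only [limitDensity_add_reflectPlane hγ]
  rw [integral_symmDensity hγ] at h
  rw [← sqrt_pi_div_pi hγ]
  have e : ((-(√(Real.pi * (4 * γ)⁻¹) * 2 / Real.pi) : ℝ) : ℂ) =
      2 * ((-(√(Real.pi * (4 * γ)⁻¹) / Real.pi) : ℝ) : ℂ) := by
    push_cast
    ring
  rw [e] at h
  exact mul_left_cancel₀ two_ne_zero h

lemma tendsto_two_mul_q2_sub_sq (hγ : 0 < γ) {r : ℝ} (hr0 : 0 < r) (hr : r < 1 / (4 * γ + 4)) :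
    Tendsto (fun t : ℝ => (2 * q2 γ r t - q1 γ r t ^ 2) / (√t : ℂ)) atTop
      (𝓝 ((-(1 / √(2 * Real.pi * γ) / √2) : ℝ) : ℂ)) := by
  have hr1 : r < 1 := hr.trans (by rw [div_lt_one (by positivity)]; linarith)
  have h := ((tendsto_side hγ).neg.add ((tendsto_rest_crossDensity hγ).const_mul 2)).sub
    ((tendsto_errS14 hγ hr0 hr1).const_mul 2)
  have e : -(∫ p, sideLimit γ p) + 2 * (∫ p, crossDensity γ p) - 2 * 0 = ∫ p, limitDensity γ p := by
    have hi : Integrable fun p => -sideLimit γ p := (integrable_sideLimit hγ).neg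
    rw [mul_zero, sub_zero, ← integral_neg, ← integral_const_mul, ← integral_add hi
      ((integrable_crossDensity hγ).const_mul 2)]
    rfl
  rw [e, integral_limitDensity hγ] at h
  refine h.congr' ?_
  filter_upwards [eventually_ge_atTop 1] with t ht
  rw [q2_eq hγ ht hr0 hr (integrable_restG hγ ht), q1_eq hγ ht hr0 hr]
  have e := two_mul_main_sub_sq hγ ht
  simp only [psiPair] at e ⊢
  linear_combination -e / (√t : ℂ)

end
end VarianceAsymptotics

/-- For `γ > 0` and densities `ρ_a, ρ_b ∈ [0,1]`, the variance
`σ²(t) = (ρ_a-ρ_b)²(2q2(t) - q1(t)²) + (ρ_a+ρ_b-2ρ_aρ_b) q1(t)` satisfies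
`lim_{t→∞} σ²(t)/√t = (1/√(2πγ))·[(ρ_a+ρ_b-2ρ_aρ_b) - (ρ_a-ρ_b)²/√2]`. -/
theorem variance_asymptotics (γ ρa ρb : ℝ) (hγ : 0 < γ)
    (ha : ρa ∈ Set.Icc (0 : ℝ) 1) (hb : ρb ∈ Set.Icc (0 : ℝ) 1) :
    ∃ r0 ∈ Set.Ioo (0 : ℝ) 1, ∀ r ∈ Set.Ioo (0 : ℝ) r0,
      Tendsto
        (fun t : ℝ =>
          (((ρa - ρb : ℝ) : ℂ) ^ 2 * (2 * q2 γ r t - (q1 γ r t) ^ 2) +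
              ((ρa + ρb - 2 * ρa * ρb : ℝ) : ℂ) * q1 γ r t) / (Real.sqrt t : ℂ))
        atTop
        (nhds (((1 / Real.sqrt (2 * Real.pi * γ)) *
          ((ρa + ρb - 2 * ρa * ρb) - (ρa - ρb) ^ 2 / Real.sqrt 2) : ℝ) : ℂ)) := by
  refine ⟨1 / (4 * γ + 4), ⟨by positivity, by rw [div_lt_one (by positivity)]; linarith⟩,
    fun r hr => ?_⟩
  have h := ((VarianceAsymptotics.tendsto_two_mul_q2_sub_sq hγ hr.1 hr.2).const_mul
    (((ρa - ρb : ℝ) : ℂ) ^ 2)).add ((VarianceAsymptotics.tendsto_q1 hγ hr.1 hr.2).const_mul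
    ((ρa + ρb - 2 * ρa * ρb : ℝ) : ℂ))
  have e : ((ρa - ρb : ℝ) : ℂ) ^ 2 * ((-(1 / √(2 * Real.pi * γ) / √2) : ℝ) : ℂ) +
      ((ρa + ρb - 2 * ρa * ρb : ℝ) : ℂ) * ((1 / √(2 * Real.pi * γ) : ℝ) : ℂ) =
      (((1 / Real.sqrt (2 * Real.pi * γ)) *
        ((ρa + ρb - 2 * ρa * ρb) - (ρa - ρb) ^ 2 / Real.sqrt 2) : ℝ) : ℂ) := by
    push_cast
    ring
  rw [e] at h
  refine h.congr fun t => ?_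
  ring
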